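/- arXiv:2104.13045 — 2 statements merged into one kernel-verified Lean document; each statement's English description precedes it below -/
import Mathlib

section
/- Let d ∈ ℕ, d ≥ 1, and let ρ₀ ∈ L¹(ℝ^d) with ρ₀ ≥ 0. There exists a constant θ > 0 (depending only on d) small enough such that if T > 0 satisfies sup_{t∈(0,T]} t^{1/4} ‖G(·,t) ∗ ρ₀‖_{L^{2d/(2d−1)}(ℝ^d)} ≤ θ, then there exists exactly one mild solution ρ ∈ X_T of the mPKS equations on [0,T] in the set X_T^θ = { u ∈ X_T : sup_{t∈(0,T]} t^{1/4} ‖u(t)‖_{L^{2d/(2d−1)}} ≤ 2θ }; moreover ρ ∈ C([0,T]; L¹(ℝ^d)) with ρ(0) = ρ₀. -/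
open MeasureTheory Real Filter
open scoped ENNReal BigOperators Topology

noncomputable section

abbrev Euc (d : ℕ) : Type := EuclideanSpace ℝ (Fin d)

/-- The heat kernel on `ℝ^d`. -/
noncomputable def heatKernel (d : ℕ) (t : ℝ) (x : Euc d) : ℝ :=
  (4 * Real.pi * t) ^ (-(d : ℝ) / 2) * Real.exp (-‖x‖ ^ 2 / (4 * t))

/-- Partial derivative in the `i`-th coordinate direction. -/
noncomputable def pd {d : ℕ} {F : Type*} [NormedAddCommGroup F] [NormedSpace ℝ F]
    (i : Fin d) (f : Euc d → F) : Euc d → F :=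
  fun x => fderiv ℝ f x (EuclideanSpace.single i 1)

/-- Multi-index spatial derivative `D_x^β`. -/
noncomputable def mderiv {d : ℕ} {F : Type*} [NormedAddCommGroup F] [NormedSpace ℝ F]
    (β : Fin d → ℕ) (f : Euc d → F) : Euc d → F :=
  (List.finRange d).foldr (fun i g => (pd i)^[β i] g) f

/-- `k`-th time derivative (pointwise in space). -/
noncomputable def tderiv {d : ℕ} {F : Type*} [NormedAddCommGroup F] [NormedSpace ℝ F]
    (k : ℕ) (ρ : ℝ → Euc d → F) (t : ℝ) : Euc d → F :=
  fun x => iteratedDeriv k (fun s => ρ s x) t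

/-- Convolution of two scalar functions on `ℝ^d`. -/
noncomputable def conv {d : ℕ} (f g : Euc d → ℝ) : Euc d → ℝ :=
  fun x => ∫ y, f (x - y) * g y

/-- Convolution of a vector field with a scalar function on `ℝ^d`. -/
noncomputable def convV {d : ℕ} (f : Euc d → Euc d) (g : Euc d → ℝ) : Euc d → Euc d :=
  fun x => ∫ y, g y • f (x - y)

/-- Gradient of the heat kernel. -/
noncomputable def gradHeat (d : ℕ) (t : ℝ) : Euc d → Euc d :=
  gradient (fun x => heatKernel d t x)

/-- Gradient of the logarithmic potential `c` generated by `ρ`. -/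
noncomputable def gradc (d : ℕ) (ρ : Euc d → ℝ) (x : Euc d) : Euc d :=
  (-(1 / (d * Real.pi))) • ∫ y, (ρ y / ‖x - y‖ ^ 2) • (x - y)

/-- `|β|` for a multi-index. -/
def msize {d : ℕ} (β : Fin d → ℕ) : ℕ := ∑ i, β i

/-- The exponent `2d/(2d-1)` as an element of `ℝ≥0∞`. -/
noncomputable def qd (d : ℕ) : ℝ≥0∞ := (2 * d : ℝ≥0∞) / (2 * d - 1 : ℝ≥0∞)

/-- Right-hand side of the Duhamel formula for the mPKS equations. -/
noncomputable def mildRHS (d : ℕ) (ρ₀ : Euc d → ℝ) (ρ : ℝ → Euc d → ℝ) (t : ℝ) (x : Euc d) : ℝ :=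
  conv (heatKernel d t) ρ₀ x -
    ∫ s in Set.Ioc (0:ℝ) t,
      ∫ y, (inner ℝ (gradHeat d (t - s) (x - y)) (ρ s y • gradc d (ρ s) y) : ℝ)

/-- Mild solution of the mPKS equations on `[0,T]`. -/
def IsMildSolution (d : ℕ) (ρ₀ : Euc d → ℝ) (T : ℝ) (ρ : ℝ → Euc d → ℝ) : Prop :=
  ∀ t ∈ Set.Ioc (0:ℝ) T, ∀ x, ρ t x = mildRHS d ρ₀ ρ t x

/-- Membership in the space `X_T`. -/
def MemXT (d : ℕ) (T : ℝ) (ρ : ℝ → Euc d → ℝ) : Prop :=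
  (∀ t ∈ Set.Ioc (0:ℝ) T, MemLp (ρ t) 1 volume) ∧
  (∀ t ∈ Set.Ioc (0:ℝ) T,
    Filter.Tendsto (fun s => eLpNorm (fun x => ρ s x - ρ t x) 1 volume)
      (nhdsWithin t (Set.Ioc (0:ℝ) T)) (nhds 0)) ∧
  (∃ C : ℝ≥0∞, C ≠ ⊤ ∧ ∀ t ∈ Set.Ioc (0:ℝ) T, eLpNorm (ρ t) 1 volume ≤ C) ∧
  (∃ C : ℝ≥0∞, C ≠ ⊤ ∧ ∀ t ∈ Set.Ioc (0:ℝ) T,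
    ENNReal.ofReal (t ^ (1/4 : ℝ)) * eLpNorm (ρ t) (qd d) volume ≤ C)

/-- Assumption (𝒜): decay of the heat semigroup applied to `ρ₀`. -/
def AssumptionA (d : ℕ) (ρ₀ : Euc d → ℝ) (T θ : ℝ) : Prop :=
  ∀ q : ℝ≥0∞, 1 ≤ q → ∀ t ∈ Set.Ioc (0:ℝ) T,
    ENNReal.ofReal (t ^ (((d : ℝ) / 2) * (1 - q⁻¹.toReal))) *
      eLpNorm (conv (heatKernel d t) ρ₀) q volume ≤ ENNReal.ofReal θ


/-- real version of the exponent -/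
def pR (d : ℕ) : ℝ := (2 * d : ℝ) / (2 * d - 1)

lemma two_d_pos {d : ℕ} (hd : 1 ≤ d) : (0:ℝ) < 2 * d - 1 := by
  have : (1:ℝ) ≤ d := by exact_mod_cast hd
  linarith

lemma pR_gt {d : ℕ} (hd : 1 ≤ d) : 1 < pR d := by
  unfold pR
  rw [lt_div_iff₀ (two_d_pos hd)]; linarith

lemma pR_inv {d : ℕ} (hd : 1 ≤ d) : 1 / pR d = 1 - 1 / (2 * d) := by
  have := two_d_pos hd
  have h : (1:ℝ) ≤ d := by exact_mod_cast hd
  unfold pR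
  field_simp

lemma pR_conj {d : ℕ} (hd : 1 ≤ d) : (pR d).HolderConjugate (2 * d) := by
  rw [Real.holderConjugate_iff]
  refine ⟨pR_gt hd, ?_⟩
  have := pR_inv hd
  rw [one_div, one_div] at this
  rw [this]; ring

lemma qd_eq {d : ℕ} (hd : 1 ≤ d) : qd d = ENNReal.ofReal (pR d) := by
  unfold qd pR
  rw [ENNReal.ofReal_div_of_pos (two_d_pos hd), ENNReal.ofReal_sub _ (by norm_num),
    ENNReal.ofReal_mul (by norm_num)]
  simp

lemma qd_toReal {d : ℕ} (hd : 1 ≤ d) : (qd d).toReal = pR d := by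
  rw [qd_eq hd, ENNReal.toReal_ofReal (by linarith [pR_gt hd])]

lemma qd_one_le {d : ℕ} (hd : 1 ≤ d) : 1 ≤ qd d := by
  rw [qd_eq hd]; simp; exact (pR_gt hd).le

lemma qd_ne_top {d : ℕ} (hd : 1 ≤ d) : qd d ≠ ∞ := by
  rw [qd_eq hd]; simp

lemma qd_ne_zero {d : ℕ} (hd : 1 ≤ d) : qd d ≠ 0 :=
  (lt_of_lt_of_le zero_lt_one (qd_one_le hd)).ne'

lemma eLpNorm_qd {d : ℕ} (hd : 1 ≤ d) {α F : Type*} [MeasurableSpace α] [NormedAddCommGroup F]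
    (f : α → F) (μ : Measure α) :
    eLpNorm f (qd d) μ = (∫⁻ x, ‖f x‖ₑ ^ (pR d) ∂μ) ^ (1 / pR d) := by
  rw [eLpNorm_eq_lintegral_rpow_enorm_toReal (qd_ne_zero hd) (qd_ne_top hd), qd_toReal hd]

lemma lintegral_scale (d : ℕ) {R : ℝ} (hR : 0 < R) (f : Euc d → ℝ≥0∞) (hf : Measurable f) :
    ∫⁻ z, f z = ENNReal.ofReal (R ^ d) * ∫⁻ z, f (R • z) := by
  have h := Measure.map_addHaar_smul (volume : Measure (Euc d)) hR.ne'
  have h2 : ∫⁻ z, f (R • z) = ∫⁻ z, f z ∂(Measure.map (R • ·) (volume : Measure (Euc d))) := by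
    rw [lintegral_map hf (measurable_const_smul R)]
  rw [h2, h, lintegral_smul_measure, smul_eq_mul, ← mul_assoc, ← ENNReal.ofReal_mul (by positivity)]
  simp only [finrank_euclideanSpace, Fintype.card_fin]
  rw [abs_of_pos (by positivity), mul_inv_cancel₀ (by positivity)]
  simp

/-- the singular kernel -/
def kk {d : ℕ} (z : Euc d) : ℝ≥0∞ := ENNReal.ofReal (‖z‖⁻¹)

lemma measurable_kk {d : ℕ} : Measurable (kk (d := d)) := by
  unfold kk; fun_prop

lemma kk_smul {d : ℕ} {R : ℝ} (hR : 0 < R) (z : Euc d) :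
    kk (R • z) = ENNReal.ofReal (R⁻¹) * kk z := by
  unfold kk
  rw [norm_smul, mul_inv, ENNReal.ofReal_mul (by positivity)]
  simp [abs_of_pos hR]

lemma kk_near (d : ℕ) (hd : 2 ≤ d) : ∃ c : ℝ≥0∞, c ≠ ⊤ ∧ ∀ R : ℝ, 0 < R →
    ∫⁻ z in Metric.ball (0 : Euc d) R, kk z ≤ c * ENNReal.ofReal (R ^ ((d:ℝ) - 1)) := by
  refine ⟨∫⁻ z in Metric.ball (0 : Euc d) 1, kk z, ?_, ?_⟩
  · have : IntegrableOn (fun z : Euc d => ‖z‖⁻¹) (Metric.ball 0 1) volume := by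
      refine integrableOn_ball_of_norm_le_rpow (C := 1) (α := 1) ?_ ?_ ?_ ?_
      · simp; omega
      · simp; omega
      · refine Eventually.of_forall fun x => ?_
        rw [Real.rpow_neg_one]; simp
      · exact Measurable.aestronglyMeasurable (by fun_prop)
    have h2 := this.2
    rw [hasFiniteIntegral_iff_norm] at h2
    refine (lt_of_le_of_lt (le_of_eq ?_) h2).ne
    simp [kk]
  · intro R hR
    rw [← lintegral_indicator Metric.isOpen_ball.measurableSet,
      ← lintegral_indicator Metric.isOpen_ball.measurableSet,
      lintegral_scale d hR _ (measurable_kk.indicator Metric.isOpen_ball.measurableSet)]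
    have : ∀ z : Euc d, (Metric.ball (0 : Euc d) R).indicator kk (R • z) =
        ENNReal.ofReal (R⁻¹) * (Metric.ball (0 : Euc d) 1).indicator kk z := by
      intro z
      by_cases hz : ‖z‖ < 1
      · have : ‖R • z‖ < R := by
          rw [norm_smul, Real.norm_of_nonneg hR.le]; nlinarith
        rw [Set.indicator_of_mem (by simpa using this), Set.indicator_of_mem (by simpa using hz),
          kk_smul hR]
      · have : ¬ ‖R • z‖ < R := by
          rw [norm_smul, Real.norm_of_nonneg hR.le]; nlinarith
        rw [Set.indicator_of_notMem (by simpa using this),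
          Set.indicator_of_notMem (by simpa using hz), mul_zero]
    simp_rw [this]
    rw [lintegral_const_mul _ (measurable_kk.indicator Metric.isOpen_ball.measurableSet),
      ← mul_assoc, ← ENNReal.ofReal_mul (by positivity), mul_comm]
    refine le_of_eq ?_
    congr 2
    rw [Real.rpow_sub hR, Real.rpow_natCast, Real.rpow_one]; rfl

lemma kk_far (d : ℕ) (hd : 1 ≤ d) : ∃ c : ℝ≥0∞, c ≠ ⊤ ∧ ∀ R : ℝ, 0 < R →
    ∫⁻ z in (Metric.ball (0 : Euc d) R)ᶜ, kk z ^ (2 * d : ℝ) ≤ c * ENNReal.ofReal (R ^ (-(d:ℝ))) := by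
  refine ⟨∫⁻ z in (Metric.ball (0 : Euc d) 1)ᶜ, kk z ^ (2 * d : ℝ), ?_, ?_⟩
  · have h1 : (1:ℝ) ≤ d := by exact_mod_cast hd
    have hi : Integrable (fun x : Euc d => (1 + ‖x‖) ^ (-(2 * d : ℝ))) volume := by
      apply integrable_one_add_norm
      simp; linarith
    have h2 := (hi.const_mul (2 ^ (2 * d : ℝ))).2
    rw [hasFiniteIntegral_iff_norm] at h2
    refine (lt_of_le_of_lt ?_ h2).ne
    refine le_trans (setLIntegral_mono' Metric.isOpen_ball.measurableSet.compl ?_)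
      (setLIntegral_le_lintegral (Metric.ball (0 : Euc d) 1)ᶜ _)
    intro z hz
    have hz : 1 ≤ ‖z‖ := by simpa using hz
    rw [kk, ENNReal.ofReal_rpow_of_nonneg (by positivity) (by positivity)]
    apply ENNReal.ofReal_le_ofReal
    rw [Real.norm_of_nonneg (by positivity), Real.rpow_neg (by positivity), ← Real.inv_rpow (by positivity),
      ← Real.mul_rpow (by positivity) (by positivity)]
    apply Real.rpow_le_rpow (by positivity) _ (by positivity)
    rw [inv_le_iff_one_le_mul₀ (by positivity)]
    field_simp
    linarith
  · intro R hR
    have hm : Measurable (fun z : Euc d => kk z ^ (2 * d : ℝ)) := measurable_kk.pow_const _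
    have hms := (Metric.isOpen_ball (x := (0: Euc d)) (ε := R)).measurableSet.compl
    have hms1 := (Metric.isOpen_ball (x := (0: Euc d)) (ε := 1)).measurableSet.compl
    rw [← lintegral_indicator hms,
      ← lintegral_indicator hms1,
      lintegral_scale d hR _ (hm.indicator hms)]
    have : ∀ z : Euc d, (Metric.ball (0 : Euc d) R)ᶜ.indicator (fun z => kk z ^ (2 * d : ℝ)) (R • z) =
        ENNReal.ofReal (R⁻¹) ^ (2 * d : ℝ) *
          (Metric.ball (0 : Euc d) 1)ᶜ.indicator (fun z => kk z ^ (2 * d : ℝ)) z := by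
      intro z
      by_cases hz : ‖z‖ < 1
      · have : ‖R • z‖ < R := by
          rw [norm_smul, Real.norm_of_nonneg hR.le]; nlinarith
        rw [Set.indicator_of_notMem (by simpa using this), Set.indicator_of_notMem (by simpa using hz),
          mul_zero]
      · have : ¬ ‖R • z‖ < R := by
          rw [norm_smul, Real.norm_of_nonneg hR.le]; nlinarith
        rw [Set.indicator_of_mem (by simpa using this),
          Set.indicator_of_mem (by simpa using hz), kk_smul hR,
          ENNReal.mul_rpow_of_nonneg _ _ (by positivity)]
    simp_rw [this]
    rw [lintegral_const_mul _ (hm.indicator hms1), ENNReal.ofReal_rpow_of_pos (by positivity),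
      ← mul_assoc, ← ENNReal.ofReal_mul (by positivity), mul_comm]
    refine le_of_eq ?_
    congr 2
    rw [Real.inv_rpow hR.le, ← Real.rpow_neg hR.le, ← Real.rpow_natCast, ← Real.rpow_add hR]
    congr 1; ring

/-- one-sided truncated bound -/
lemma hls_trunc (d : ℕ) (hd : 2 ≤ d) : ∃ C : ℝ≥0∞, C ≠ ⊤ ∧ ∀ g : Euc d → ℝ≥0∞, Measurable g →
    ∫⁻ y, g y ^ pR d ≤ 1 → ∀ a : ℝ≥0∞, a ≠ ⊤ → ∀ x : Euc d,
      a * ∫⁻ y in {y | g y ≤ a}, g y * kk (x - y) ≤ C * a ^ pR d := by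
  obtain ⟨c1, hc1, h1⟩ := kk_near d hd
  obtain ⟨c2, hc2, h2⟩ := kk_far d (by omega)
  have hd1 : (2:ℝ) ≤ d := by exact_mod_cast hd
  refine ⟨c1 + c2 ^ (1 / (2 * d : ℝ)), by finiteness, ?_⟩
  intro g hg hg1 a ha x
  obtain ⟨a, rfl⟩ : ∃ b : NNReal, a = b := ⟨a.toNNReal, by simp [ha]⟩
  rcases eq_or_ne a 0 with rfl | ha0
  · simp
  have hapos : (0:ℝ) < a := by positivity
  set R : ℝ := (a:ℝ) ^ (-(2 / (2 * (d:ℝ) - 1))) with hRdef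
  have hR : 0 < R := by positivity
  have hkm : Measurable fun y => kk (x - y) := measurable_kk.comp (measurable_const.sub measurable_id)
  have hS : MeasurableSet {y | g y ≤ (a:ℝ≥0∞)} := hg measurableSet_Iic
  have hB : MeasurableSet (Metric.ball x R) := Metric.isOpen_ball.measurableSet
  have near : ∫⁻ y in Metric.ball x R, kk (x - y) ≤ c1 * ENNReal.ofReal (R ^ ((d:ℝ) - 1)) := by
    refine le_trans (le_of_eq ?_) (h1 R hR)
    rw [← lintegral_indicator hB, ← lintegral_indicator Metric.isOpen_ball.measurableSet,
      ← lintegral_sub_left_eq_self _ x]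
    refine lintegral_congr fun y => ?_
    simp only [Set.indicator, Metric.mem_ball, dist_eq_norm, sub_zero]
    rw [sub_sub_cancel, show x - y - x = -y by abel, norm_neg]
  have far : ∫⁻ y in (Metric.ball x R)ᶜ, kk (x - y) ^ (2 * d : ℝ) ≤ c2 * ENNReal.ofReal (R ^ (-(d:ℝ))) := by
    refine le_trans (le_of_eq ?_) (h2 R hR)
    rw [← lintegral_indicator hB.compl, ← lintegral_indicator Metric.isOpen_ball.measurableSet.compl,
      ← lintegral_sub_left_eq_self _ x]
    refine lintegral_congr fun y => ?_
    simp only [Set.indicator, Set.mem_compl_iff, Metric.mem_ball, dist_eq_norm, sub_zero]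
    rw [sub_sub_cancel, show x - y - x = -y by abel, norm_neg]
  have split : ∫⁻ y in {y | g y ≤ a}, g y * kk (x - y) ≤
      a * (∫⁻ y in Metric.ball x R, kk (x - y)) + ∫⁻ y in (Metric.ball x R)ᶜ, g y * kk (x - y) := by
    rw [← lintegral_indicator hS, ← lintegral_indicator hB, ← lintegral_indicator hB.compl,
      ← lintegral_const_mul _ (hkm.indicator hB), ← lintegral_add_left ((hkm.indicator hB).const_mul _)]
    refine lintegral_mono fun y => ?_
    by_cases h : y ∈ Metric.ball x R
    · rw [Set.indicator_of_mem h, Set.indicator_of_notMem (s := (Metric.ball x R)ᶜ) (by simpa using h), add_zero]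
      by_cases h' : g y ≤ a
      · rw [Set.indicator_of_mem (by exact h')]
        gcongr
      · rw [Set.indicator_of_notMem (by exact h')]; exact zero_le
    · rw [Set.indicator_of_notMem h, Set.indicator_of_mem (show y ∈ (Metric.ball x R)ᶜ from h),
        mul_zero, zero_add]
      by_cases h' : g y ≤ a
      · rw [Set.indicator_of_mem (by exact h')]
      · rw [Set.indicator_of_notMem (by exact h')]; exact zero_le
  have hold : ∫⁻ y in (Metric.ball x R)ᶜ, g y * kk (x - y) ≤
      c2 ^ (1 / (2 * d : ℝ)) * ENNReal.ofReal (R ^ (-(1/2:ℝ))) := by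
    refine (ENNReal.lintegral_mul_le_Lp_mul_Lq _ (pR_conj (d := d) (by omega)) hg.aemeasurable
      hkm.aemeasurable).trans ?_
    have e1 : (∫⁻ y in (Metric.ball x R)ᶜ, g y ^ pR d) ^ (1 / pR d) ≤ 1 := by
      apply ENNReal.rpow_le_one ((setLIntegral_le_lintegral _ _).trans hg1)
      have := pR_gt (d := d) (by omega); positivity
    have e2 : (∫⁻ y in (Metric.ball x R)ᶜ, kk (x - y) ^ (2 * d : ℝ)) ^ (1 / (2 * d : ℝ)) ≤
        c2 ^ (1 / (2 * d : ℝ)) * ENNReal.ofReal (R ^ (-(1/2:ℝ))) := by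
      refine (ENNReal.rpow_le_rpow far (by positivity)).trans (le_of_eq ?_)
      rw [ENNReal.mul_rpow_of_nonneg _ _ (by positivity), ENNReal.ofReal_rpow_of_pos (by positivity),
        ← Real.rpow_mul hR.le]
      congr 3
      field_simp
    calc _ ≤ 1 * _ := mul_le_mul' e1 e2
      _ = _ := one_mul _
  have key1 : (a:ℝ≥0∞) * (a * ENNReal.ofReal (R ^ ((d:ℝ) - 1))) = (a:ℝ≥0∞) ^ pR d := by
    rw [← ENNReal.ofReal_coe_nnreal, ENNReal.ofReal_rpow_of_pos hapos, ← ENNReal.ofReal_mul (by positivity),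
      ← ENNReal.ofReal_mul (by positivity), hRdef, ← Real.rpow_mul hapos.le]
    congr 1
    conv_lhs => rw [← mul_assoc, ← Real.rpow_one (a:ℝ), ← Real.rpow_add hapos, Real.rpow_one, ← Real.rpow_add hapos]
    congr 1
    unfold pR
    have := two_d_pos (d := d) (by omega)
    have hne : 2 * (d:ℝ) - 1 ≠ 0 := this.ne'
    field_simp
    ring
  have key2 : (a:ℝ≥0∞) * ENNReal.ofReal (R ^ (-(1/2:ℝ))) = (a:ℝ≥0∞) ^ pR d := by
    rw [← ENNReal.ofReal_coe_nnreal, ENNReal.ofReal_rpow_of_pos hapos, ← ENNReal.ofReal_mul (by positivity),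
      hRdef, ← Real.rpow_mul hapos.le]
    congr 1
    conv_lhs => rw [← Real.rpow_one (a:ℝ), ← Real.rpow_mul hapos.le, ← Real.rpow_add hapos]
    congr 1
    unfold pR
    have := two_d_pos (d := d) (by omega)
    have hne : 2 * (d:ℝ) - 1 ≠ 0 := this.ne'
    field_simp
    ring
  calc (a:ℝ≥0∞) * ∫⁻ y in {y | g y ≤ a}, g y * kk (x - y)
      ≤ a * (a * (c1 * ENNReal.ofReal (R ^ ((d:ℝ) - 1))) +
        c2 ^ (1 / (2 * d : ℝ)) * ENNReal.ofReal (R ^ (-(1/2:ℝ)))) := by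
        gcongr
        exact split.trans (by gcongr)
    _ = c1 * (a * (a * ENNReal.ofReal (R ^ ((d:ℝ) - 1)))) +
        c2 ^ (1 / (2 * d : ℝ)) * (a * ENNReal.ofReal (R ^ (-(1/2:ℝ)))) := by ring
    _ = _ := by rw [key1, key2]; ring

lemma hls_one (d : ℕ) (hd : 2 ≤ d) : ∃ C : ℝ≥0∞, C ≠ ⊤ ∧ ∀ f g : Euc d → ℝ≥0∞, Measurable f →
    Measurable g → ∫⁻ y, f y ^ pR d ≤ 1 → ∫⁻ y, g y ^ pR d ≤ 1 →
      ∫⁻ x, ∫⁻ y, f x * (g y * kk (x - y)) ≤ C := by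
  obtain ⟨C, hC, h⟩ := hls_trunc d hd
  have hp : 0 < pR d := by linarith [pR_gt (d := d) (by omega)]
  have half : ∀ f g : Euc d → ℝ≥0∞, Measurable f → Measurable g → ∫⁻ y, f y ^ pR d ≤ 1 →
      ∫⁻ y, g y ^ pR d ≤ 1 → ∫⁻ x, ∫⁻ y in {y | g y ≤ f x}, f x * (g y * kk (x - y)) ≤ C := by
    intro f g hf hg hf1 hg1
    have hfin : ∀ᵐ x, f x < ⊤ := by
      have : ∀ᵐ x, f x ^ pR d < ⊤ :=
        ae_lt_top (hf.pow_const _) (lt_of_le_of_lt hf1 ENNReal.one_lt_top).ne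
      filter_upwards [this] with x hx
      exact (ENNReal.rpow_lt_top_iff_of_pos hp).1 hx
    calc _ ≤ ∫⁻ x, C * f x ^ pR d := by
          refine lintegral_mono_ae ?_
          filter_upwards [hfin] with x hx
          rw [lintegral_const_mul]
          · exact h g hg hg1 (f x) hx.ne x
          · exact hg.mul (measurable_kk.comp (measurable_const.sub measurable_id))
      _ = C * ∫⁻ x, f x ^ pR d := lintegral_const_mul _ (hf.pow_const _)
      _ ≤ C * 1 := by gcongr
      _ = C := mul_one _
  refine ⟨C + C, by finiteness, ?_⟩
  intro f g hf hg hf1 hg1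
  have hsub : Measurable fun z : Euc d × Euc d => z.1 - z.2 := by fun_prop
  have hm : Measurable fun z : Euc d × Euc d => f z.1 * (g z.2 * kk (z.1 - z.2)) :=
    (hf.comp measurable_fst).mul ((hg.comp measurable_snd).mul (measurable_kk.comp hsub))
  have hS : MeasurableSet {z : Euc d × Euc d | g z.2 ≤ f z.1} :=
    measurableSet_le (hg.comp measurable_snd) (hf.comp measurable_fst)
  calc ∫⁻ x, ∫⁻ y, f x * (g y * kk (x - y))
      ≤ ∫⁻ x, ((∫⁻ y in {y | g y ≤ f x}, f x * (g y * kk (x - y))) +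
          ∫⁻ y, {y | f x ≤ g y}.indicator (fun y => f x * (g y * kk (x - y))) y) := by
        refine lintegral_mono fun x => ?_
        rw [← lintegral_indicator (measurableSet_le hg measurable_const), ← lintegral_add_left]
        · refine lintegral_mono fun y => ?_
          simp only [Set.indicator, Set.mem_ofPred_eq]
          rcases le_total (g y) (f x) with h | h
          · simp [h]
          · simp [h]
        · refine Measurable.indicator ?_ (measurableSet_le hg measurable_const)
          exact hm.comp (measurable_const.prodMk measurable_id)
    _ = (∫⁻ x, (∫⁻ y in {y | g y ≤ f x}, f x * (g y * kk (x - y)))) +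
          ∫⁻ x, ∫⁻ y, {y | f x ≤ g y}.indicator (fun y => f x * (g y * kk (x - y))) y := by
        rw [lintegral_add_left]
        have : ∀ x, ∫⁻ y in {y | g y ≤ f x}, f x * (g y * kk (x - y)) =
          ∫⁻ y, {z : Euc d × Euc d | g z.2 ≤ f z.1}.indicator
            (fun z => f z.1 * (g z.2 * kk (z.1 - z.2))) (x, y) := by
          intro x
          rw [← lintegral_indicator (measurableSet_le hg measurable_const)]; rfl
        simp_rw [this]
        exact (hm.indicator hS).lintegral_prod_right'
    _ ≤ C + C := by
        gcongr
        · exact half f g hf hg hf1 hg1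
        · rw [lintegral_lintegral_swap]
          · refine le_trans (le_of_eq ?_) (half g f hg hf hg1 hf1)
            refine lintegral_congr fun y => ?_
            rw [← lintegral_indicator (measurableSet_le hf measurable_const)]
            refine lintegral_congr fun x => ?_
            simp only [Set.indicator, Set.mem_ofPred_eq]
            split_ifs
            · rw [kk, kk, norm_sub_rev]; ring
            · rfl
          · have hS' : MeasurableSet {z : Euc d × Euc d | f z.1 ≤ g z.2} :=
              measurableSet_le (hf.comp measurable_fst) (hg.comp measurable_snd)
            exact (hm.indicator hS').aemeasurable

/-- Diagonal Hardy-Littlewood-Sobolev inequality. -/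
lemma hls (d : ℕ) (hd : 2 ≤ d) : ∃ C : ℝ≥0∞, C ≠ ⊤ ∧ ∀ f g : Euc d → ℝ≥0∞, Measurable f →
    Measurable g → ∫⁻ y, f y ^ pR d ≠ ⊤ → ∫⁻ y, g y ^ pR d ≠ ⊤ →
      ∫⁻ x, ∫⁻ y, f x * (g y * kk (x - y)) ≤
        C * ((∫⁻ y, f y ^ pR d) ^ (1 / pR d) * (∫⁻ y, g y ^ pR d) ^ (1 / pR d)) := by
  obtain ⟨C, hC, h⟩ := hls_one d hd
  have hp : 0 < pR d := by linarith [pR_gt (d := d) (by omega)]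
  refine ⟨C, hC, ?_⟩
  intro f g hf hg hf1 hg1
  have zero : ∀ f : Euc d → ℝ≥0∞, Measurable f → ∫⁻ y, f y ^ pR d = 0 → ∀ᵐ x, f x = 0 := by
    intro f hf h0
    rw [lintegral_eq_zero_iff (hf.pow_const _)] at h0
    filter_upwards [h0] with x hx
    simpa [hp, hp.le, not_lt.2 hp.le] using hx
  by_cases hf0 : ∫⁻ y, f y ^ pR d = 0
  · have : ∫⁻ x, ∫⁻ y, f x * (g y * kk (x - y)) = ∫⁻ x : Euc d, 0 := by
      refine lintegral_congr_ae ?_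
      filter_upwards [zero f hf hf0] with x hx
      simp [hx]
    rw [this]; simp
  by_cases hg0 : ∫⁻ y, g y ^ pR d = 0
  · have : ∫⁻ x, ∫⁻ y, f x * (g y * kk (x - y)) = ∫⁻ x : Euc d, 0 := by
      refine lintegral_congr fun x => ?_
      rw [← lintegral_zero (μ := (volume : Measure (Euc d)))]
      refine lintegral_congr_ae ?_
      filter_upwards [zero g hg hg0] with y hy
      simp [hy]
    rw [this]; simp
  set A := (∫⁻ y, f y ^ pR d) ^ (1 / pR d) with hA
  set B := (∫⁻ y, g y ^ pR d) ^ (1 / pR d) with hB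
  have hA0 : A ≠ 0 := by simp [hA, hf0, hf1]
  have hAt : A ≠ ⊤ := by simp [hA, hf0, hf1]
  have hB0 : B ≠ 0 := by simp [hB, hg0, hg1]
  have hBt : B ≠ ⊤ := by simp [hB, hg0, hg1]
  have nrm : ∀ f : Euc d → ℝ≥0∞, Measurable f → ∫⁻ y, f y ^ pR d ≠ 0 → ∫⁻ y, f y ^ pR d ≠ ⊤ →
      ∫⁻ y, (((∫⁻ y, f y ^ pR d) ^ (1 / pR d))⁻¹ * f y) ^ pR d ≤ 1 := by
    intro f hf h0 h1
    simp_rw [ENNReal.mul_rpow_of_nonneg _ _ hp.le]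
    rw [lintegral_const_mul _ (hf.pow_const _), ENNReal.inv_rpow, ← ENNReal.rpow_mul,
      one_div_mul_cancel hp.ne', ENNReal.rpow_one, ENNReal.inv_mul_cancel h0 h1]
  have := h (fun x => A⁻¹ * f x) (fun x => B⁻¹ * g x) (hf.const_mul _) (hg.const_mul _)
    (nrm f hf hf0 hf1) (nrm g hg hg0 hg1)
  have e : ∫⁻ x, ∫⁻ y, f x * (g y * kk (x - y)) =
      (A * B) * ∫⁻ x, ∫⁻ y, A⁻¹ * f x * (B⁻¹ * g y * kk (x - y)) := by
    rw [← lintegral_const_mul' _ _ (by finiteness)]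
    refine lintegral_congr fun x => ?_
    rw [← lintegral_const_mul' _ _ (by finiteness)]
    refine lintegral_congr fun y => ?_
    calc f x * (g y * kk (x - y)) = (A * A⁻¹) * (B * B⁻¹) * (f x * (g y * kk (x - y))) := by
          rw [ENNReal.mul_inv_cancel hA0 hAt, ENNReal.mul_inv_cancel hB0 hBt]; simp
      _ = _ := by ring
  rw [e, mul_comm C]
  gcongr

/-- the absolute potential -/
def pot {d : ℕ} (h : Euc d → ℝ) (y : Euc d) : ℝ≥0∞ := ∫⁻ z, ‖h z‖ₑ * kk (y - z)

lemma enorm_kernel {d : ℕ} (a : ℝ) (w : Euc d) : ‖(a / ‖w‖ ^ 2) • w‖ₑ = ‖a‖ₑ * kk w := by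
  rw [kk, ← ofReal_norm_eq_enorm, ← ofReal_norm_eq_enorm, ← ENNReal.ofReal_mul (by positivity), norm_smul]
  congr 1
  rw [norm_div]
  by_cases h : ‖w‖ = 0
  · simp [h]
  · simp only [norm_pow, norm_norm]; field_simp

lemma measurable_kernel {d : ℕ} {h : Euc d → ℝ} (hh : Measurable h) (y : Euc d) :
    Measurable (fun z => (h z / ‖y - z‖ ^ 2) • (y - z)) := by fun_prop

lemma gradc_le {d : ℕ} (hd : 1 ≤ d) (h : Euc d → ℝ) (y : Euc d) : ‖gradc d h y‖ₑ ≤ pot h y := by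
  unfold gradc
  rw [enorm_smul]
  have h1 : ‖-(1 / (d * Real.pi))‖ₑ ≤ 1 := by
    rw [enorm_neg, ← ofReal_norm_eq_enorm]
    apply ENNReal.ofReal_le_one.2
    have h1 : (1:ℝ) ≤ d := by exact_mod_cast hd
    have := Real.pi_gt_three
    rw [Real.norm_of_nonneg (by positivity), div_le_one (by positivity)]
    nlinarith
  calc _ ≤ 1 * ∫⁻ z, ‖(h z / ‖y - z‖ ^ 2) • (y - z)‖ₑ := mul_le_mul' h1 (enorm_integral_le_lintegral_enorm _)
    _ = _ := by simp_rw [enorm_kernel]; rw [one_mul]; rfl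

lemma integrable_kernel {d : ℕ} {h : Euc d → ℝ} (hh : Measurable h) {y : Euc d} (hp : pot h y < ⊤) :
    Integrable (fun z => (h z / ‖y - z‖ ^ 2) • (y - z)) := by
  refine ⟨(measurable_kernel hh y).aestronglyMeasurable, ?_⟩
  rw [hasFiniteIntegral_iff_enorm]
  simp_rw [enorm_kernel]
  exact hp

lemma gradc_sub {d : ℕ} {f g : Euc d → ℝ} (hf : Measurable f) (hg : Measurable g) {y : Euc d}
    (hpf : pot f y < ⊤) (hpg : pot g y < ⊤) :
    gradc d f y - gradc d g y = gradc d (fun z => f z - g z) y := by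
  unfold gradc
  rw [← smul_sub, ← integral_sub (integrable_kernel hf hpf) (integrable_kernel hg hpg)]
  congr 2
  ext1 z
  rw [← sub_smul, sub_div]

lemma measurable_pot {d : ℕ} {h : Euc d → ℝ} (hh : Measurable h) : Measurable (pot h) := by
  have hsub : Measurable fun z : Euc d × Euc d => z.1 - z.2 := by fun_prop
  have : Measurable fun z : Euc d × Euc d => ‖h z.2‖ₑ * kk (z.1 - z.2) :=
    (hh.comp measurable_snd).enorm.mul (measurable_kk.comp hsub)
  exact this.lintegral_prod_right'

lemma hls' (d : ℕ) (hd : 2 ≤ d) : ∃ C : ℝ≥0∞, C ≠ ⊤ ∧ ∀ f g : Euc d → ℝ, Measurable f →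
    Measurable g → eLpNorm f (qd d) volume ≠ ⊤ → eLpNorm g (qd d) volume ≠ ⊤ →
      ∫⁻ x, ‖f x‖ₑ * pot g x ≤
        C * (eLpNorm f (qd d) volume * eLpNorm g (qd d) volume) := by
  obtain ⟨C, hC, h⟩ := hls d hd
  have hp : 0 < pR d := by linarith [pR_gt (d := d) (by omega)]
  refine ⟨C, hC, fun f g hf hg hft hgt => ?_⟩
  have e := h (fun x => ‖f x‖ₑ) (fun x => ‖g x‖ₑ) hf.enorm hg.enorm ?_ ?_
  · rw [← eLpNorm_qd (by omega), ← eLpNorm_qd (by omega)] at e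
    refine le_trans (le_of_eq ?_) e
    refine lintegral_congr fun x => ?_
    rw [pot, lintegral_const_mul _]
    exact hg.enorm.mul (measurable_kk.comp (measurable_const.sub measurable_id))
  · intro h
    rw [eLpNorm_qd (by omega), h] at hft
    simp [hp] at hft
  · intro h
    rw [eLpNorm_qd (by omega), h] at hgt
    simp [hp] at hgt

lemma pot_ae_finite (d : ℕ) (hd : 2 ≤ d) {g : Euc d → ℝ} (hg : Measurable g)
    (hgt : eLpNorm g (qd d) volume ≠ ⊤) : ∀ᵐ x, pot g x < ⊤ := by
  obtain ⟨C, hC, h⟩ := hls' d hd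
  have hp := pR_gt (d := d) (by omega)
  set w : Euc d → ℝ := fun x => (1 + ‖x‖) ^ (-((d:ℝ) + 1)) with hw
  have hwm : Measurable w := by simp only [hw]; fun_prop
  have hwp : ∀ x, 0 < w x := fun x => by simp only [hw]; positivity
  have hw1 : ∀ x, w x ≤ 1 := fun x => by
    simp only [hw]
    apply Real.rpow_le_one_of_one_le_of_nonpos
    · have := norm_nonneg x; linarith
    · have : (0:ℝ) ≤ d := by positivity
      linarith
  have hwi : Integrable w := by
    apply integrable_one_add_norm
    simp
  have hwt : eLpNorm w (qd d) volume ≠ ⊤ := by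
    rw [eLpNorm_qd (by omega)]
    apply ENNReal.rpow_ne_top_of_nonneg (by positivity)
    have h2 := hwi.2
    rw [hasFiniteIntegral_iff_enorm] at h2
    refine (lt_of_le_of_lt (lintegral_mono fun x => ?_) h2).ne
    have : ‖w x‖ₑ ≤ 1 := by
      rw [← ofReal_norm_eq_enorm, Real.norm_of_nonneg (hwp x).le]
      exact ENNReal.ofReal_le_one.2 (hw1 x)
    calc ‖w x‖ₑ ^ pR d ≤ ‖w x‖ₑ ^ (1:ℝ) := ENNReal.rpow_le_rpow_of_exponent_ge this hp.le
      _ = _ := ENNReal.rpow_one _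
  have hfin := h w g hwm hg hwt hgt
  have : ∀ᵐ x, ‖w x‖ₑ * pot g x < ⊤ :=
    ae_lt_top (hwm.enorm.mul (measurable_pot hg)) (ne_top_of_le_ne_top (by finiteness) hfin)
  filter_upwards [this] with x hx
  rcases ENNReal.mul_lt_top_iff.1 hx with h | h | h
  · exact h.2
  · exact absurd h (by simp [(hwp x).ne'])
  · rw [h]; simp

lemma flux_two (d : ℕ) (hd : 2 ≤ d) : ∃ A : ℝ≥0∞, A ≠ ⊤ ∧ ∀ f g : Euc d → ℝ, Measurable f →
    Measurable g → eLpNorm f (qd d) volume ≠ ⊤ → eLpNorm g (qd d) volume ≠ ⊤ →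
    ∫⁻ y, ‖f y • gradc d f y - g y • gradc d g y‖ₑ ≤
      A * ((eLpNorm f (qd d) volume + eLpNorm g (qd d) volume) *
        eLpNorm (fun z => f z - g z) (qd d) volume) := by
  obtain ⟨C, hC, h⟩ := hls' d hd
  refine ⟨C, hC, fun f g hf hg hft hgt => ?_⟩
  have hfg : eLpNorm (fun z => f z - g z) (qd d) volume ≠ ⊤ :=
    ((MemLp.sub ⟨hf.aestronglyMeasurable, hft.lt_top⟩ ⟨hg.aestronglyMeasurable, hgt.lt_top⟩).2).ne
  calc ∫⁻ y, ‖f y • gradc d f y - g y • gradc d g y‖ₑ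
      ≤ ∫⁻ y, (‖f y - g y‖ₑ * pot f y + ‖g y‖ₑ * pot (fun z => f z - g z) y) := by
        refine lintegral_mono_ae ?_
        filter_upwards [pot_ae_finite d hd hf hft, pot_ae_finite d hd hg hgt] with y h1 h2
        have e : f y • gradc d f y - g y • gradc d g y =
            (f y - g y) • gradc d f y + g y • gradc d (fun z => f z - g z) y := by
          rw [← gradc_sub hf hg h1 h2, sub_smul, smul_sub]; abel
        rw [e]
        refine (enorm_add_le _ _).trans ?_
        rw [enorm_smul, enorm_smul]
        gcongr
        · exact gradc_le (by omega) _ _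
        · exact gradc_le (by omega) _ _
    _ = (∫⁻ y, ‖f y - g y‖ₑ * pot f y) + ∫⁻ y, ‖g y‖ₑ * pot (fun z => f z - g z) y :=
        lintegral_add_left ((hf.sub hg).enorm.mul (measurable_pot hf)) _
    _ ≤ C * (eLpNorm (fun z => f z - g z) (qd d) volume * eLpNorm f (qd d) volume) +
        C * (eLpNorm g (qd d) volume * eLpNorm (fun z => f z - g z) (qd d) volume) :=
        add_le_add (h _ _ (hf.sub hg) hf hfg hft) (h _ _ hg (hf.sub hg) hgt hfg)
    _ = _ := by ring

lemma flux_one_zero {f : Euc 1 → ℝ} (hf : Measurable f) (hft : eLpNorm f (qd 1) volume ≠ ⊤) :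
    ∀ᵐ y, f y • gradc 1 f y = 0 := by
  have hl : LocallyIntegrable (fun z => ‖f z‖) volume :=
    MemLp.locallyIntegrable (MemLp.norm ⟨hf.aestronglyMeasurable, hft.lt_top⟩) (qd_one_le le_rfl)
  filter_upwards [(Besicovitch.vitaliFamily (volume : Measure (Euc 1))).ae_tendsto_average hl]
    with y hy
  by_cases h0 : f y = 0
  · simp [h0]
  have hni : ¬ Integrable (fun z => (f z / ‖y - z‖ ^ 2) • (y - z)) := by
    intro hi
    have hfin : ∫⁻ z, ‖f z‖ₑ * kk (y - z) ≠ ⊤ := by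
      have := hi.2
      rw [hasFiniteIntegral_iff_enorm] at this
      simp_rw [enorm_kernel] at this
      exact this.ne
    have hvol : ∀ r : ℝ, 0 ≤ r → volume (Metric.closedBall y r) =
        ENNReal.ofReal r * volume (Metric.ball (0 : Euc 1) 1) := by
      intro r hr
      rw [Measure.addHaar_closedBall _ _ hr]; simp
    set m := volume (Metric.ball (0 : Euc 1) 1) with hm
    have hm0 : m ≠ 0 := (Metric.measure_ball_pos _ _ one_pos).ne'
    have hmt : m ≠ ⊤ := measure_ball_lt_top.ne
    have hz : Tendsto (fun r => volume (Metric.closedBall y r)) (𝓝[>] (0:ℝ)) (𝓝 0) := by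
      have h1 : Tendsto (fun r : ℝ => ENNReal.ofReal r * m) (𝓝[>] (0:ℝ)) (𝓝 0) := by
        have : Tendsto (fun r : ℝ => ENNReal.ofReal r * m) (𝓝 (0:ℝ)) (𝓝 (ENNReal.ofReal 0 * m)) :=
          ENNReal.Tendsto.mul_const (ENNReal.continuous_ofReal.tendsto _) (Or.inr hmt)
        simp only [ENNReal.ofReal_zero, zero_mul] at this
        exact this.mono_left nhdsWithin_le_nhds
      refine h1.congr' ?_
      filter_upwards [self_mem_nhdsWithin] with r hr
      exact (hvol r (le_of_lt hr)).symm
    have hlim := tendsto_setLIntegral_zero hfin hz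
    have hav := hy.comp (Besicovitch.tendsto_filterAt volume y)
    have hpos : 0 < ‖f y‖ := norm_pos_iff.2 h0
    have ev1 : ∀ᶠ r in 𝓝[>] (0:ℝ), ‖f y‖ / 2 < ⨍ z in Metric.closedBall y r, ‖f z‖ := 
      hav.eventually (lt_mem_nhds (by linarith))
    have ev2 : ∀ᶠ r in 𝓝[>] (0:ℝ), ∫⁻ z in Metric.closedBall y r, ‖f z‖ₑ * kk (y - z) <
        ENNReal.ofReal (‖f y‖ / 2) * m := by
      refine hlim.eventually (gt_mem_nhds ?_)
      apply ENNReal.mul_pos _ hm0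
      simpa using h0
    obtain ⟨r, ⟨h1, h2⟩, hr⟩ := ((ev1.and ev2).and self_mem_nhdsWithin).exists
    have hr : 0 < r := hr
    have hI : IntegrableOn (fun z => ‖f z‖) (Metric.closedBall y r) :=
      hl.integrableOn_isCompact (isCompact_closedBall y r)
    have h3 : ENNReal.ofReal (‖f y‖ / 2) * (ENNReal.ofReal r * m) ≤
        ∫⁻ z in Metric.closedBall y r, ‖f z‖ₑ := by
      have e1 : ∫⁻ z in Metric.closedBall y r, ‖f z‖ₑ =
          ENNReal.ofReal (∫ z in Metric.closedBall y r, ‖f z‖) := by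
        rw [ofReal_integral_eq_lintegral_ofReal hI (Eventually.of_forall fun z => norm_nonneg _)]
        simp_rw [ofReal_norm_eq_enorm]
      rw [setAverage_eq, smul_eq_mul, inv_mul_eq_div, lt_div_iff₀] at h1
      · rw [e1, ← hvol r hr.le]
        refine le_trans (le_of_eq ?_) (ENNReal.ofReal_le_ofReal h1.le)
        rw [ENNReal.ofReal_mul (by positivity), measureReal_def, ENNReal.ofReal_toReal]
        exact measure_closedBall_lt_top.ne
      · exact ENNReal.toReal_pos (Metric.measure_closedBall_pos _ _ hr).ne' measure_closedBall_lt_top.ne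
    have h4 : ENNReal.ofReal r⁻¹ * ∫⁻ z in Metric.closedBall y r, ‖f z‖ₑ ≤
        ∫⁻ z in Metric.closedBall y r, ‖f z‖ₑ * kk (y - z) := by
      rw [← lintegral_const_mul _ hf.enorm]
      have hne : ∀ᵐ z ∂(volume.restrict (Metric.closedBall y r)), z ≠ y := by
        apply ae_restrict_of_ae
        rw [ae_iff]; simp
      refine lintegral_mono_ae ?_
      filter_upwards [hne, ae_restrict_mem measurableSet_closedBall] with z hzy hz
      rw [mul_comm, kk]
      gcongr
      · exact norm_pos_iff.2 (sub_ne_zero.2 (Ne.symm hzy))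
      · simpa [dist_eq_norm, norm_sub_rev] using hz
    refine absurd h2 (not_lt.2 (le_trans ?_ h4))
    calc ENNReal.ofReal (‖f y‖ / 2) * m = ENNReal.ofReal r⁻¹ * (ENNReal.ofReal (‖f y‖ / 2) * (ENNReal.ofReal r * m)) := by
          have : ENNReal.ofReal r⁻¹ * ENNReal.ofReal r = 1 := by
            rw [← ENNReal.ofReal_mul (by positivity), inv_mul_cancel₀ hr.ne']; simp
          calc _ = (ENNReal.ofReal r⁻¹ * ENNReal.ofReal r) * (ENNReal.ofReal (‖f y‖ / 2) * m) := by
                rw [this, one_mul]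
            _ = _ := by ring
      _ ≤ _ := by gcongr
  rw [gradc, integral_undef hni]
  simp

lemma flux (d : ℕ) (hd : 1 ≤ d) : ∃ A : ℝ≥0∞, A ≠ ⊤ ∧ ∀ f g : Euc d → ℝ, Measurable f →
    Measurable g → eLpNorm f (qd d) volume ≠ ⊤ → eLpNorm g (qd d) volume ≠ ⊤ →
    ∫⁻ y, ‖f y • gradc d f y - g y • gradc d g y‖ₑ ≤
      A * ((eLpNorm f (qd d) volume + eLpNorm g (qd d) volume) *
        eLpNorm (fun z => f z - g z) (qd d) volume) := by
  rcases hd.lt_or_eq with h | rfl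
  · exact flux_two d h
  · refine ⟨0, by simp, fun f g hf hg hft hgt => ?_⟩
    rw [zero_mul, nonpos_iff_eq_zero, lintegral_eq_zero_iff']
    · filter_upwards [flux_one_zero hf hft, flux_one_zero hg hgt] with y h1 h2
      simp [h1, h2]
    · have : (fun y => ‖f y • gradc 1 f y - g y • gradc 1 g y‖ₑ) =ᵐ[volume] fun _ => 0 := by
        filter_upwards [flux_one_zero hf hft, flux_one_zero hg hgt] with y h1 h2
        simp [h1, h2]
      exact aemeasurable_const.congr this.symm

lemma gradHeat_eq (d : ℕ) (t : ℝ) (x : Euc d) :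
    gradHeat d t x = (-(heatKernel d t x * (2 * t)⁻¹)) • x := by
  have h1 : HasFDerivAt (fun x : Euc d => ‖x‖ ^ 2) (2 • innerSL ℝ x) x :=
    (hasStrictFDerivAt_norm_sq x).hasFDerivAt
  have h2 := ((h1.const_mul (-(4 * t)⁻¹)).exp).const_mul ((4 * Real.pi * t) ^ (-(d : ℝ) / 2))
  have h3 : HasGradientAt (fun x => heatKernel d t x) ((-(heatKernel d t x * (2 * t)⁻¹)) • x) x := by
    rw [hasGradientAt_iff_hasFDerivAt]
    have e : (fun x : Euc d => heatKernel d t x) = fun x =>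
        (4 * Real.pi * t) ^ (-(d : ℝ) / 2) * Real.exp (-(4 * t)⁻¹ * ‖x‖ ^ 2) := by
      ext x; unfold heatKernel; congr 2; rw [div_eq_mul_inv]; ring
    have e2 := congrFun e x
    rw [e2, e]
    convert! h2 using 1
    ext z
    simp [inner_smul_left]
    ring
  exact h3.gradient

lemma measurable_heat (d : ℕ) : Measurable fun a : ℝ × Euc d => heatKernel d a.1 a.2 := by
  unfold heatKernel; fun_prop

lemma measurable_gradHeat (d : ℕ) : Measurable fun a : ℝ × Euc d => gradHeat d a.1 a.2 := by
  simp_rw [gradHeat_eq]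
  have := measurable_heat d
  fun_prop

lemma measurable_heat' (d : ℕ) (t : ℝ) : Measurable fun a : Euc d => heatKernel d t a := by
  unfold heatKernel; fun_prop

lemma measurable_gradHeat' (d : ℕ) (t : ℝ) : Measurable fun a : Euc d => gradHeat d t a := by
  simp_rw [gradHeat_eq]
  have := measurable_heat' d t
  fun_prop

lemma heat_pos (d : ℕ) {t : ℝ} (ht : 0 < t) (x : Euc d) : 0 < heatKernel d t x := by
  unfold heatKernel; positivity

lemma heat_scale (d : ℕ) {t : ℝ} (ht : 0 < t) (z : Euc d) :
    heatKernel d t (√t • z) = t ^ (-(d:ℝ) / 2) * heatKernel d 1 z := by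
  unfold heatKernel
  rw [Real.mul_rpow (by positivity) ht.le, norm_smul, Real.norm_of_nonneg (by positivity), mul_pow,
    Real.sq_sqrt ht.le, mul_one]
  have : -(t * ‖z‖ ^ 2) / (4 * t) = -‖z‖ ^ 2 / (4 * 1) := by field_simp
  rw [this]; ring

lemma gradHeat_scale (d : ℕ) {t : ℝ} (ht : 0 < t) (z : Euc d) :
    gradHeat d t (√t • z) = t ^ (-((d:ℝ) + 1) / 2) • gradHeat d 1 z := by
  rw [gradHeat_eq, gradHeat_eq, heat_scale d ht, smul_smul, smul_smul]
  congr 1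
  have h1 : t ^ (-((d:ℝ) + 1) / 2) = t ^ (-(d:ℝ) / 2) * (√t)⁻¹ := by
    rw [Real.sqrt_eq_rpow, ← Real.rpow_neg ht.le, ← Real.rpow_add ht]
    congr 1; ring
  rw [h1]
  have hs : √t ≠ 0 := by positivity
  have h2 : t = √t * √t := (Real.mul_self_sqrt ht.le).symm
  have h3 : (2 * t)⁻¹ * √t = (√t)⁻¹ * 2⁻¹ := by
    nth_rewrite 1 [h2]; field_simp
  calc _ = -(t ^ (-(d:ℝ) / 2) * heatKernel d 1 z * ((2 * t)⁻¹ * √t)) := by ring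
    _ = _ := by rw [h3]; ring

lemma integrable_gauss (d : ℕ) {b : ℝ} (hb : 0 < b) :
    Integrable (fun v : Euc d => Real.exp (-b * ‖v‖ ^ 2)) := by
  by_contra h
  have := GaussianFourier.integral_rexp_neg_mul_sq_norm (V := Euc d) hb
  rw [integral_undef h] at this
  have : 0 < (Real.pi / b) ^ (Module.finrank ℝ (Euc d) / 2 : ℝ) := by positivity
  linarith

lemma heat_one_integral (d : ℕ) : ∫ x, heatKernel d 1 x = 1 := by
  unfold heatKernel
  rw [integral_const_mul]
  have := GaussianFourier.integral_rexp_neg_mul_sq_norm (V := Euc d) (b := 1/4) (by norm_num)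
  have e : ∀ x : Euc d, Real.exp (-‖x‖ ^ 2 / (4 * 1)) = Real.exp (-(1/4) * ‖x‖ ^ 2) := by
    intro x; congr 1; ring
  simp_rw [e, this]
  simp only [finrank_euclideanSpace, Fintype.card_fin]
  rw [show Real.pi / (1/4) = 4 * Real.pi * 1 by ring, ← Real.rpow_add (by positivity)]
  rw [show -(d:ℝ)/2 + d/2 = 0 by ring, Real.rpow_zero]

lemma heat_one_lintegral (d : ℕ) : ∫⁻ x, ENNReal.ofReal (heatKernel d 1 x) = 1 := by
  have hi : Integrable (heatKernel d 1) := by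
    by_contra h
    have := heat_one_integral d
    rw [integral_undef h] at this
    norm_num at this
  rw [← ofReal_integral_eq_lintegral_ofReal hi
    (Eventually.of_forall fun x => (heat_pos d one_pos x).le), heat_one_integral]
  simp

lemma gradHeat_one_le (d : ℕ) (z : Euc d) : ‖gradHeat d 1 z‖ ≤ Real.exp (-(1/8) * ‖z‖ ^ 2) := by
  rw [gradHeat_eq, norm_smul, norm_neg, norm_mul, Real.norm_of_nonneg (heat_pos d one_pos z).le]
  have h1 : heatKernel d 1 z ≤ Real.exp (-‖z‖ ^ 2 / 4) := by
    unfold heatKernel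
    have : (4 * Real.pi * 1) ^ (-(d:ℝ) / 2) ≤ 1 := by
      apply Real.rpow_le_one_of_one_le_of_nonpos
      · have := Real.pi_gt_three; linarith
      · have : (0:ℝ) ≤ d := by positivity
        linarith
    calc _ ≤ 1 * Real.exp (-‖z‖ ^ 2 / (4 * 1)) := by gcongr
      _ = _ := by rw [one_mul, mul_one]
  have h2 : ‖z‖ / 2 ≤ Real.exp (‖z‖ ^ 2 / 8) := by
    have := Real.add_one_le_exp (‖z‖ ^ 2 / 8)
    nlinarith [sq_nonneg (‖z‖ - 2)]
  have h3 : Real.exp (-(1/8) * ‖z‖ ^ 2) = Real.exp (-‖z‖ ^ 2 / 4) * Real.exp (‖z‖ ^ 2 / 8) := by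
    rw [← Real.exp_add]; congr 1; ring
  rw [h3]
  calc heatKernel d 1 z * ‖(2 * (1:ℝ))⁻¹‖ * ‖z‖ = heatKernel d 1 z * (‖z‖ / 2) := by norm_num; ring
    _ ≤ _ := by gcongr

lemma gradHeat_pow_finite (d : ℕ) {r : ℝ} (hr : 1 ≤ r) : ∫⁻ z, ‖gradHeat d 1 z‖ₑ ^ r ≠ ⊤ := by
  have h2 := (integrable_gauss d (b := r / 8) (by linarith)).2
  rw [hasFiniteIntegral_iff_enorm] at h2
  refine (lt_of_le_of_lt (lintegral_mono fun z => ?_) h2).ne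
  rw [← ofReal_norm_eq_enorm, ← ofReal_norm_eq_enorm, ENNReal.ofReal_rpow_of_nonneg (norm_nonneg _) (by linarith)]
  apply ENNReal.ofReal_le_ofReal
  rw [Real.norm_of_nonneg (Real.exp_pos _).le]
  calc _ ≤ (Real.exp (-(1/8) * ‖z‖ ^ 2)) ^ r := by
        apply Real.rpow_le_rpow (norm_nonneg _) (gradHeat_one_le d z) (by linarith)
    _ = _ := by rw [← Real.exp_mul]; congr 1; ring

lemma gradHeat_pow (d : ℕ) {r : ℝ} (hr : 1 ≤ r) {t : ℝ} (ht : 0 < t) :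
    ∫⁻ z, ‖gradHeat d t z‖ₑ ^ r =
      ENNReal.ofReal (t ^ ((d:ℝ) / 2 - r * ((d:ℝ) + 1) / 2)) * ∫⁻ z, ‖gradHeat d 1 z‖ₑ ^ r := by
  have hr0 : (0:ℝ) ≤ r := by linarith
  have hm : ∀ τ : ℝ, Measurable fun z : Euc d => ‖gradHeat d τ z‖ₑ ^ r := by
    intro τ
    have h1 := measurable_gradHeat' d τ
    exact h1.enorm.pow_const r
  rw [lintegral_scale d (Real.sqrt_pos.2 ht) (fun z => ‖gradHeat d t z‖ₑ ^ r) (hm t)]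
  simp_rw [gradHeat_scale d ht, enorm_smul, ENNReal.mul_rpow_of_nonneg _ _ hr0]
  rw [lintegral_const_mul _ (hm 1), ← mul_assoc]
  congr 1
  rw [← ofReal_norm_eq_enorm, Real.norm_of_nonneg (by positivity), ENNReal.ofReal_rpow_of_pos (by positivity),
    ← ENNReal.ofReal_mul (by positivity)]
  congr 1
  rw [Real.sqrt_eq_rpow, ← Real.rpow_natCast, ← Real.rpow_mul ht.le, ← Real.rpow_mul ht.le, ← Real.rpow_add ht]
  congr 1; ring

lemma gradHeat_L1 (d : ℕ) {t : ℝ} (ht : 0 < t) :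
    ∫⁻ z, ‖gradHeat d t z‖ₑ = ENNReal.ofReal (t ^ (-(1/2:ℝ))) * ∫⁻ z, ‖gradHeat d 1 z‖ₑ := by
  have := gradHeat_pow d le_rfl ht
  simp only [ENNReal.rpow_one] at this
  rw [this]
  congr 3; ring

lemma gradHeat_L1_finite (d : ℕ) : ∫⁻ z, ‖gradHeat d 1 z‖ₑ ≠ ⊤ := by
  have := gradHeat_pow_finite d le_rfl
  simpa only [ENNReal.rpow_one] using this

lemma gradHeat_Lp (d : ℕ) (hd : 1 ≤ d) {t : ℝ} (ht : 0 < t) :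
    ∫⁻ z, ‖gradHeat d t z‖ₑ ^ pR d =
      (ENNReal.ofReal (t ^ (-(3/4:ℝ))) * (∫⁻ z, ‖gradHeat d 1 z‖ₑ ^ pR d) ^ (1 / pR d)) ^ pR d := by
  have hp := pR_gt hd
  rw [gradHeat_pow d hp.le ht, ENNReal.mul_rpow_of_nonneg _ _ (by linarith), ← ENNReal.rpow_mul,
    one_div_mul_cancel (by linarith), ENNReal.rpow_one, ENNReal.ofReal_rpow_of_pos (by positivity),
    ← Real.rpow_mul ht.le]
  congr 3
  have hne : 2 * (d:ℝ) - 1 ≠ 0 := (two_d_pos hd).ne'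
  have hmul : pR d * (2 * (d:ℝ) - 1) = 2 * d := by
    unfold pR; rw [div_mul_cancel₀ _ hne]
  linarith

lemma heat_lintegral_scale (d : ℕ) {r : ℝ} (hr : 1 ≤ r) {t : ℝ} (ht : 0 < t) :
    ∫⁻ z, ‖heatKernel d t z‖ₑ ^ r =
      ENNReal.ofReal (t ^ ((d:ℝ) / 2 - r * (d:ℝ) / 2)) * ∫⁻ z, ‖heatKernel d 1 z‖ₑ ^ r := by
  have hm : Measurable fun z => heatKernel d t z := (measurable_heat d).comp (measurable_const.prodMk measurable_id)
  have hm1 : Measurable fun z => heatKernel d 1 z := (measurable_heat d).comp (measurable_const.prodMk measurable_id)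
  rw [lintegral_scale d (Real.sqrt_pos.2 ht) _ (hm.enorm.pow_const _)]
  simp_rw [heat_scale d ht, enorm_mul, ENNReal.mul_rpow_of_nonneg _ _ (by linarith : 0 ≤ r)]
  rw [lintegral_const_mul _ (hm1.enorm.pow_const _), ← mul_assoc]
  congr 1
  rw [← ofReal_norm_eq_enorm, Real.norm_of_nonneg (by positivity), ENNReal.ofReal_rpow_of_pos (by positivity),
    ← ENNReal.ofReal_mul (by positivity)]
  congr 1
  rw [Real.sqrt_eq_rpow, ← Real.rpow_natCast, ← Real.rpow_mul ht.le, ← Real.rpow_mul ht.le, ← Real.rpow_add ht]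
  congr 1; ring

lemma heat_pow_finite (d : ℕ) {r : ℝ} (hr : 1 ≤ r) : ∫⁻ z, ‖heatKernel d 1 z‖ₑ ^ r ≠ ⊤ := by
  have h2 := (integrable_gauss d (b := r / 4) (by linarith)).2
  rw [hasFiniteIntegral_iff_enorm] at h2
  refine (lt_of_le_of_lt (lintegral_mono fun z => ?_) h2).ne
  rw [← ofReal_norm_eq_enorm, ← ofReal_norm_eq_enorm, ENNReal.ofReal_rpow_of_nonneg (norm_nonneg _) (by linarith)]
  apply ENNReal.ofReal_le_ofReal
  rw [Real.norm_of_nonneg (Real.exp_pos _).le, Real.norm_of_nonneg (heat_pos d one_pos z).le]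
  have h1 : heatKernel d 1 z ≤ Real.exp (-‖z‖ ^ 2 / 4) := by
    unfold heatKernel
    have : (4 * Real.pi * 1) ^ (-(d:ℝ) / 2) ≤ 1 := by
      apply Real.rpow_le_one_of_one_le_of_nonpos
      · have := Real.pi_gt_three; linarith
      · have : (0:ℝ) ≤ d := by positivity
        linarith
    calc _ ≤ 1 * Real.exp (-‖z‖ ^ 2 / (4 * 1)) := by gcongr
      _ = _ := by rw [one_mul, mul_one]
  calc _ ≤ (Real.exp (-‖z‖ ^ 2 / 4)) ^ r := by
        apply Real.rpow_le_rpow (heat_pos d one_pos z).le h1 (by linarith)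
    _ = _ := by rw [← Real.exp_mul]; congr 1; ring

lemma heat_Lp (d : ℕ) (hd : 1 ≤ d) {t : ℝ} (ht : 0 < t) :
    ∫⁻ z, ‖heatKernel d t z‖ₑ ^ pR d =
      (ENNReal.ofReal (t ^ (-(1/4:ℝ))) * (∫⁻ z, ‖heatKernel d 1 z‖ₑ ^ pR d) ^ (1 / pR d)) ^ pR d := by
  have hp := pR_gt hd
  rw [heat_lintegral_scale d hp.le ht, ENNReal.mul_rpow_of_nonneg _ _ (by linarith), ← ENNReal.rpow_mul,
    one_div_mul_cancel (by linarith), ENNReal.rpow_one, ENNReal.ofReal_rpow_of_pos (by positivity),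
    ← Real.rpow_mul ht.le]
  congr 3
  have hne : 2 * (d:ℝ) - 1 ≠ 0 := (two_d_pos hd).ne'
  have hmul : pR d * (2 * (d:ℝ) - 1) = 2 * d := by
    unfold pR; rw [div_mul_cancel₀ _ hne]
  linarith

/-- Minkowski type inequality. -/
lemma mink {α β : Type*} [MeasurableSpace α] [MeasurableSpace β] (μ : Measure α) [SFinite μ]
    (ν : Measure β) [SFinite ν] {p : ℝ} (hp : 1 < p) (k : α → β → ℝ≥0∞)
    (hk : Measurable (Function.uncurry k)) (w : α → ℝ≥0∞) (hw : Measurable w)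
    (h : ∀ᵐ a ∂μ, w a ≠ 0 ∧ w a ≠ ⊤ ∧ ∫⁻ x, k a x ^ p ∂ν ≤ w a ^ p) :
    ∫⁻ x, (∫⁻ a, k a x ∂μ) ^ p ∂ν ≤ (∫⁻ a, w a ∂μ) ^ p := by
  have hpq := Real.HolderConjugate.conjExponent hp
  set q := Real.conjExponent p with hq
  have hp0 : 0 < p := by linarith
  have hq0 : 0 < q := hpq.symm.pos
  have hpq1 : (1 / q) * p = p - 1 := by
    have := hpq.inv_add_inv_eq_one
    rw [one_div]
    have h2 : q⁻¹ = 1 - p⁻¹ := by linarith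
    rw [h2]; field_simp
  have hkx : ∀ x, Measurable fun a => k a x := fun x => hk.comp (measurable_id.prodMk measurable_const)
  set W := ∫⁻ a, w a ∂μ with hW
  have h1 : ∀ x, (∫⁻ a, k a x ∂μ) ^ p ≤ (∫⁻ a, k a x ^ p * (w a ^ (p - 1))⁻¹ ∂μ) * W ^ (p - 1) := by
    intro x
    have e1 : ∫⁻ a, k a x ∂μ = ∫⁻ a, ((fun a => k a x * (w a ^ (1 / q))⁻¹) * (fun a => w a ^ (1/q))) a ∂μ := by
      refine lintegral_congr_ae ?_
      filter_upwards [h] with a ha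
      simp only [Pi.mul_apply]
      rw [mul_assoc, ENNReal.inv_mul_cancel, mul_one]
      · simp [ha.1, ha.2.1]
      · simp [ha.1, ha.2.1, hq0.le]
    have e2 := ENNReal.lintegral_mul_le_Lp_mul_Lq μ hpq
      (f := fun a => k a x * (w a ^ (1 / q))⁻¹) (g := fun a => w a ^ (1/q))
      ((hkx x).mul (hw.pow_const _).inv).aemeasurable (hw.pow_const _).aemeasurable
    rw [← e1] at e2
    calc _ ≤ _ := ENNReal.rpow_le_rpow e2 hp0.le
      _ = _ := by
        rw [ENNReal.mul_rpow_of_nonneg _ _ hp0.le, ← ENNReal.rpow_mul, ← ENNReal.rpow_mul,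
          one_div_mul_cancel hp0.ne', ENNReal.rpow_one, hpq1]
        simp_rw [← ENNReal.rpow_mul, one_div_mul_cancel hq0.ne', ENNReal.rpow_one,
          ENNReal.mul_rpow_of_nonneg _ _ hp0.le, ENNReal.inv_rpow, ← ENNReal.rpow_mul, hpq1]
        rfl
  have hkw : Measurable fun z : β × α => k z.2 z.1 ^ p * (w z.2 ^ (p - 1))⁻¹ :=
    ((hk.comp measurable_swap).pow_const _).mul ((hw.comp measurable_snd).pow_const _).inv
  calc _ ≤ ∫⁻ x, (∫⁻ a, k a x ^ p * (w a ^ (p - 1))⁻¹ ∂μ) * W ^ (p - 1) ∂ν := lintegral_mono h1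
    _ = (∫⁻ x, (∫⁻ a, k a x ^ p * (w a ^ (p - 1))⁻¹ ∂μ) ∂ν) * W ^ (p - 1) :=
        lintegral_mul_const _ hkw.lintegral_prod_right'
    _ = (∫⁻ a, (∫⁻ x, k a x ^ p * (w a ^ (p - 1))⁻¹ ∂ν) ∂μ) * W ^ (p - 1) := by
        rw [lintegral_lintegral_swap hkw.aemeasurable]
    _ ≤ (∫⁻ a, w a ∂μ) * W ^ (p - 1) := by
        gcongr ?_ * _
        refine lintegral_mono_ae ?_
        filter_upwards [h] with a ha
        have hm' : Measurable fun x => k a x ^ p := (hk.comp (measurable_const.prodMk measurable_id)).pow_const p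
        rw [lintegral_mul_const _ hm']
        calc _ ≤ w a ^ p * (w a ^ (p - 1))⁻¹ := by gcongr; exact ha.2.2
          _ = w a := by
            rw [← ENNReal.rpow_neg, ← ENNReal.rpow_add _ _ ha.1 ha.2.1]
            rw [show p + -(p-1) = 1 by ring, ENNReal.rpow_one]
    _ = W ^ p := by
        rw [← hW]
        conv_lhs => rw [← ENNReal.rpow_one W]
        rw [← ENNReal.rpow_mul, one_mul, ← ENNReal.rpow_add_of_nonneg _ _ (by norm_num) (by linarith)]
        congr 1; ring

lemma lint_rpow {b t : ℝ} (hb : b < 1) (ht : 0 < t) :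
    ∫⁻ s in Set.Ioc 0 t, ENNReal.ofReal (s ^ (-b)) = ENNReal.ofReal (t ^ (1 - b) / (1 - b)) := by
  have hi := intervalIntegral.intervalIntegrable_rpow' (a := 0) (b := t) (r := -b) (by linarith)
  rw [intervalIntegrable_iff_integrableOn_Ioc_of_le ht.le] at hi
  rw [← ofReal_integral_eq_lintegral_ofReal hi, ← intervalIntegral.integral_of_le ht.le,
    integral_rpow (Or.inl (by linarith)), Real.zero_rpow (by linarith)]
  · congr 1; rw [sub_zero, show -b + 1 = 1 - b by ring]
  · filter_upwards [ae_restrict_mem measurableSet_Ioc] with s hs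
    exact Real.rpow_nonneg hs.1.le _

lemma lint_rpow_sub {b a t : ℝ} (hb : b < 1) (hat : a < t) :
    ∫⁻ s in Set.Ioc a t, ENNReal.ofReal ((t - s) ^ (-b)) = ENNReal.ofReal ((t - a) ^ (1 - b) / (1 - b)) := by
  rw [← lint_rpow hb (sub_pos.2 hat), ← lintegral_indicator measurableSet_Ioc,
    ← lintegral_indicator measurableSet_Ioc, ← lintegral_sub_left_eq_self _ t]
  have h0 : ∀ᵐ s : ℝ, s ≠ 0 ∧ s ≠ t - a := by
    rw [eventually_and]
    constructor <;> (rw [ae_iff]; simp)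
  refine lintegral_congr_ae ?_
  filter_upwards [h0] with s hs
  simp only [Set.indicator, Set.mem_Ioc, sub_sub_cancel]
  have : (a < t - s ∧ t - s ≤ t) ↔ (0 < s ∧ s ≤ t - a) := by
    constructor
    · rintro ⟨h1, h2⟩
      exact ⟨lt_of_le_of_ne (by linarith) (Ne.symm hs.1), by linarith⟩
    · rintro ⟨h1, h2⟩
      have := lt_of_le_of_ne h2 hs.2
      exact ⟨by linarith, by linarith⟩
  simp only [this]

lemma time_int {a : ℝ} (ha0 : 0 ≤ a) (ha : a < 1) : ∃ B : ℝ≥0∞, B ≠ ⊤ ∧ ∀ t : ℝ, 0 < t →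
    ∫⁻ s in Set.Ioc 0 t, ENNReal.ofReal ((t - s) ^ (-a)) * ENNReal.ofReal (s ^ (-(1/2:ℝ))) ≤
      B * ENNReal.ofReal (t ^ (1/2 - a)) := by
  refine ⟨ENNReal.ofReal ((1/2:ℝ) ^ (-a) * 2 + (1/2:ℝ) ^ (-(1/2:ℝ)) / (1 - a)), by simp, ?_⟩
  intro t ht
  have key : ∀ s ∈ Set.Ioc (0:ℝ) t, ENNReal.ofReal ((t - s) ^ (-a)) * ENNReal.ofReal (s ^ (-(1/2:ℝ))) ≤
      ENNReal.ofReal ((t/2) ^ (-a)) * ENNReal.ofReal (s ^ (-(1/2:ℝ))) +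
        ENNReal.ofReal ((t/2) ^ (-(1/2:ℝ))) * ENNReal.ofReal ((t - s) ^ (-a)) := by
    intro s hs
    rcases le_total s (t/2) with h | h
    · refine le_trans ?_ le_self_add
      gcongr ENNReal.ofReal ?_ * _
      apply Real.rpow_le_rpow_of_nonpos (by linarith) (by linarith) (by linarith)
    · refine le_trans ?_ le_add_self
      rw [mul_comm]
      gcongr ENNReal.ofReal ?_ * _
      apply Real.rpow_le_rpow_of_nonpos (by linarith) (by linarith) (by norm_num)
  refine (setLIntegral_mono' measurableSet_Ioc key).trans ?_
  rw [lintegral_add_left (by fun_prop), lintegral_const_mul _ (by fun_prop),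
    lintegral_const_mul _ (by fun_prop), lint_rpow (by norm_num) ht, lint_rpow_sub ha ht,
    ← ENNReal.ofReal_mul (by positivity), ← ENNReal.ofReal_mul (by positivity),
    ← ENNReal.ofReal_mul (by have : 0 < 1 - a := by linarith
                             positivity),
    ← ENNReal.ofReal_add (by positivity) (by have : 0 < 1 - a := by linarith
                                             simp only [sub_zero]; positivity)]
  apply ENNReal.ofReal_le_ofReal
  apply le_of_eq
  rw [div_eq_mul_one_div t 2, Real.mul_rpow ht.le (by norm_num), Real.mul_rpow ht.le (by norm_num), sub_zero]
  have e1 : t ^ (1/2 - a) = t ^ (-a) * t ^ (1 - 1/2 : ℝ) := by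
    rw [← Real.rpow_add ht]; congr 1; ring
  have e2 : t ^ (-(1/2:ℝ)) * t ^ (1 - a) = t ^ (1/2 - a) := by
    rw [← Real.rpow_add ht]; congr 1; ring
  calc _ = ((1/2:ℝ) ^ (-a) * 2) * (t ^ (-a) * t ^ (1 - 1/2 : ℝ)) +
        ((1/2:ℝ) ^ (-(1/2:ℝ)) / (1 - a)) * (t ^ (-(1/2:ℝ)) * t ^ (1 - a)) := by ring
    _ = _ := by rw [← e1, e2]; ring

/-- cut-off kernel -/
def KK (d : ℕ) (t s : ℝ) (z : Euc d) : Euc d :=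
  if s ∈ Set.Ioc (0:ℝ) t then gradHeat d (t - s) z else 0

/-- space-time integral operator -/
def DD {d : ℕ} (K F : ℝ → Euc d → Euc d) (x : Euc d) : ℝ :=
  ∫ s, ∫ y, (inner ℝ (K s (x - y)) (F s y) : ℝ)

/-- its absolute version -/
def JJ {d : ℕ} (K F : ℝ → Euc d → Euc d) (x : Euc d) : ℝ≥0∞ :=
  ∫⁻ s, ∫⁻ y, ‖K s (x - y)‖ₑ * ‖F s y‖ₑ

lemma measurable_KK (d : ℕ) : Measurable fun a : ℝ × ℝ × Euc d => KK d a.1 a.2.1 a.2.2 := by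
  have hs : MeasurableSet {a : ℝ × ℝ × Euc d | a.2.1 ∈ Set.Ioc (0:ℝ) a.1} := by
    have h1 : MeasurableSet {a : ℝ × ℝ × Euc d | (0:ℝ) < a.2.1} :=
      measurableSet_lt measurable_const (measurable_fst.comp measurable_snd)
    have h2 : MeasurableSet {a : ℝ × ℝ × Euc d | a.2.1 ≤ a.1} :=
      measurableSet_le (measurable_fst.comp measurable_snd) measurable_fst
    exact h1.inter h2
  have hg : Measurable fun a : ℝ × ℝ × Euc d => (a.1 - a.2.1, a.2.2) := by fun_prop
  have h3 := (measurable_gradHeat d).comp hg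
  exact Measurable.ite hs h3 measurable_const

lemma measurable_KK' (d : ℕ) (t : ℝ) : Measurable (Function.uncurry (KK d t)) := by
  have hg : Measurable fun a : ℝ × Euc d => (t, a.1, a.2) := by fun_prop
  exact (measurable_KK d).comp hg

lemma measurable_kx {d : ℕ} {K : ℝ → Euc d → Euc d} (hK : Measurable (Function.uncurry K)) :
    Measurable fun a : Euc d × ℝ × Euc d => K a.2.1 (a.1 - a.2.2) := by
  have hg : Measurable fun a : Euc d × ℝ × Euc d => (a.2.1, a.1 - a.2.2) := by fun_prop
  exact hK.comp hg

lemma measurable_kx2 {d : ℕ} {K : ℝ → Euc d → Euc d} (hK : Measurable (Function.uncurry K)) :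
    Measurable (Function.uncurry fun (a : ℝ × Euc d) (x : Euc d) => ‖K a.1 (x - a.2)‖ₑ) := by
  have hg : Measurable fun a : (ℝ × Euc d) × Euc d => (a.1.1, a.2 - a.1.2) := by fun_prop
  exact (hK.comp hg).enorm

lemma measurable_kx3 {d : ℕ} {K : ℝ → Euc d → Euc d} (hK : Measurable (Function.uncurry K)) (x : Euc d) :
    Measurable (fun (a : ℝ × Euc d) => ‖K a.1 (x - a.2)‖ₑ) := by
  have hg : Measurable fun a : ℝ × Euc d => (a.1, x - a.2) := by fun_prop
  exact (hK.comp hg).enorm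

lemma DD_KK (d : ℕ) (t : ℝ) (F : ℝ → Euc d → Euc d) (x : Euc d) :
    DD (KK d t) F x = ∫ s in Set.Ioc (0:ℝ) t, ∫ y, (inner ℝ (gradHeat d (t - s) (x - y)) (F s y) : ℝ) := by
  rw [← integral_indicator measurableSet_Ioc]
  unfold DD
  congr 1; ext1 s
  unfold KK Set.indicator
  by_cases h : s ∈ Set.Ioc (0:ℝ) t
  · simp only [h, if_true]
  · simp only [h, if_false, inner_zero_left, integral_zero]

lemma DD_le_JJ {d : ℕ} (K F : ℝ → Euc d → Euc d) (x : Euc d) : ‖DD K F x‖ₑ ≤ JJ K F x := by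
  unfold DD JJ
  refine (enorm_integral_le_lintegral_enorm _).trans (lintegral_mono fun s => ?_)
  refine (enorm_integral_le_lintegral_enorm _).trans (lintegral_mono fun y => ?_)
  rw [← ofReal_norm_eq_enorm, ← ofReal_norm_eq_enorm, ← ofReal_norm_eq_enorm, ← ENNReal.ofReal_mul (norm_nonneg _)]
  exact ENNReal.ofReal_le_ofReal (norm_inner_le_norm _ _)

lemma JJ_prod {d : ℕ} {K F : ℝ → Euc d → Euc d} (hK : Measurable (Function.uncurry K))
    (hF : Measurable (Function.uncurry F)) (x : Euc d) :
    JJ K F x = ∫⁻ a : ℝ × Euc d, ‖K a.1 (x - a.2)‖ₑ * ‖F a.1 a.2‖ₑ ∂(volume.prod volume) := by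
  have hm : Measurable fun a : ℝ × Euc d => ‖K a.1 (x - a.2)‖ₑ * ‖F a.1 a.2‖ₑ := by
    have h1 : Measurable fun a : ℝ × Euc d => K a.1 (x - a.2) :=
      (measurable_kx hK).comp (measurable_const.prodMk measurable_id)
    exact h1.enorm.mul hF.enorm
  rw [lintegral_prod _ hm.aemeasurable]
  rfl

lemma measurable_JJ {d : ℕ} {K F : ℝ → Euc d → Euc d} (hK : Measurable (Function.uncurry K))
    (hF : Measurable (Function.uncurry F)) : Measurable (JJ K F) := by
  have h0 : Measurable fun a : Euc d × ℝ × Euc d => ‖K a.2.1 (a.1 - a.2.2)‖ₑ * ‖F a.2.1 a.2.2‖ₑ := by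
    have h2 : Measurable fun a : Euc d × ℝ × Euc d => F a.2.1 a.2.2 := hF.comp measurable_snd
    exact (measurable_kx hK).enorm.mul h2.enorm
  have e : JJ K F = fun x => ∫⁻ a : ℝ × Euc d, ‖K a.1 (x - a.2)‖ₑ * ‖F a.1 a.2‖ₑ ∂(volume.prod volume) := by
    ext x; exact JJ_prod hK hF x
  rw [e]
  exact h0.lintegral_prod_right'

lemma integrable_DD {d : ℕ} {K F : ℝ → Euc d → Euc d} (hK : Measurable (Function.uncurry K))
    (hF : Measurable (Function.uncurry F)) {x : Euc d} (hx : JJ K F x < ⊤) :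
    Integrable (fun a : ℝ × Euc d => (inner ℝ (K a.1 (x - a.2)) (F a.1 a.2) : ℝ)) (volume.prod volume) := by
  have h1 : Measurable fun a : ℝ × Euc d => K a.1 (x - a.2) :=
      (measurable_kx hK).comp (measurable_const.prodMk measurable_id)
  refine ⟨(h1.inner hF).aestronglyMeasurable, ?_⟩
  rw [hasFiniteIntegral_iff_enorm]
  refine lt_of_le_of_lt (lintegral_mono fun a => ?_) ((JJ_prod hK hF x).symm.trans_lt hx)
  rw [← ofReal_norm_eq_enorm, ← ofReal_norm_eq_enorm, ← ofReal_norm_eq_enorm, ← ENNReal.ofReal_mul (norm_nonneg _)]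
  exact ENNReal.ofReal_le_ofReal (norm_inner_le_norm _ _)

lemma DD_prod {d : ℕ} {K F : ℝ → Euc d → Euc d} (hK : Measurable (Function.uncurry K))
    (hF : Measurable (Function.uncurry F)) {x : Euc d} (hx : JJ K F x < ⊤) :
    DD K F x = ∫ a : ℝ × Euc d, (inner ℝ (K a.1 (x - a.2)) (F a.1 a.2) : ℝ) ∂(volume.prod volume) := by
  rw [integral_prod _ (integrable_DD hK hF hx)]
  rfl

lemma JJ_add_le {d : ℕ} {K F H : ℝ → Euc d → Euc d} (hK : Measurable (Function.uncurry K))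
    (hF : Measurable (Function.uncurry F)) (hH : Measurable (Function.uncurry H)) {x : Euc d}  :
    JJ K (fun s y => F s y - H s y) x ≤ JJ K F x + JJ K H x := by
  have hFH : Measurable (Function.uncurry fun s y => F s y - H s y) := hF.sub hH
  rw [JJ_prod hK hF, JJ_prod hK hH, JJ_prod hK hFH, ← lintegral_add_left]
  · refine lintegral_mono fun a => ?_
    simp only
    rw [← mul_add]
    gcongr
    exact enorm_sub_le
  · have h1 : Measurable fun a : ℝ × Euc d => K a.1 (x - a.2) :=
      (measurable_kx hK).comp (measurable_const.prodMk measurable_id)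
    exact h1.enorm.mul hF.enorm

lemma JJ_add_le' {d : ℕ} {K L F : ℝ → Euc d → Euc d} (hK : Measurable (Function.uncurry K))
    (hL : Measurable (Function.uncurry L)) (hF : Measurable (Function.uncurry F)) {x : Euc d}  :
    JJ (fun s y => K s y - L s y) F x ≤ JJ K F x + JJ L F x := by
  have hKL : Measurable (Function.uncurry fun s y => K s y - L s y) := hK.sub hL
  rw [JJ_prod hK hF, JJ_prod hL hF, JJ_prod hKL hF, ← lintegral_add_left]
  · refine lintegral_mono fun a => ?_
    simp only
    rw [← add_mul]
    gcongr
    exact enorm_sub_le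
  · have h1 : Measurable fun a : ℝ × Euc d => K a.1 (x - a.2) :=
      (measurable_kx hK).comp (measurable_const.prodMk measurable_id)
    exact h1.enorm.mul hF.enorm

lemma DD_sub {d : ℕ} {K F H : ℝ → Euc d → Euc d} (hK : Measurable (Function.uncurry K))
    (hF : Measurable (Function.uncurry F)) (hH : Measurable (Function.uncurry H)) {x : Euc d}
    (h1 : JJ K F x < ⊤) (h2 : JJ K H x < ⊤) :
    DD K F x - DD K H x = DD K (fun s y => F s y - H s y) x := by
  have hFH : Measurable (Function.uncurry fun s y => F s y - H s y) := hF.sub hH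
  have h3 : JJ K (fun s y => F s y - H s y) x < ⊤ :=
    (JJ_add_le hK hF hH).trans_lt (ENNReal.add_lt_top.2 ⟨h1, h2⟩)
  rw [DD_prod hK hF h1, DD_prod hK hH h2, DD_prod hK hFH h3,
    ← integral_sub (integrable_DD hK hF h1) (integrable_DD hK hH h2)]
  simp_rw [inner_sub_right]

lemma DD_sub' {d : ℕ} {K L F : ℝ → Euc d → Euc d} (hK : Measurable (Function.uncurry K))
    (hL : Measurable (Function.uncurry L)) (hF : Measurable (Function.uncurry F)) {x : Euc d}
    (h1 : JJ K F x < ⊤) (h2 : JJ L F x < ⊤) :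
    DD K F x - DD L F x = DD (fun s y => K s y - L s y) F x := by
  have hKL : Measurable (Function.uncurry fun s y => K s y - L s y) := hK.sub hL
  have h3 : JJ (fun s y => K s y - L s y) F x < ⊤ :=
    (JJ_add_le' hK hL hF).trans_lt (ENNReal.add_lt_top.2 ⟨h1, h2⟩)
  rw [DD_prod hK hF h1, DD_prod hL hF h2, DD_prod hKL hF h3,
    ← integral_sub (integrable_DD hK hF h1) (integrable_DD hL hF h2)]
  simp_rw [inner_sub_left]

lemma JJ_L1 {d : ℕ} {K F : ℝ → Euc d → Euc d} (hK : Measurable (Function.uncurry K))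
    (hF : Measurable (Function.uncurry F)) :
    ∫⁻ x, JJ K F x = ∫⁻ s, (∫⁻ z, ‖K s z‖ₑ) * ∫⁻ y, ‖F s y‖ₑ := by
  have h0 : Measurable fun a : Euc d × ℝ × Euc d => ‖K a.2.1 (a.1 - a.2.2)‖ₑ * ‖F a.2.1 a.2.2‖ₑ := by
    have h2 : Measurable fun a : Euc d × ℝ × Euc d => F a.2.1 a.2.2 := hF.comp measurable_snd
    exact (measurable_kx hK).enorm.mul h2.enorm
  simp_rw [JJ_prod hK hF]
  rw [lintegral_lintegral_swap h0.aemeasurable]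
  have e : ∀ a : ℝ × Euc d, ∫⁻ x, ‖K a.1 (x - a.2)‖ₑ * ‖F a.1 a.2‖ₑ = (∫⁻ z, ‖K a.1 z‖ₑ) * ‖F a.1 a.2‖ₑ := by
    intro a
    have hm : Measurable fun x : Euc d => ‖K a.1 x‖ₑ := (hK.comp (measurable_const.prodMk measurable_id)).enorm
    have hm2 : Measurable fun x : Euc d => ‖K a.1 (x - a.2)‖ₑ := hm.comp (measurable_id.sub_const _)
    rw [lintegral_mul_const _ hm2, lintegral_sub_right_eq_self (fun x => ‖K a.1 x‖ₑ)]
  simp_rw [e]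
  have hk : Measurable fun s => ∫⁻ z, ‖K s z‖ₑ := hK.enorm.lintegral_prod_right'
  have hm3 : Measurable fun a : ℝ × Euc d => (∫⁻ z, ‖K a.1 z‖ₑ) * ‖F a.1 a.2‖ₑ :=
    (hk.comp measurable_fst).mul hF.enorm
  rw [lintegral_prod _ hm3.aemeasurable]
  refine lintegral_congr fun s => ?_
  have hm : Measurable fun x : Euc d => ‖F s x‖ₑ := (hF.comp (measurable_const.prodMk measurable_id)).enorm
  change ∫⁻ y, (∫⁻ z, ‖K s z‖ₑ) * ‖F s y‖ₑ = _
  exact lintegral_const_mul _ hm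

lemma ofReal_rpow_ne {a b : ℝ} (ha : 0 < a) : ENNReal.ofReal (a ^ b) ≠ 0 := by
  have : 0 < a ^ b := by positivity
  simp [this]

/-- main bounds for the Duhamel operator -/
lemma duh_bound (d : ℕ) (hd : 1 ≤ d) : ∃ c : ℝ≥0∞, c ≠ ⊤ ∧ ∀ t : ℝ, 0 < t → ∀ F : ℝ → Euc d → Euc d,
    Measurable (Function.uncurry F) → ∀ M : ℝ≥0∞,
    (∀ s ∈ Set.Ioc (0:ℝ) t, ∫⁻ y, ‖F s y‖ₑ ≤ M * ENNReal.ofReal (s ^ (-(1/2:ℝ)))) →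
    ∫⁻ x, JJ (KK d t) F x ≤ c * M ∧
    (∫⁻ x, JJ (KK d t) F x ^ pR d) ^ (1 / pR d) ≤ c * M * ENNReal.ofReal (t ^ (-(1/4:ℝ))) := by
  obtain ⟨B1, hB1, h1⟩ := time_int (a := 1/2) (by norm_num) (by norm_num)
  obtain ⟨B2, hB2, h2⟩ := time_int (a := 3/4) (by norm_num) (by norm_num)
  have hp := pR_gt hd
  have hp0 : 0 < pR d := by linarith
  set C1 := ∫⁻ z, ‖gradHeat d 1 z‖ₑ with hC1
  have hC1t : C1 ≠ ⊤ := gradHeat_L1_finite d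
  set C2 := (∫⁻ z, ‖gradHeat d 1 z‖ₑ ^ pR d) ^ (1 / pR d) with hC2
  have hC2t : C2 ≠ ⊤ := ENNReal.rpow_ne_top_of_nonneg (by positivity) (gradHeat_pow_finite d hp.le)
  refine ⟨C1 * B1 + (C2 + 1) * B2, by finiteness, ?_⟩
  intro t ht F hF M hM
  have hK := measurable_KK' d t
  have hae : ∀ᵐ s ∂(volume.restrict (Set.Ioc (0:ℝ) t)), s ∈ Set.Ioo (0:ℝ) t := by
    have h0 : ∀ᵐ s : ℝ, s ≠ t := by rw [ae_iff]; simp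
    filter_upwards [ae_restrict_mem measurableSet_Ioc, ae_restrict_of_ae h0] with s hs hs'
    exact ⟨hs.1, lt_of_le_of_ne hs.2 hs'⟩
  constructor
  · rw [JJ_L1 hK hF]
    calc _ = ∫⁻ s in Set.Ioc 0 t, (∫⁻ z, ‖KK d t s z‖ₑ) * ∫⁻ y, ‖F s y‖ₑ := by
          rw [← lintegral_indicator measurableSet_Ioc]
          refine lintegral_congr fun s => ?_
          unfold Set.indicator
          split_ifs with h
          · rfl
          · simp [KK, h]
      _ ≤ ∫⁻ s in Set.Ioc 0 t, (C1 * M) * (ENNReal.ofReal ((t - s) ^ (-(1/2:ℝ))) * ENNReal.ofReal (s ^ (-(1/2:ℝ)))) := by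
          refine lintegral_mono_ae ?_
          filter_upwards [hae] with s hs
          have hs' : s ∈ Set.Ioc (0:ℝ) t := ⟨hs.1, hs.2.le⟩
          simp only [KK, hs', if_true]
          rw [gradHeat_L1 d (sub_pos.2 hs.2)]
          calc _ ≤ ENNReal.ofReal ((t - s) ^ (-(1/2:ℝ))) * C1 * (M * ENNReal.ofReal (s ^ (-(1/2:ℝ)))) := by
                gcongr; exact hM s hs'
            _ = _ := by ring
      _ ≤ C1 * M * (B1 * ENNReal.ofReal (t ^ (1/2 - 1/2 : ℝ))) := by
          rw [lintegral_const_mul _ (by fun_prop)]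
          gcongr
          exact h1 t ht
      _ = C1 * B1 * M := by simp; ring
      _ ≤ _ := by gcongr; exact le_self_add
  · set μ := (((volume : Measure ℝ).restrict (Set.Ioc 0 t)).prod (volume : Measure (Euc d))).withDensity
      (fun a => ‖F a.1 a.2‖ₑ) with hμ
    have hFm : Measurable fun a : ℝ × Euc d => ‖F a.1 a.2‖ₑ := hF.enorm
    set w : ℝ × Euc d → ℝ≥0∞ := fun a => (C2 + 1) * ENNReal.ofReal ((t - a.1) ^ (-(3/4:ℝ))) with hw
    have hwm : Measurable w := by rw [hw]; fun_prop
    have hk : Measurable (Function.uncurry fun (a : ℝ × Euc d) (x : Euc d) => ‖KK d t a.1 (x - a.2)‖ₑ) :=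
      measurable_kx2 hK
    have hkx : ∀ x, Measurable fun (a : ℝ × Euc d) => ‖KK d t a.1 (x - a.2)‖ₑ := fun x =>
      measurable_kx3 hK x
    have key := mink μ (volume : Measure (Euc d)) hp (fun a x => ‖KK d t a.1 (x - a.2)‖ₑ) hk w hwm ?_
    · have e1 : ∀ x, ∫⁻ a, ‖KK d t a.1 (x - a.2)‖ₑ ∂μ = JJ (KK d t) F x := by
        intro x
        rw [hμ, lintegral_withDensity_eq_lintegral_mul _ hFm (hkx x)]
        have hm : Measurable ((fun a : ℝ × Euc d => ‖F a.1 a.2‖ₑ) * fun a => ‖KK d t a.1 (x - a.2)‖ₑ) := hFm.mul (hkx x)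
        rw [lintegral_prod _ hm.aemeasurable, ← lintegral_indicator measurableSet_Ioc]
        unfold JJ
        refine lintegral_congr fun s => ?_
        unfold Set.indicator
        split_ifs with h
        · simp only [Pi.mul_apply, mul_comm]
        · simp [KK, h]
      have e2 : ∫⁻ a, w a ∂μ ≤ (C1 * B1 + (C2 + 1) * B2) * M * ENNReal.ofReal (t ^ (-(1/4:ℝ))) := by
        rw [hμ, lintegral_withDensity_eq_lintegral_mul _ hFm hwm]
        have hm : Measurable ((fun a : ℝ × Euc d => ‖F a.1 a.2‖ₑ) * w) := hFm.mul hwm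
        rw [lintegral_prod _ hm.aemeasurable]
        calc _ ≤ ∫⁻ s in Set.Ioc 0 t, ((C2 + 1) * M) * (ENNReal.ofReal ((t - s) ^ (-(3/4:ℝ))) * ENNReal.ofReal (s ^ (-(1/2:ℝ)))) := by
              refine lintegral_mono_ae ?_
              filter_upwards [ae_restrict_mem measurableSet_Ioc] with s hs
              have hFs : Measurable fun y => ‖F s y‖ₑ := (hF.comp (measurable_const.prodMk measurable_id)).enorm
              simp only [Pi.mul_apply, hw]
              rw [lintegral_mul_const _ hFs]
              calc _ ≤ (M * ENNReal.ofReal (s ^ (-(1/2:ℝ)))) * ((C2 + 1) * ENNReal.ofReal ((t - s) ^ (-(3/4:ℝ)))) := by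
                    gcongr; exact hM s hs
                _ = _ := by ring
          _ ≤ (C2 + 1) * M * (B2 * ENNReal.ofReal (t ^ (1/2 - 3/4 : ℝ))) := by
              rw [lintegral_const_mul _ (by fun_prop)]
              gcongr
              exact h2 t ht
          _ = (C2 + 1) * B2 * M * ENNReal.ofReal (t ^ (-(1/4:ℝ))) := by
              rw [show (1/2 - 3/4 : ℝ) = -(1/4:ℝ) by norm_num]; ring
          _ ≤ _ := by gcongr; exact le_add_self
      simp_rw [e1] at key
      calc _ ≤ ((∫⁻ a, w a ∂μ) ^ pR d) ^ (1 / pR d) := ENNReal.rpow_le_rpow key (by positivity)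
        _ = ∫⁻ a, w a ∂μ := by
          rw [← ENNReal.rpow_mul, mul_one_div_cancel hp0.ne', ENNReal.rpow_one]
        _ ≤ _ := e2
    · have hac : μ ≪ ((volume : Measure ℝ).restrict (Set.Ioc 0 t)).prod (volume : Measure (Euc d)) :=
        withDensity_absolutelyContinuous _ _
      refine hac.ae_le ?_
      have hae2 : ∀ᵐ a ∂(((volume : Measure ℝ).restrict (Set.Ioc 0 t)).prod (volume : Measure (Euc d))),
          a.1 ∈ Set.Ioo (0:ℝ) t := Measure.quasiMeasurePreserving_fst.ae hae
      filter_upwards [hae2] with a ha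
      have hpos := sub_pos.2 ha.2
      refine ⟨?_, ?_, ?_⟩
      · exact mul_ne_zero (by simp) (ofReal_rpow_ne hpos)
      · exact ENNReal.mul_ne_top (by finiteness) ENNReal.ofReal_ne_top
      · have ha' : a.1 ∈ Set.Ioc (0:ℝ) t := ⟨ha.1, ha.2.le⟩
        simp only [KK, ha', if_true]
        rw [lintegral_sub_right_eq_self (fun x => ‖gradHeat d (t - a.1) x‖ₑ ^ pR d), gradHeat_Lp d hd hpos]
        apply ENNReal.rpow_le_rpow _ hp0.le
        change _ ≤ (C2 + 1) * ENNReal.ofReal ((t - a.1) ^ (-(3/4:ℝ)))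
        rw [mul_comm]
        exact mul_le_mul_left le_self_add _

/-- the flux -/
def FF (d : ℕ) (u : ℝ → Euc d → ℝ) (s : ℝ) (y : Euc d) : Euc d := u s y • gradc d (u s) y

lemma measurable_FF (d : ℕ) {u : ℝ → Euc d → ℝ} (hu : Measurable (Function.uncurry u)) :
    Measurable (Function.uncurry (FF d u)) := by
  have h1 : Measurable fun a : (ℝ × Euc d) × Euc d => (u a.1.1 a.2 / ‖a.1.2 - a.2‖ ^ 2) • (a.1.2 - a.2) := by
    have hg : Measurable fun a : (ℝ × Euc d) × Euc d => (a.1.1, a.2) := by fun_prop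
    have h2 : Measurable fun a : (ℝ × Euc d) × Euc d => u a.1.1 a.2 := hu.comp hg
    fun_prop
  have h3 := (h1.stronglyMeasurable.integral_prod_right' (ν := (volume : Measure (Euc d)))).measurable
  exact hu.smul (h3.const_smul (-(1 / (d * Real.pi))))

lemma mildRHS_eq (d : ℕ) (ρ₀ : Euc d → ℝ) (u : ℝ → Euc d → ℝ) (t : ℝ) (x : Euc d) :
    mildRHS d ρ₀ u t x = conv (heatKernel d t) ρ₀ x - DD (KK d t) (FF d u) x := by
  rw [DD_KK]; rfl

lemma measurable_DD (d : ℕ) {F : ℝ → Euc d → Euc d} (hF : Measurable (Function.uncurry F)) :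
    Measurable fun a : ℝ × Euc d => DD (KK d a.1) F a.2 := by
  have hg : Measurable fun b : ((ℝ × Euc d) × ℝ) × Euc d => (b.1.1.1, b.1.2, b.1.1.2 - b.2) := by fun_prop
  have hg2 : Measurable fun b : ((ℝ × Euc d) × ℝ) × Euc d => (b.1.2, b.2) := by fun_prop
  have h1 := (measurable_KK d).comp hg
  have h2 := hF.comp hg2
  have h3 := (h1.inner (𝕜 := ℝ) h2).stronglyMeasurable.integral_prod_right' (ν := (volume : Measure (Euc d)))
  exact (h3.integral_prod_right' (ν := (volume : Measure ℝ))).measurable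

lemma measurable_conv (d : ℕ) {ρ₀ : Euc d → ℝ} (h : Measurable ρ₀) :
    Measurable fun a : ℝ × Euc d => conv (heatKernel d a.1) ρ₀ a.2 := by
  have hg : Measurable fun b : (ℝ × Euc d) × Euc d => (b.1.1, b.1.2 - b.2) := by fun_prop
  have h1 := (measurable_heat d).comp hg
  have h2 : Measurable fun b : (ℝ × Euc d) × Euc d => ρ₀ b.2 := h.comp measurable_snd
  exact ((h1.mul h2).stronglyMeasurable.integral_prod_right' (ν := (volume : Measure (Euc d)))).measurable

lemma measurable_mild (d : ℕ) {ρ₀ : Euc d → ℝ} (h : Measurable ρ₀) {u : ℝ → Euc d → ℝ}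
    (hu : Measurable (Function.uncurry u)) : Measurable (Function.uncurry (mildRHS d ρ₀ u)) := by
  have : Function.uncurry (mildRHS d ρ₀ u) = fun a : ℝ × Euc d =>
      conv (heatKernel d a.1) ρ₀ a.2 - DD (KK d a.1) (FF d u) a.2 := by
    ext a; exact mildRHS_eq d ρ₀ u a.1 a.2
  rw [this]
  exact (measurable_conv d h).sub (measurable_DD d (measurable_FF d hu))

lemma FF_congr (d : ℕ) {u v : ℝ → Euc d → ℝ} {s : ℝ} (h : u s =ᵐ[volume] v s) :
    FF d u s =ᵐ[volume] FF d v s := by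
  have : gradc d (u s) = gradc d (v s) := by
    ext1 x
    unfold gradc
    congr 1
    refine integral_congr_ae ?_
    filter_upwards [h] with y hy
    rw [hy]
  filter_upwards [h] with y hy
  unfold FF
  rw [this, hy]

lemma mild_congr (d : ℕ) (ρ₀ : Euc d → ℝ) {u v : ℝ → Euc d → ℝ} {t : ℝ}
    (h : ∀ s ∈ Set.Ioc (0:ℝ) t, u s =ᵐ[volume] v s) (x : Euc d) :
    mildRHS d ρ₀ u t x = mildRHS d ρ₀ v t x := by
  unfold mildRHS
  congr 1
  refine setIntegral_congr_fun measurableSet_Ioc fun s hs => ?_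
  refine integral_congr_ae ?_
  filter_upwards [FF_congr d (h s hs)] with y hy
  unfold FF at hy
  rw [hy]

lemma mild_congr0 (d : ℕ) {ρ₀ ρ₁ : Euc d → ℝ} (h : ρ₀ =ᵐ[volume] ρ₁) (u : ℝ → Euc d → ℝ) (t : ℝ) (x : Euc d) :
    mildRHS d ρ₀ u t x = mildRHS d ρ₁ u t x := by
  unfold mildRHS conv
  congr 1
  refine integral_congr_ae ?_
  filter_upwards [h] with y hy
  rw [hy]

/-- weighted bound on `(0,t]`. -/
def WB (d : ℕ) (t : ℝ) (u : ℝ → Euc d → ℝ) (a : ℝ≥0∞) : Prop :=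
  ∀ s ∈ Set.Ioc (0:ℝ) t, ENNReal.ofReal (s ^ (1/4 : ℝ)) * eLpNorm (u s) (qd d) volume ≤ a

lemma WB.le {d : ℕ} {t : ℝ} {u : ℝ → Euc d → ℝ} {a : ℝ≥0∞} (h : WB d t u a) {s : ℝ} (hs : s ∈ Set.Ioc (0:ℝ) t) :
    eLpNorm (u s) (qd d) volume ≤ a * ENNReal.ofReal (s ^ (-(1/4 : ℝ))) := by
  have e : ENNReal.ofReal (s ^ (-(1/4 : ℝ))) * ENNReal.ofReal (s ^ (1/4 : ℝ)) = 1 := by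
    rw [← ENNReal.ofReal_mul (Real.rpow_nonneg hs.1.le _), ← Real.rpow_add hs.1]; simp
  calc _ = ENNReal.ofReal (s ^ (-(1/4 : ℝ))) * (ENNReal.ofReal (s ^ (1/4 : ℝ)) * eLpNorm (u s) (qd d) volume) := by
        rw [← mul_assoc, e, one_mul]
    _ ≤ ENNReal.ofReal (s ^ (-(1/4 : ℝ))) * a := by gcongr; exact h s hs
    _ = _ := mul_comm _ _

lemma WB.ne_top {d : ℕ} {t : ℝ} {u : ℝ → Euc d → ℝ} {a : ℝ≥0∞} (h : WB d t u a) (ha : a ≠ ⊤) {s : ℝ}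
    (hs : s ∈ Set.Ioc (0:ℝ) t) : eLpNorm (u s) (qd d) volume ≠ ⊤ :=
  ne_top_of_le_ne_top (by finiteness) (h.le hs)

lemma slice_meas {d : ℕ} {E : Type*} [MeasurableSpace E] {u : ℝ → Euc d → E} (hu : Measurable (Function.uncurry u)) (s : ℝ) :
    Measurable (u s) := hu.comp (measurable_const.prodMk measurable_id)

lemma flux_w (d : ℕ) (hd : 1 ≤ d) : ∃ A : ℝ≥0∞, A ≠ ⊤ ∧ ∀ t : ℝ, ∀ u v : ℝ → Euc d → ℝ,
    Measurable (Function.uncurry u) → Measurable (Function.uncurry v) → ∀ a b δ : ℝ≥0∞, a ≠ ⊤ → b ≠ ⊤ →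
    WB d t u a → WB d t v b → WB d t (fun s y => u s y - v s y) δ → ∀ s ∈ Set.Ioc (0:ℝ) t,
    ∫⁻ y, ‖FF d u s y - FF d v s y‖ₑ ≤ A * ((a + b) * δ) * ENNReal.ofReal (s ^ (-(1/2:ℝ))) := by
  obtain ⟨A, hA, h⟩ := flux d hd
  refine ⟨A, hA, ?_⟩
  intro t u v hu hv a b δ ha hb hua hvb huv s hs
  refine (h (u s) (v s) (slice_meas hu s) (slice_meas hv s) (hua.ne_top ha hs) (hvb.ne_top hb hs)).trans ?_
  have e : ENNReal.ofReal (s ^ (-(1/4 : ℝ))) * ENNReal.ofReal (s ^ (-(1/4 : ℝ))) = ENNReal.ofReal (s ^ (-(1/2:ℝ))) := by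
    rw [← ENNReal.ofReal_mul (Real.rpow_nonneg hs.1.le _), ← Real.rpow_add hs.1]; norm_num
  calc _ ≤ A * ((a * ENNReal.ofReal (s ^ (-(1/4 : ℝ))) + b * ENNReal.ofReal (s ^ (-(1/4 : ℝ)))) *
        (δ * ENNReal.ofReal (s ^ (-(1/4 : ℝ))))) := by
        gcongr
        · exact hua.le hs
        · exact hvb.le hs
        · exact huv.le hs
    _ = _ := by rw [← e]; ring

lemma FF_zero (d : ℕ) : FF d (fun _ _ => 0) = fun _ _ => 0 := by
  ext1 s; ext1 y; simp [FF]

lemma DD_zero {d : ℕ} (K : ℝ → Euc d → Euc d) (x : Euc d) : DD K (fun _ _ => 0) x = 0 := by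
  simp [DD]

lemma WB_zero (d : ℕ) (t : ℝ) : WB d t (fun _ _ => 0) 0 := by
  intro s _
  have : eLpNorm (fun _ : Euc d => (0:ℝ)) (qd d) volume = 0 := eLpNorm_zero'
  simp [this]

/-- flux bound for a single function -/
lemma flux_w1 (d : ℕ) (hd : 1 ≤ d) : ∃ A : ℝ≥0∞, A ≠ ⊤ ∧ ∀ t : ℝ, ∀ u : ℝ → Euc d → ℝ,
    Measurable (Function.uncurry u) → ∀ a : ℝ≥0∞, a ≠ ⊤ → WB d t u a → ∀ s ∈ Set.Ioc (0:ℝ) t,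
    ∫⁻ y, ‖FF d u s y‖ₑ ≤ A * (a * a) * ENNReal.ofReal (s ^ (-(1/2:ℝ))) := by
  obtain ⟨A, hA, h⟩ := flux_w d hd
  refine ⟨A, hA, fun t u hu a ha hua s hs => ?_⟩
  have := h t u (fun _ _ => 0) hu measurable_const a 0 a ha (by simp) hua (WB_zero d t) (by simpa using hua) s hs
  simpa [FF_zero] using this

/-- contraction estimate -/
lemma contr (d : ℕ) (hd : 1 ≤ d) : ∃ E : ℝ≥0∞, E ≠ ⊤ ∧ ∀ t : ℝ, 0 < t → ∀ ρ₀ : Euc d → ℝ, ∀ u v : ℝ → Euc d → ℝ,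
    Measurable (Function.uncurry u) → Measurable (Function.uncurry v) → ∀ a b δ : ℝ≥0∞, a ≠ ⊤ → b ≠ ⊤ →
    WB d t u a → WB d t v b → WB d t (fun s y => u s y - v s y) δ →
    eLpNorm (fun x => mildRHS d ρ₀ u t x - mildRHS d ρ₀ v t x) 1 volume ≤ E * ((a + b) * δ) ∧
    ENNReal.ofReal (t ^ (1/4 : ℝ)) * eLpNorm (fun x => mildRHS d ρ₀ u t x - mildRHS d ρ₀ v t x) (qd d) volume
      ≤ E * ((a + b) * δ) := by
  obtain ⟨A, hA, hfl⟩ := flux_w d hd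
  obtain ⟨A1, hA1, hfl1⟩ := flux_w1 d hd
  obtain ⟨c, hc, hdu⟩ := duh_bound d hd
  refine ⟨c * A, by finiteness, ?_⟩
  intro t ht ρ₀ u v hu hv a b δ ha hb hua hvb huv
  have hFu := measurable_FF d hu
  have hFv := measurable_FF d hv
  have hK := measurable_KK' d t
  have hJ : ∀ w : ℝ → Euc d → ℝ, Measurable (Function.uncurry w) → ∀ r : ℝ≥0∞, r ≠ ⊤ → WB d t w r →
      ∀ᵐ x, JJ (KK d t) (FF d w) x < ⊤ := by
    intro w hw r hr hwr
    have h1 := (hdu t ht (FF d w) (measurable_FF d hw) _ (hfl1 t w hw r hr hwr)).1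
    exact ae_lt_top (measurable_JJ hK (measurable_FF d hw)) (ne_top_of_le_ne_top (by finiteness) h1)
  have hbd := hdu t ht (fun s y => FF d u s y - FF d v s y) (hFu.sub hFv) _ (hfl t u v hu hv a b δ ha hb hua hvb huv)
  have hle : ∀ᵐ x, ‖mildRHS d ρ₀ u t x - mildRHS d ρ₀ v t x‖ₑ ≤ JJ (KK d t) (fun s y => FF d u s y - FF d v s y) x := by
    filter_upwards [hJ u hu a ha hua, hJ v hv b hb hvb] with x h1 h2
    rw [mildRHS_eq, mildRHS_eq, sub_sub_sub_cancel_left, ← enorm_neg, neg_sub, DD_sub hK hFu hFv h1 h2]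
    exact DD_le_JJ _ _ _
  have hp0 : 0 < pR d := by linarith [pR_gt hd]
  constructor
  · rw [eLpNorm_one_eq_lintegral_enorm]
    refine (lintegral_mono_ae hle).trans (hbd.1.trans ?_)
    rw [mul_assoc]
  · rw [eLpNorm_qd hd]
    have e : ENNReal.ofReal (t ^ (1/4 : ℝ)) * ENNReal.ofReal (t ^ (-(1/4 : ℝ))) = 1 := by
      rw [← ENNReal.ofReal_mul (Real.rpow_nonneg ht.le _), ← Real.rpow_add ht]; simp
    calc _ ≤ ENNReal.ofReal (t ^ (1/4 : ℝ)) * (c * (A * ((a + b) * δ)) * ENNReal.ofReal (t ^ (-(1/4 : ℝ)))) := by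
          gcongr
          refine le_trans ?_ hbd.2
          gcongr ?_ ^ _
          refine lintegral_mono_ae ?_
          filter_upwards [hle] with x hx
          exact ENNReal.rpow_le_rpow hx hp0.le
      _ = c * A * ((a + b) * δ) * (ENNReal.ofReal (t ^ (1/4 : ℝ)) * ENNReal.ofReal (t ^ (-(1/4 : ℝ)))) := by ring
      _ ≤ _ := by rw [e, mul_one]

lemma mild_zero (d : ℕ) (ρ₀ : Euc d → ℝ) (t : ℝ) (x : Euc d) :
    mildRHS d ρ₀ (fun _ _ => 0) t x = conv (heatKernel d t) ρ₀ x := by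
  rw [mildRHS_eq, FF_zero, DD_zero, sub_zero]

lemma WB.mono {d : ℕ} {t : ℝ} {u : ℝ → Euc d → ℝ} {a b : ℝ≥0∞} (h : WB d t u a) (hab : a ≤ b) : WB d t u b :=
  fun s hs => (h s hs).trans hab

lemma WB.add {d : ℕ} (hd : 1 ≤ d) {t : ℝ} {u v w : ℝ → Euc d → ℝ} {a b : ℝ≥0∞}
    (hu : ∀ s ∈ Set.Ioc (0:ℝ) t, AEStronglyMeasurable (u s) volume)
    (hv : ∀ s ∈ Set.Ioc (0:ℝ) t, AEStronglyMeasurable (v s) volume)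
    (h : WB d t u a) (h' : WB d t v b) (e : ∀ s ∈ Set.Ioc (0:ℝ) t, ∀ x, w s x = u s x + v s x) : WB d t w (a + b) := by
  intro s hs
  have : w s = u s + v s := by ext x; exact e s hs x
  rw [this]
  calc _ ≤ ENNReal.ofReal (s ^ (1/4 : ℝ)) * (eLpNorm (u s) (qd d) volume + eLpNorm (v s) (qd d) volume) := by
        gcongr
        exact eLpNorm_add_le (hu s hs) (hv s hs) (qd_one_le hd)
    _ ≤ _ := by rw [mul_add]; exact add_le_add (h s hs) (h' s hs)

lemma WB.lim {d : ℕ} {t : ℝ} {U : ℕ → ℝ → Euc d → ℝ} {u : ℝ → Euc d → ℝ} {a : ℝ≥0∞}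
    (hU : ∀ n, Measurable (Function.uncurry (U n))) (h : ∀ᶠ n in atTop, WB d t (U n) a)
    (hl : ∀ s ∈ Set.Ioc (0:ℝ) t, ∀ᵐ x, Tendsto (fun n => U n s x) atTop (𝓝 (u s x))) : WB d t u a := by
  intro s hs
  have hpos := Real.rpow_pos_of_pos hs.1 (1/4)
  rw [mul_comm, ← ENNReal.le_div_iff_mul_le (Or.inl (ofReal_rpow_ne hs.1)) (Or.inl ENNReal.ofReal_ne_top)]
  refine (Lp.eLpNorm_lim_le_liminf_eLpNorm (fun n => (slice_meas (hU n) s).aestronglyMeasurable) (u s) (hl s hs)).trans ?_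
  apply liminf_le_of_frequently_le'
  apply Eventually.frequently
  filter_upwards [h] with n hn
  rw [ENNReal.le_div_iff_mul_le (Or.inl (ofReal_rpow_ne hs.1)) (Or.inl ENNReal.ofReal_ne_top), mul_comm]
  exact hn s hs

/-- Picard iterates -/
def UU (d : ℕ) (ρ₀ : Euc d → ℝ) : ℕ → ℝ → Euc d → ℝ
  | 0 => fun _ _ => 0
  | n + 1 => mildRHS d ρ₀ (UU d ρ₀ n)

lemma measurable_UU (d : ℕ) {ρ₀ : Euc d → ℝ} (h : Measurable ρ₀) (n : ℕ) : Measurable (Function.uncurry (UU d ρ₀ n)) := by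
  induction n with
  | zero => exact measurable_const
  | succ n ih => exact measurable_mild d h ih

/-- the constant property -/
def CC (d : ℕ) (E : ℝ≥0∞) : Prop := ∀ t : ℝ, 0 < t → ∀ ρ₀ : Euc d → ℝ, ∀ u v : ℝ → Euc d → ℝ,
    Measurable (Function.uncurry u) → Measurable (Function.uncurry v) → ∀ a b δ : ℝ≥0∞, a ≠ ⊤ → b ≠ ⊤ →
    WB d t u a → WB d t v b → WB d t (fun s y => u s y - v s y) δ →
    eLpNorm (fun x => mildRHS d ρ₀ u t x - mildRHS d ρ₀ v t x) 1 volume ≤ E * ((a + b) * δ) ∧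
    ENNReal.ofReal (t ^ (1/4 : ℝ)) * eLpNorm (fun x => mildRHS d ρ₀ u t x - mildRHS d ρ₀ v t x) (qd d) volume
      ≤ E * ((a + b) * δ)

lemma CC.wb {d : ℕ} {E : ℝ≥0∞} (h : CC d E) {T : ℝ} (ρ₀ : Euc d → ℝ) {u v : ℝ → Euc d → ℝ}
    (hu : Measurable (Function.uncurry u)) (hv : Measurable (Function.uncurry v)) {a b δ : ℝ≥0∞} (ha : a ≠ ⊤) (hb : b ≠ ⊤)
    (hua : WB d T u a) (hvb : WB d T v b) (huv : WB d T (fun s y => u s y - v s y) δ) :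
    WB d T (fun s y => mildRHS d ρ₀ u s y - mildRHS d ρ₀ v s y) (E * ((a + b) * δ)) := by
  intro t ht
  have hr : ∀ {w : ℝ → Euc d → ℝ} {r : ℝ≥0∞}, WB d T w r → WB d t w r :=
    fun hw s hs => hw s ⟨hs.1, hs.2.trans ht.2⟩
  exact (h t ht.1 ρ₀ u v hu hv a b δ ha hb (hr hua) (hr hvb) (hr huv)).2

lemma UU_bound {d : ℕ} (hd : 1 ≤ d) {E : ℝ≥0∞} (hE : CC d E) {ρ₀ : Euc d → ℝ} (hρ : Measurable ρ₀) {T : ℝ}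
    {Θ : ℝ≥0∞} (hΘ : Θ ≠ ⊤) (hs : E * (2 * Θ + 2 * Θ) ≤ 1 / 2)
    (h0 : WB d T (fun t => conv (heatKernel d t) ρ₀) Θ) (n : ℕ) : WB d T (UU d ρ₀ n) (2 * Θ) := by
  induction n with
  | zero => exact (WB_zero d T).mono zero_le
  | succ n ih =>
    have h1 := hE.wb ρ₀ (measurable_UU d hρ n) (measurable_UU d hρ 0) (a := 2 * Θ) (b := 0) (δ := 2 * Θ)
      (by finiteness) (by simp) ih (WB_zero d T) (by simpa [UU] using ih)
    have h2 : E * ((2 * Θ + 0) * (2 * Θ)) ≤ Θ := by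
      calc _ ≤ E * ((2 * Θ + 2 * Θ) * (2 * Θ)) := by gcongr; exact zero_le
        _ = E * (2 * Θ + 2 * Θ) * (2 * Θ) := by ring
        _ ≤ 1 / 2 * (2 * Θ) := by gcongr
        _ = Θ := by rw [one_div, ← mul_assoc, ENNReal.inv_mul_cancel (by simp) (by simp), one_mul]
    have h3 := WB.add hd (w := UU d ρ₀ (n+1)) ?_ ?_ h0 (h1.mono h2) ?_
    · rwa [← two_mul] at h3
    · intro s _
      exact (slice_meas (u := fun t => conv (heatKernel d t) ρ₀) (measurable_conv d hρ) s).aestronglyMeasurable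
    · intro s _
      exact ((slice_meas (measurable_UU d hρ (n+1)) s).sub (slice_meas (measurable_UU d hρ 1) s)).aestronglyMeasurable
    · intro s _ x
      have : mildRHS d ρ₀ (UU d ρ₀ 0) s x = conv (heatKernel d s) ρ₀ x := mild_zero d ρ₀ s x
      simp only [this]
      simp [UU]

lemma UU_cauchy {d : ℕ} (hd : 1 ≤ d) {E : ℝ≥0∞} (hE : CC d E) {ρ₀ : Euc d → ℝ} (hρ : Measurable ρ₀) {T : ℝ}
    {Θ : ℝ≥0∞} (hΘ : Θ ≠ ⊤) (hs : E * (2 * Θ + 2 * Θ) ≤ 1 / 2)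
    (h0 : WB d T (fun t => conv (heatKernel d t) ρ₀) Θ) (N : ℕ) : ∀ n m, N ≤ n → N ≤ m →
    WB d T (fun s y => UU d ρ₀ n s y - UU d ρ₀ m s y) ((2⁻¹) ^ N * (4 * Θ)) := by
  have hb := UU_bound hd hE hρ hΘ hs h0
  induction N with
  | zero =>
    intro n m _ _
    have h3 := WB.add hd (u := UU d ρ₀ n) (v := fun s y => - UU d ρ₀ m s y)
      (w := fun s y => UU d ρ₀ n s y - UU d ρ₀ m s y) (b := 2 * Θ)
      (fun s _ => (slice_meas (measurable_UU d hρ n) s).aestronglyMeasurable)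
      (fun s _ => (slice_meas (measurable_UU d hρ m) s).neg.aestronglyMeasurable) (hb n) ?_ ?_
    · refine h3.mono (le_of_eq ?_); ring
    · intro s hs
      have := hb m s hs
      rwa [← eLpNorm_neg] at this
    · intro s _ x; ring
  | succ N ih =>
    intro n m hn hm
    obtain ⟨n, rfl⟩ : ∃ k, n = k + 1 := ⟨n - 1, by omega⟩
    obtain ⟨m, rfl⟩ : ∃ k, m = k + 1 := ⟨m - 1, by omega⟩
    have h1 := hE.wb ρ₀ (measurable_UU d hρ n) (measurable_UU d hρ m) (by finiteness) (by finiteness)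
      (hb n) (hb m) (ih n m (by omega) (by omega))
    refine h1.mono ?_
    calc _ = E * (2 * Θ + 2 * Θ) * (2⁻¹ ^ N * (4 * Θ)) := by ring
      _ ≤ 1 / 2 * (2⁻¹ ^ N * (4 * Θ)) := by gcongr
      _ = _ := by rw [one_div, pow_succ]; ring

lemma geom_tendsto {Θ : ℝ≥0∞} (hΘ : Θ ≠ ⊤) : Tendsto (fun N : ℕ => (2⁻¹ : ℝ≥0∞) ^ N * Θ) atTop (𝓝 0) := by
  have h1 : Tendsto (fun N : ℕ => (2⁻¹ : ℝ≥0∞) ^ N) atTop (𝓝 0) :=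
    ENNReal.tendsto_pow_atTop_nhds_zero_of_lt_one (by simp [ENNReal.inv_lt_one])
  have := ENNReal.Tendsto.mul_const h1 (Or.inr hΘ)
  simpa using this

lemma fixed_point {d : ℕ} (hd : 1 ≤ d) {E : ℝ≥0∞} (hE : CC d E) {ρ₀ : Euc d → ℝ} (hρ : Measurable ρ₀)
    {T : ℝ} {Θ : ℝ≥0∞} (hΘ : Θ ≠ ⊤) (hΘ0 : Θ ≠ 0) (hs : E * (2 * Θ + 2 * Θ) ≤ 1 / 2)
    (h0 : WB d T (fun t => conv (heatKernel d t) ρ₀) Θ) :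
    ∃ u : ℝ → Euc d → ℝ, Measurable (Function.uncurry u) ∧ WB d T u (2 * Θ) ∧
      ∀ t ∈ Set.Ioc (0:ℝ) T, u t =ᵐ[volume] mildRHS d ρ₀ u t := by
  have hb := UU_bound hd hE hρ hΘ hs h0
  have hc := UU_cauchy hd hE hρ hΘ hs h0
  have hm := measurable_UU d hρ
  set u : ℝ → Euc d → ℝ := fun t x => limUnder atTop (fun n => UU d ρ₀ n t x) with hu
  have hum : Measurable (Function.uncurry u) := by
    have := StronglyMeasurable.limUnder (l := atTop) (f := fun n => Function.uncurry (UU d ρ₀ n))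
      (fun n => (hm n).stronglyMeasurable)
    exact this.measurable
  have hl : ∀ s ∈ Set.Ioc (0:ℝ) T, ∀ᵐ x, Tendsto (fun n => UU d ρ₀ n s x) atTop (𝓝 (u s x)) := by
    intro s hs
    have hr : ENNReal.ofReal (s ^ (-(1/4:ℝ))) ≠ 0 := ofReal_rpow_ne hs.1
    set c := 4 * Θ * ENNReal.ofReal (s ^ (-(1/4:ℝ))) with hcdef
    have hct : c ≠ ⊤ := by finiteness
    have hc0 : c ≠ 0 := mul_ne_zero (mul_ne_zero (by simp) hΘ0) hr
    have := Lp.ae_tendsto_of_cauchy_eLpNorm (μ := (volume : Measure (Euc d))) (p := qd d) (f := fun n => UU d ρ₀ n s)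
      (B := fun N => 2⁻¹ ^ N * (c + c))
      (fun n => (slice_meas (hm n) s).aestronglyMeasurable) (qd_one_le hd) ?_ ?_
    · filter_upwards [this] with x hx
      exact tendsto_nhds_limUnder hx
    · rw [ENNReal.tsum_mul_right, ENNReal.tsum_geometric]
      simp only [ENNReal.one_sub_inv_two, inv_inv]
      finiteness
    · intro N n m hn hm
      have h1 := (hc N n m hn hm).le hs
      refine lt_of_le_of_lt h1 ?_
      rw [mul_assoc, ← hcdef, mul_add]
      apply ENNReal.lt_add_right (by finiteness)
      exact mul_ne_zero (by simp) hc0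
  have hub : WB d T u (2 * Θ) := WB.lim hm (Eventually.of_forall hb) hl
  have huc : ∀ N, WB d T (fun s y => u s y - UU d ρ₀ N s y) ((2⁻¹) ^ N * (4 * Θ)) := by
    intro N
    refine WB.lim (U := fun n s y => UU d ρ₀ n s y - UU d ρ₀ N s y) (fun n => (hm n).sub (hm N)) ?_ ?_
    · filter_upwards [eventually_ge_atTop N] with n hn
      exact hc N n N hn le_rfl
    · intro s hs
      filter_upwards [hl s hs] with x hx
      exact hx.sub_const _
  refine ⟨u, hum, hub, ?_⟩
  intro t ht
  have hd1 : ∀ N, WB d T (fun s y => u s y - mildRHS d ρ₀ u s y) ((2⁻¹) ^ N * (8 * Θ)) := by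
    intro N
    have hneg : WB d T (fun s y => UU d ρ₀ N s y - u s y) ((2⁻¹) ^ N * (4 * Θ)) := by
      intro s hs
      have := huc N s hs
      rw [← eLpNorm_neg] at this
      convert this using 4
      ext x; simp
    have h1 := hE.wb ρ₀ (hm N) hum (by finiteness) (by finiteness) (hb N) hub hneg
    have h2 : E * ((2 * Θ + 2 * Θ) * ((2⁻¹) ^ N * (4 * Θ))) ≤ (2⁻¹) ^ N * (4 * Θ) := by
      calc _ = E * (2 * Θ + 2 * Θ) * (2⁻¹ ^ N * (4 * Θ)) := by ring
        _ ≤ 1 * (2⁻¹ ^ N * (4 * Θ)) := by gcongr; exact hs.trans (by simp)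
        _ = _ := one_mul _
    have h3 := WB.add hd (w := fun s y => u s y - mildRHS d ρ₀ u s y) ?_ ?_ (huc (N+1)) (h1.mono h2) ?_
    · refine h3.mono ?_
      calc _ ≤ 2⁻¹ ^ N * (4 * Θ) + 2⁻¹ ^ N * (4 * Θ) := by
            gcongr ?_ * _ + _
            rw [pow_succ]
            calc _ ≤ (2⁻¹ : ℝ≥0∞) ^ N * 1 := by gcongr; simp
              _ = _ := mul_one _
        _ = _ := by ring
    · intro s _
      exact ((slice_meas hum s).sub (slice_meas (hm (N+1)) s)).aestronglyMeasurable
    · intro s _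
      exact ((slice_meas (measurable_mild d hρ (hm N)) s).sub (slice_meas (measurable_mild d hρ hum) s)).aestronglyMeasurable
    · intro s _ x
      simp [UU]
  have h8 : WB d T (fun s y => u s y - mildRHS d ρ₀ u s y) 0 := by
    intro s hs
    exact ge_of_tendsto (geom_tendsto (Θ := 8 * Θ) (by finiteness)) (Eventually.of_forall fun N => hd1 N s hs)
  have h9 := h8.le ht
  rw [zero_mul, nonpos_iff_eq_zero, eLpNorm_eq_zero_iff] at h9
  · filter_upwards [h9] with x hx
    simp only [Pi.zero_apply] at hx
    linarith
  · exact ((slice_meas hum t).sub (slice_meas (measurable_mild d hρ hum) t)).aestronglyMeasurable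
  · exact qd_ne_zero hd

/-- mollification -/
def mol {d : ℕ} (φ : Euc d → ℝ) (g : Euc d → ℝ) (x : Euc d) : ℝ :=
  convolution φ g (ContinuousLinearMap.lsmul ℝ ℝ) volume x

lemma mol_eq {d : ℕ} (φ g : Euc d → ℝ) (x : Euc d) : mol φ g x = ∫ t, φ (x - t) * g t := by
  unfold mol
  rw [convolution_eq_swap]
  rfl

lemma mol_diff {d : ℕ} {φ f g : Euc d → ℝ} (hφ : Continuous φ) {C : ℝ} (hC : ∀ x, ‖φ x‖ ≤ C)
    (hf : Integrable f) (hg : Integrable g) (x : Euc d) :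
    ‖mol φ f x - mol φ g x‖ₑ ≤ ENNReal.ofReal C * eLpNorm (fun y => f y - g y) 1 volume := by
  have hi : ∀ h : Euc d → ℝ, Integrable h → Integrable (fun t => φ (x - t) * h t) := by
    intro h hh
    refine hh.bdd_mul (c := C) ?_ (Eventually.of_forall fun t => hC _)
    exact (hφ.comp (continuous_const.sub continuous_id)).aestronglyMeasurable
  rw [mol_eq, mol_eq, ← integral_sub (hi f hf) (hi g hg), eLpNorm_one_eq_lintegral_enorm,
    ← lintegral_const_mul' _ _ ENNReal.ofReal_ne_top]
  refine (enorm_integral_le_lintegral_enorm _).trans (lintegral_mono fun t => ?_)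
  rw [← mul_sub, enorm_mul]
  gcongr
  rw [← ofReal_norm_eq_enorm]
  exact ENNReal.ofReal_le_ofReal (hC _)

lemma meas_rep {d : ℕ} {T : ℝ} {ρ : ℝ → Euc d → ℝ} (h1 : ∀ t ∈ Set.Ioc (0:ℝ) T, MemLp (ρ t) 1 volume)
    (h2 : ∀ t ∈ Set.Ioc (0:ℝ) T,
    Filter.Tendsto (fun s => eLpNorm (fun x => ρ s x - ρ t x) 1 volume)
      (nhdsWithin t (Set.Ioc (0:ℝ) T)) (nhds 0)) :
    ∃ v : ℝ → Euc d → ℝ, Measurable (Function.uncurry v) ∧ ∀ t ∈ Set.Ioc (0:ℝ) T, ρ t =ᵐ[volume] v t := by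
  classical
  have hint : ∀ t ∈ Set.Ioc (0:ℝ) T, Integrable (ρ t) := fun t ht => memLp_one_iff_integrable.1 (h1 t ht)
  let φ : ℕ → ContDiffBump (0 : Euc d) := fun n =>
    ⟨1 / ((n:ℝ) + 1), 2 / ((n:ℝ) + 1), by positivity, by gcongr; norm_num⟩
  let V : ℕ → ℝ → Euc d → ℝ := fun n s x =>
    (Set.Ioc (0:ℝ) T).piecewise (fun s => mol ((φ n).normed volume) (ρ s) x) (fun _ => 0) s
  have hV : ∀ n, Measurable (Function.uncurry (V n)) := by
    intro n
    have hφc : Continuous ((φ n).normed (volume : Measure (Euc d))) := (φ n).continuous_normed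
    have hφs : HasCompactSupport ((φ n).normed (volume : Measure (Euc d))) := (φ n).hasCompactSupport_normed
    obtain ⟨C, hC⟩ := hφc.bounded_above_of_compact_support hφs
    have hm : Measurable (Function.uncurry fun (x : Euc d) (s : ℝ) => V n s x) := by
      apply measurable_uncurry_of_continuous_of_measurable
      · intro s
        by_cases hs : s ∈ Set.Ioc (0:ℝ) T
        · simp only [V, Set.piecewise, hs, if_true]
          exact hφs.continuous_convolution_left (ContinuousLinearMap.lsmul ℝ ℝ) hφc (hint s hs).locallyIntegrable
        · simp only [V, Set.piecewise, hs, if_false]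
          exact continuous_const
      · intro x
        refine ContinuousOn.measurable_piecewise ?_ continuousOn_const measurableSet_Ioc
        intro s hs
        have h3 := h2 s hs
        refine tendsto_iff_edist_tendsto_0.2 ?_
        have h4 := ENNReal.Tendsto.const_mul h3 (Or.inr (ENNReal.ofReal_ne_top (r := C)))
        rw [mul_zero] at h4
        refine tendsto_of_tendsto_of_tendsto_of_le_of_le' tendsto_const_nhds h4 (Eventually.of_forall fun _ => zero_le) ?_
        filter_upwards [self_mem_nhdsWithin] with s' hs'
        rw [edist_eq_enorm_sub]
        exact mol_diff hφc hC (hint s' hs') (hint s hs) x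
    exact hm.comp measurable_swap
  refine ⟨fun s x => limUnder atTop (fun n => V n s x), ?_, ?_⟩
  · have := StronglyMeasurable.limUnder (l := atTop) (f := fun n => Function.uncurry (V n))
      (fun n => (hV n).stronglyMeasurable)
    exact this.measurable
  · intro t ht
    have h5 := ContDiffBump.ae_convolution_tendsto_right_of_locallyIntegrable (μ := (volume : Measure (Euc d)))
      (φ := φ) (l := atTop) (K := 2) (g := ρ t) ?_ ?_ (hint t ht).locallyIntegrable
    · filter_upwards [h5] with x hx
      have e : (fun n => V n t x) = fun i => (convolution ((φ i).normed volume) (ρ t) (ContinuousLinearMap.lsmul ℝ ℝ) volume) x := by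
        ext n
        simp only [V, Set.piecewise, ht, if_true]
        rfl
      rw [e]
      exact hx.limUnder_eq.symm
    · change Tendsto (fun n : ℕ => 2 / ((n:ℝ) + 1)) atTop (𝓝 0)
      exact tendsto_const_div_atTop_nhds_zero_nat 2 |>.comp (tendsto_add_atTop_nat 1) |>.congr (fun n => by simp)
    · refine Eventually.of_forall fun n => ?_
      change 2 / ((n:ℝ) + 1) ≤ 2 * (1 / ((n:ℝ) + 1))
      apply le_of_eq; ring

lemma WB.congr {d : ℕ} {t : ℝ} {u v : ℝ → Euc d → ℝ} {a : ℝ≥0∞} (h : WB d t u a)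
    (e : ∀ s ∈ Set.Ioc (0:ℝ) t, u s =ᵐ[volume] v s) : WB d t v a := by
  intro s hs
  rw [← eLpNorm_congr_ae (e s hs)]
  exact h s hs

lemma WB_zero_ae {d : ℕ} (hd : 1 ≤ d) {T : ℝ} {u v : ℝ → Euc d → ℝ} (hu : Measurable (Function.uncurry u))
    (hv : Measurable (Function.uncurry v)) (h : WB d T (fun s y => u s y - v s y) 0) :
    ∀ t ∈ Set.Ioc (0:ℝ) T, u t =ᵐ[volume] v t := by
  intro t ht
  have h9 := h.le ht
  rw [zero_mul, nonpos_iff_eq_zero, eLpNorm_eq_zero_iff] at h9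
  · filter_upwards [h9] with x hx
    simp only [Pi.zero_apply] at hx
    linarith
  · exact ((slice_meas hu t).sub (slice_meas hv t)).aestronglyMeasurable
  · exact qd_ne_zero hd

lemma unique_fp {d : ℕ} (hd : 1 ≤ d) {E : ℝ≥0∞} (hE : CC d E) {ρ₀ : Euc d → ℝ}
    {T : ℝ} {Θ : ℝ≥0∞} (hΘ : Θ ≠ ⊤) (hs : E * (2 * Θ + 2 * Θ) ≤ 1 / 2) {u v : ℝ → Euc d → ℝ}
    (hu : Measurable (Function.uncurry u)) (hv : Measurable (Function.uncurry v))
    (hub : WB d T u (2 * Θ)) (hvb : WB d T v (2 * Θ))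
    (hfu : ∀ t ∈ Set.Ioc (0:ℝ) T, u t =ᵐ[volume] mildRHS d ρ₀ u t)
    (hfv : ∀ t ∈ Set.Ioc (0:ℝ) T, v t =ᵐ[volume] mildRHS d ρ₀ v t) :
    ∀ t ∈ Set.Ioc (0:ℝ) T, u t =ᵐ[volume] v t := by
  have key : ∀ N : ℕ, WB d T (fun s y => u s y - v s y) (2⁻¹ ^ N * (4 * Θ)) := by
    intro N
    induction N with
    | zero =>
      have h3 := WB.add hd (u := u) (v := fun s y => - v s y)
        (w := fun s y => u s y - v s y) (b := 2 * Θ)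
        (fun s _ => (slice_meas hu s).aestronglyMeasurable)
        (fun s _ => (slice_meas hv s).neg.aestronglyMeasurable) hub ?_ ?_
      · refine h3.mono (le_of_eq ?_); ring
      · intro s hs
        have := hvb s hs
        rwa [← eLpNorm_neg] at this
      · intro s _ x; ring
    | succ N ih =>
      have h1 := hE.wb ρ₀ hu hv (by finiteness) (by finiteness) hub hvb ih
      have h2 : WB d T (fun s y => u s y - v s y) (E * ((2 * Θ + 2 * Θ) * (2⁻¹ ^ N * (4 * Θ)))) := by
        refine h1.congr fun s hs => ?_
        filter_upwards [hfu s hs, hfv s hs] with x hx hx'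
        rw [hx, hx']
      refine h2.mono ?_
      calc _ = E * (2 * Θ + 2 * Θ) * (2⁻¹ ^ N * (4 * Θ)) := by ring
        _ ≤ 1 / 2 * (2⁻¹ ^ N * (4 * Θ)) := by gcongr
        _ = _ := by rw [one_div, pow_succ]; ring
  refine WB_zero_ae hd hu hv fun s hs => ?_
  exact ge_of_tendsto (geom_tendsto (Θ := 4 * Θ) (by finiteness)) (Eventually.of_forall fun N => key N s hs)

lemma gradHeat_dom (d : ℕ) {a b τ : ℝ} (ha : 0 < a) (h1 : a ≤ τ) (h2 : τ ≤ b) (z : Euc d) :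
    ‖gradHeat d τ z‖ ≤ ((4 * Real.pi * a) ^ (-(d : ℝ) / 2) * (2 * a)⁻¹ * ((4 * Real.pi * b) ^ (-(d : ℝ) / 2) * (2 * b)⁻¹)⁻¹)
      * ‖gradHeat d b z‖ := by
  have hτ : 0 < τ := by linarith
  have hb : 0 < b := by linarith
  rw [gradHeat_eq, gradHeat_eq, norm_smul, norm_smul, norm_neg, norm_neg, norm_mul, norm_mul,
    Real.norm_of_nonneg (heat_pos d hτ z).le, Real.norm_of_nonneg (heat_pos d hb z).le,
    Real.norm_of_nonneg (by positivity), Real.norm_of_nonneg (by positivity)]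
  have e1 : (4 * Real.pi * τ) ^ (-(d : ℝ) / 2) ≤ (4 * Real.pi * a) ^ (-(d : ℝ) / 2) := by
    apply Real.rpow_le_rpow_of_nonpos (by positivity) (by gcongr)
    have : (0:ℝ) ≤ d := by positivity
    linarith
  have e2 : Real.exp (-‖z‖ ^ 2 / (4 * τ)) ≤ Real.exp (-‖z‖ ^ 2 / (4 * b)) := by
    apply Real.exp_le_exp.2
    rw [neg_div, neg_div]
    apply neg_le_neg
    gcongr
  have e3 : (2 * τ)⁻¹ ≤ (2 * a)⁻¹ := by gcongr
  have hB : 0 < (4 * Real.pi * b) ^ (-(d : ℝ) / 2) := by positivity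
  have hB2 : 0 < (2 * b)⁻¹ := by positivity
  calc heatKernel d τ z * (2 * τ)⁻¹ * ‖z‖
      ≤ ((4 * Real.pi * a) ^ (-(d : ℝ) / 2) * Real.exp (-‖z‖ ^ 2 / (4 * b))) * (2 * a)⁻¹ * ‖z‖ := by
        unfold heatKernel; gcongr
    _ = _ := by
        unfold heatKernel
        rw [mul_inv]
        field_simp

lemma gradHeat_L1_cont (d : ℕ) {τ₀ : ℝ} (h0 : 0 < τ₀) :
    Tendsto (fun τ => ∫⁻ z, ‖gradHeat d τ z - gradHeat d τ₀ z‖ₑ) (𝓝 τ₀) (𝓝 0) := by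
  set C := ((4 * Real.pi * (τ₀ / 2)) ^ (-(d : ℝ) / 2) * (2 * (τ₀ / 2))⁻¹ *
    ((4 * Real.pi * (2 * τ₀)) ^ (-(d : ℝ) / 2) * (2 * (2 * τ₀))⁻¹)⁻¹) with hC
  have hC0 : 0 ≤ C := by positivity
  have hbd : ∀ τ ∈ Set.Icc (τ₀ / 2) (2 * τ₀), ∀ z, ‖gradHeat d τ z‖ₑ ≤ ENNReal.ofReal C * ‖gradHeat d (2 * τ₀) z‖ₑ := by
    intro τ hτ z
    rw [← ofReal_norm_eq_enorm, ← ofReal_norm_eq_enorm, ← ENNReal.ofReal_mul hC0]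
    exact ENNReal.ofReal_le_ofReal (gradHeat_dom d (by positivity) hτ.1 hτ.2 z)
  have hev : ∀ᶠ τ in 𝓝 τ₀, τ ∈ Set.Icc (τ₀ / 2) (2 * τ₀) := Icc_mem_nhds (by linarith) (by linarith)
  have hL : ∫⁻ z, ‖gradHeat d (2 * τ₀) z‖ₑ ≠ ⊤ := by
    rw [gradHeat_L1 d (by positivity)]
    exact ENNReal.mul_ne_top ENNReal.ofReal_ne_top (gradHeat_L1_finite d)
  have key := tendsto_lintegral_filter_of_dominated_convergence (μ := (volume : Measure (Euc d))) (l := 𝓝 τ₀)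
    (F := fun τ z => ‖gradHeat d τ z - gradHeat d τ₀ z‖ₑ) (f := fun _ => 0)
    (fun z => ENNReal.ofReal C * ‖gradHeat d (2 * τ₀) z‖ₑ + ENNReal.ofReal C * ‖gradHeat d (2 * τ₀) z‖ₑ) ?_ ?_ ?_ ?_
  · simpa using key
  · exact Eventually.of_forall fun τ => ((measurable_gradHeat' d τ).sub (measurable_gradHeat' d τ₀)).enorm
  · filter_upwards [hev] with τ hτ
    refine Eventually.of_forall fun z => enorm_sub_le.trans ?_
    exact add_le_add (hbd τ hτ z) (hbd τ₀ ⟨by linarith, by linarith⟩ z)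
  · have hm := (measurable_gradHeat' d (2 * τ₀)).enorm
    rw [lintegral_add_left (hm.const_mul _), lintegral_const_mul _ hm]
    finiteness
  · refine Eventually.of_forall fun z => ?_
    have hc : ContinuousAt (fun τ => gradHeat d τ z) τ₀ := by
      simp_rw [gradHeat_eq]
      unfold heatKernel
      have hne : 4 * Real.pi * τ₀ ≠ 0 := by positivity
      have hne2 : 4 * τ₀ ≠ 0 := by positivity
      have hne3 : 2 * τ₀ ≠ 0 := by positivity
      have c1 : ContinuousAt (fun τ : ℝ => (4 * Real.pi * τ) ^ (-(d : ℝ) / 2)) τ₀ :=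
        ContinuousAt.rpow_const (by fun_prop) (Or.inl hne)
      have c2 : ContinuousAt (fun τ : ℝ => Real.exp (-‖z‖ ^ 2 / (4 * τ))) τ₀ :=
        (continuousAt_const.div (by fun_prop) hne2).rexp
      have c3 : ContinuousAt (fun τ : ℝ => (2 * τ)⁻¹) τ₀ := ContinuousAt.inv₀ (by fun_prop) hne3
      exact (((c1.mul c2).mul c3).neg).smul continuousAt_const
    have h2 : Tendsto (fun τ => ‖gradHeat d τ z - gradHeat d τ₀ z‖ₑ) (𝓝 τ₀) (𝓝 ‖gradHeat d τ₀ z - gradHeat d τ₀ z‖ₑ) :=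
      (hc.sub continuousAt_const).enorm
    simpa using h2

lemma KK_L1_le (d : ℕ) (t s : ℝ) : ∫⁻ z, ‖KK d t s z‖ₑ ≤
    (Set.Iic t).indicator (fun s => (∫⁻ z, ‖gradHeat d 1 z‖ₑ) * ENNReal.ofReal ((t - s) ^ (-(1/2:ℝ)))) s := by
  by_cases h : s ∈ Set.Ioc (0:ℝ) t
  · have h' : s ∈ Set.Iic t := h.2
    simp only [KK, h, if_true, Set.indicator, h']
    rcases h.2.lt_or_eq with h2 | h2
    · rw [gradHeat_L1 d (sub_pos.2 h2), mul_comm]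
    · simp [h2, gradHeat_eq]
  · simp [KK, h]

/-- L1 continuity of the Duhamel term -/
lemma duh_cont (d : ℕ) {T : ℝ} {F : ℝ → Euc d → Euc d} (hF : Measurable (Function.uncurry F)) {M : ℝ≥0∞} (hMt : M ≠ ⊤)
    (hM : ∀ s ∈ Set.Ioc (0:ℝ) T, ∫⁻ y, ‖F s y‖ₑ ≤ M * ENNReal.ofReal (s ^ (-(1/2:ℝ)))) {t₀ : ℝ} (ht₀ : t₀ ∈ Set.Ioc (0:ℝ) T) :
    Tendsto (fun t => ∫⁻ x, JJ (fun s z => KK d t s z - KK d t₀ s z) F x) (𝓝[Set.Ioc (0:ℝ) T] t₀) (𝓝 0) := by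
  set C1 := ∫⁻ z, ‖gradHeat d 1 z‖ₑ with hC1
  have hC1t : C1 ≠ ⊤ := gradHeat_L1_finite d
  have hKm : ∀ t, Measurable (Function.uncurry fun s z => KK d t s z - KK d t₀ s z) :=
    fun t => (measurable_KK' d t).sub (measurable_KK' d t₀)
  have ht0 : 0 < t₀ := ht₀.1
  rw [ENNReal.tendsto_nhds_zero]
  intro ε hε
  have hε2 : 0 < ε / 2 := ENNReal.half_pos hε.ne'
  -- the tail function
  set tail : ℝ → ℝ≥0∞ := fun δ => M * ENNReal.ofReal ((t₀/2) ^ (-(1/2:ℝ))) *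
    (C1 * ENNReal.ofReal ((2 * δ) ^ (1 - 1/2 : ℝ) / (1 - 1/2)) + C1 * ENNReal.ofReal ((2 * δ) ^ (1 - 1/2 : ℝ) / (1 - 1/2))) with htail
  have htl : Tendsto tail (𝓝[>] 0) (𝓝 0) := by
    have h1 : Tendsto (fun δ : ℝ => ENNReal.ofReal ((2 * δ) ^ (1 - 1/2 : ℝ) / (1 - 1/2))) (𝓝[>] 0) (𝓝 0) := by
      have hc : Continuous fun δ : ℝ => ENNReal.ofReal ((2 * δ) ^ (1 - 1/2 : ℝ) / (1 - 1/2)) := by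
        apply ENNReal.continuous_ofReal.comp
        apply Continuous.div_const
        exact (Real.continuous_rpow_const (by norm_num)).comp (by fun_prop)
      have := hc.tendsto 0
      simp only [mul_zero] at this
      rw [Real.zero_rpow (by norm_num)] at this
      simp only [zero_div, ENNReal.ofReal_zero] at this
      exact this.mono_left nhdsWithin_le_nhds
    have h2 := ENNReal.Tendsto.const_mul (a := C1) h1 (Or.inr hC1t)
    have h3 := ENNReal.Tendsto.const_mul (a := M * ENNReal.ofReal ((t₀/2) ^ (-(1/2:ℝ)))) (h2.add h2)
      (Or.inr (by finiteness))
    simp only [mul_zero, add_zero] at h3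
    exact h3
  have hδex : ∀ᶠ δ in 𝓝[>] (0:ℝ), tail δ ≤ ε / 2 ∧ δ < t₀ / 2 ∧ 0 < δ := by
    filter_upwards [ENNReal.tendsto_nhds_zero.1 htl _ hε2, self_mem_nhdsWithin,
      nhdsWithin_le_nhds (Iio_mem_nhds (half_pos ht0))] with δ h1 h2 h3
    exact ⟨h1, h3, h2⟩
  obtain ⟨δ, hδ1, hδ2, hδ0⟩ := hδex.exists
  -- head
  have hhead : Tendsto (fun t => ∫⁻ s in Set.Ioc 0 (t₀ - δ), (∫⁻ z, ‖KK d t s z - KK d t₀ s z‖ₑ) * (M * ENNReal.ofReal (s ^ (-(1/2:ℝ)))))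
      (𝓝 t₀) (𝓝 0) := by
    have hev : ∀ᶠ t in 𝓝 t₀, t₀ - δ / 2 < t := Ioi_mem_nhds (by linarith)
    have hb : ∀ t, t₀ - δ / 2 < t → ∀ s ∈ Set.Ioc 0 (t₀ - δ), ∫⁻ z, ‖KK d t s z‖ₑ ≤ C1 * ENNReal.ofReal ((δ/2) ^ (-(1/2:ℝ))) := by
      intro t ht s hs
      refine (KK_L1_le d t s).trans ?_
      have hs2 := hs.2
      have h' : s ∈ Set.Iic t := by simp only [Set.mem_Iic]; linarith
      simp only [Set.indicator, h', if_true]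
      gcongr C1 * ENNReal.ofReal ?_
      exact Real.rpow_le_rpow_of_nonpos (by linarith) (by linarith) (by norm_num)
    have key := tendsto_lintegral_filter_of_dominated_convergence (μ := (volume : Measure ℝ).restrict (Set.Ioc 0 (t₀ - δ))) (l := 𝓝 t₀)
      (F := fun t s => (∫⁻ z, ‖KK d t s z - KK d t₀ s z‖ₑ) * (M * ENNReal.ofReal (s ^ (-(1/2:ℝ))))) (f := fun _ => 0)
      (fun s => (C1 * ENNReal.ofReal ((δ/2) ^ (-(1/2:ℝ))) + C1 * ENNReal.ofReal ((δ/2) ^ (-(1/2:ℝ)))) * M * ENNReal.ofReal (s ^ (-(1/2:ℝ))))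
      ?_ ?_ ?_ ?_
    · simpa using key
    · refine Eventually.of_forall fun t => ?_
      have h1 : Measurable fun s => ∫⁻ z, ‖KK d t s z - KK d t₀ s z‖ₑ := (hKm t).enorm.lintegral_prod_right'
      exact h1.mul (by fun_prop)
    · filter_upwards [hev] with t ht
      filter_upwards [ae_restrict_mem measurableSet_Ioc] with s hs
      rw [← mul_assoc]
      gcongr ?_ * _ * _
      refine (lintegral_mono fun z => enorm_sub_le).trans ?_
      rw [lintegral_add_left (slice_meas (measurable_KK' d t) s).enorm]
      exact add_le_add (hb t ht s hs) (hb t₀ (by linarith) s hs)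
    · rw [lintegral_const_mul _ (by fun_prop), lint_rpow (by norm_num) (by linarith)]
      finiteness
    · filter_upwards [ae_restrict_mem measurableSet_Ioc] with s hs
      have hs2 := hs.2
      have h1 : Tendsto (fun t => ∫⁻ z, ‖gradHeat d (t - s) z - gradHeat d (t₀ - s) z‖ₑ) (𝓝 t₀) (𝓝 0) :=
        (gradHeat_L1_cont d (τ₀ := t₀ - s) (by linarith)).comp
          ((continuous_id.sub continuous_const).tendsto t₀)
      have h2 : Tendsto (fun t => ∫⁻ z, ‖KK d t s z - KK d t₀ s z‖ₑ) (𝓝 t₀) (𝓝 0) := by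
        refine h1.congr' ?_
        filter_upwards [hev] with t ht
        have i1 : s ∈ Set.Ioc 0 t := ⟨hs.1, by linarith⟩
        have i2 : s ∈ Set.Ioc 0 t₀ := ⟨hs.1, by linarith⟩
        simp only [KK, i1, i2, if_true]
      have h3 := ENNReal.Tendsto.mul_const (b := M * ENNReal.ofReal (s ^ (-(1/2:ℝ)))) h2 (Or.inr (by finiteness))
      simpa using h3
  have hev1 := nhdsWithin_le_nhds (s := Set.Ioc (0:ℝ) T) (ENNReal.tendsto_nhds_zero.1 hhead _ hε2)
  have hev2 : ∀ᶠ t in 𝓝[Set.Ioc (0:ℝ) T] t₀, t ∈ Set.Ioo (t₀ - δ) (t₀ + δ) :=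
    nhdsWithin_le_nhds (Ioo_mem_nhds (by linarith) (by linarith))
  filter_upwards [hev1, hev2, self_mem_nhdsWithin] with t hh ht htT
  rw [JJ_L1 (hKm t) hF]
  have hN : ∀ r : ℝ, r ∈ Set.Ioo (t₀ - δ) (t₀ + δ) →
      ∫⁻ s in Set.Ioc (t₀ - δ) T, (∫⁻ z, ‖KK d r s z‖ₑ) ≤ C1 * ENNReal.ofReal ((2 * δ) ^ (1 - 1/2 : ℝ) / (1 - 1/2)) := by
    intro r hr
    calc _ ≤ ∫⁻ s in Set.Ioc (t₀ - δ) T, (Set.Iic r).indicator (fun s => C1 * ENNReal.ofReal ((r - s) ^ (-(1/2:ℝ)))) s :=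
          lintegral_mono fun s => KK_L1_le d r s
      _ ≤ ∫⁻ s in Set.Ioc (t₀ - δ) r, C1 * ENNReal.ofReal ((r - s) ^ (-(1/2:ℝ))) := by
          rw [← lintegral_indicator measurableSet_Ioc, ← lintegral_indicator measurableSet_Ioc]
          refine lintegral_mono fun s => ?_
          simp only [Set.indicator, Set.mem_Ioc, Set.mem_Iic]
          split_ifs with h1 h2 h3 h3
          · exact le_rfl
          · exact absurd ⟨h1.1, h2⟩ h3
          all_goals exact zero_le
      _ = C1 * ENNReal.ofReal ((r - (t₀ - δ)) ^ (1 - 1/2 : ℝ) / (1 - 1/2)) := by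
          rw [lintegral_const_mul _ (by fun_prop), lint_rpow_sub (by norm_num) hr.1]
      _ ≤ _ := by
          have h1 := hr.1
          have h2 := hr.2
          have h3 : (0:ℝ) ≤ r - (t₀ - δ) := by linarith
          have h4 : r - (t₀ - δ) ≤ 2 * δ := by linarith
          have h5 : (0:ℝ) ≤ 1 - 1/2 := by norm_num
          have h6 : (0:ℝ) ≤ 1 - 1/2 := h5
          exact mul_le_mul' le_rfl (ENNReal.ofReal_le_ofReal (div_le_div_of_nonneg_right (Real.rpow_le_rpow h3 h4 h5) h6))
  have hkm : Measurable fun s => ∫⁻ z, ‖KK d t s z‖ₑ := (measurable_KK' d t).enorm.lintegral_prod_right'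
  have htailb : ∫⁻ s in Set.Ioc (t₀ - δ) T, (∫⁻ z, ‖KK d t s z - KK d t₀ s z‖ₑ) * (M * ENNReal.ofReal (s ^ (-(1/2:ℝ)))) ≤ tail δ := by
    calc _ ≤ ∫⁻ s in Set.Ioc (t₀ - δ) T, (M * ENNReal.ofReal ((t₀/2) ^ (-(1/2:ℝ)))) * ((∫⁻ z, ‖KK d t s z‖ₑ) + ∫⁻ z, ‖KK d t₀ s z‖ₑ) := by
          refine lintegral_mono_ae ?_
          filter_upwards [ae_restrict_mem measurableSet_Ioc] with s hs
          have hs1 := hs.1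
          rw [mul_comm]
          gcongr M * ENNReal.ofReal ?_ * ?_
          · exact Real.rpow_le_rpow_of_nonpos (by linarith) (by linarith) (by norm_num)
          · refine (lintegral_mono fun z => enorm_sub_le).trans ?_
            rw [lintegral_add_left (slice_meas (measurable_KK' d t) s).enorm]
      _ ≤ _ := by
          rw [lintegral_const_mul' _ _ (by finiteness), lintegral_add_left hkm, htail]
          exact mul_le_mul' le_rfl (add_le_add (hN t ht) (hN t₀ ⟨by linarith, by linarith⟩))
  calc _ = ∫⁻ s in Set.Ioc 0 T, (∫⁻ z, ‖KK d t s z - KK d t₀ s z‖ₑ) * ∫⁻ y, ‖F s y‖ₑ := by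
        rw [← lintegral_indicator measurableSet_Ioc]
        refine lintegral_congr fun s => ?_
        unfold Set.indicator
        split_ifs with h
        · rfl
        · have i1 : s ∉ Set.Ioc 0 t := fun hh => h ⟨hh.1, hh.2.trans htT.2⟩
          have i2 : s ∉ Set.Ioc 0 t₀ := fun hh => h ⟨hh.1, hh.2.trans ht₀.2⟩
          simp [KK, i1, i2]
    _ ≤ ∫⁻ s in Set.Ioc 0 T, (∫⁻ z, ‖KK d t s z - KK d t₀ s z‖ₑ) * (M * ENNReal.ofReal (s ^ (-(1/2:ℝ)))) := by
        refine lintegral_mono_ae ?_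
        filter_upwards [ae_restrict_mem measurableSet_Ioc] with s hs
        gcongr
        exact hM s hs
    _ ≤ (∫⁻ s in Set.Ioc 0 (t₀ - δ), (∫⁻ z, ‖KK d t s z - KK d t₀ s z‖ₑ) * (M * ENNReal.ofReal (s ^ (-(1/2:ℝ))))) +
        ∫⁻ s in Set.Ioc (t₀ - δ) T, (∫⁻ z, ‖KK d t s z - KK d t₀ s z‖ₑ) * (M * ENNReal.ofReal (s ^ (-(1/2:ℝ)))) := by
        rw [← Set.Ioc_union_Ioc_eq_Ioc (a := (0:ℝ)) (b := t₀ - δ) (c := T) (by linarith) (by linarith [ht₀.2])]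
        exact lintegral_union_le _ _ _
    _ ≤ ε / 2 + ε / 2 := add_le_add hh (htailb.trans hδ1)
    _ = ε := ENNReal.add_halves ε

lemma trans_L1 {d : ℕ} {ρ : Euc d → ℝ} (h : MemLp ρ 1 volume) (z : Euc d) (r₀ : ℝ) :
    Tendsto (fun r : ℝ => ∫⁻ x, ‖ρ (x - r • z) - ρ (x - r₀ • z)‖ₑ) (𝓝 r₀) (𝓝 0) := by
  let g : C(ℝ, C(Euc d, Euc d)) :=
    (ContinuousMap.mk (fun a : ℝ × Euc d => a.2 - a.1 • z) (by fun_prop)).curry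
  have hg : ∀ r, MeasurePreserving (g r) (volume : Measure (Euc d)) volume := fun r =>
    measurePreserving_sub_right volume (r • z)
  have hc : Continuous fun r => Lp.compMeasurePreserving (g r) (hg r) (h.toLp ρ) :=
    continuous_const.compMeasurePreservingLp g.continuous hg ENNReal.one_ne_top
  have h1 := tendsto_iff_edist_tendsto_0.1 (hc.tendsto r₀)
  refine h1.congr fun r => ?_
  have e : ∀ r, Lp.compMeasurePreserving (g r) (hg r) (h.toLp ρ) =
      (h.comp_measurePreserving (hg r)).toLp _ := fun r => Lp.toLp_compMeasurePreserving h (hg r)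
  rw [e, e, Lp.edist_toLp_toLp, eLpNorm_one_eq_lintegral_enorm]
  rfl

lemma lint_trans {d : ℕ} (f : Euc d → ℝ≥0∞) (a : Euc d) : ∫⁻ x, f (x - a) = ∫⁻ x, f x :=
  lintegral_sub_right_eq_self f a

def SS (d : ℕ) (ρ : Euc d → ℝ) (r : ℝ) (x : Euc d) : ℝ := ∫ z, heatKernel d 1 z * ρ (x - r • z)

lemma SS_zero (d : ℕ) (ρ : Euc d → ℝ) (x : Euc d) : SS d ρ 0 x = ρ x := by
  simp [SS, integral_mul_const, heat_one_integral]

lemma conv_SS (d : ℕ) (ρ : Euc d → ℝ) {t : ℝ} (ht : 0 < t) (x : Euc d) :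
    conv (heatKernel d t) ρ x = SS d ρ (√t) x := by
  have hs : 0 < √t := Real.sqrt_pos.2 ht
  have h1 : conv (heatKernel d t) ρ x = ∫ w, heatKernel d t w * ρ (x - w) := by
    unfold conv
    rw [← integral_sub_left_eq_self (fun w => heatKernel d t w * ρ (x - w)) volume x]
    simp
  have h2 := Measure.integral_comp_smul (volume : Measure (Euc d)) (fun w => heatKernel d t w * ρ (x - w)) (√t)
  have h3 : SS d ρ (√t) x = (t ^ ((d:ℝ)/2)) * ∫ z, heatKernel d t (√t • z) * ρ (x - √t • z) := by
    unfold SS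
    rw [← integral_const_mul]
    refine integral_congr_ae (Eventually.of_forall fun z => ?_)
    simp only
    rw [heat_scale d ht, ← mul_assoc, ← mul_assoc, ← Real.rpow_add ht]
    have : (d:ℝ)/2 + -(d:ℝ)/2 = 0 := by ring
    rw [this]; simp
  rw [h1, h3, h2]
  simp only [finrank_euclideanSpace, Fintype.card_fin, smul_eq_mul]
  have h4 : (√t)^d = t ^ ((d:ℝ)/2) := by
    rw [Real.sqrt_eq_rpow, ← Real.rpow_natCast, ← Real.rpow_mul ht.le]; congr 1; ring
  have h5 : 0 < t ^ ((d:ℝ)/2) := by positivity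
  rw [h4, abs_of_pos (by positivity), ← mul_assoc, mul_inv_cancel₀ h5.ne', one_mul]

lemma SS_lint (d : ℕ) {ρ : Euc d → ℝ} (hm : Measurable ρ) (r : ℝ) :
    ∫⁻ x, ∫⁻ z, ‖heatKernel d 1 z * ρ (x - r • z)‖ₑ = ∫⁻ x, ‖ρ x‖ₑ := by
  have hH := measurable_heat' d 1
  rw [lintegral_lintegral_swap]
  · have : ∀ z, ∫⁻ x, ‖heatKernel d 1 z * ρ (x - r • z)‖ₑ = ENNReal.ofReal (heatKernel d 1 z) * ∫⁻ x, ‖ρ x‖ₑ := by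
      intro z
      simp only [enorm_mul]
      rw [lintegral_const_mul _ (by fun_prop), lint_trans (fun x => ‖ρ x‖ₑ),
        Real.enorm_eq_ofReal (heat_pos d one_pos z).le]
    simp only [this]
    rw [lintegral_mul_const _ (by fun_prop), heat_one_lintegral, one_mul]
  · exact Measurable.aemeasurable (by fun_prop)

lemma SS_integrable (d : ℕ) {ρ : Euc d → ℝ} (hm : Measurable ρ) (h : ∫⁻ x, ‖ρ x‖ₑ ≠ ⊤) (r : ℝ) :
    ∀ᵐ x : Euc d, Integrable fun z => heatKernel d 1 z * ρ (x - r • z) := by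
  have hH := measurable_heat' d 1
  have h1 : ∀ᵐ x : Euc d, ∫⁻ z, ‖heatKernel d 1 z * ρ (x - r • z)‖ₑ < ⊤ := by
    apply ae_lt_top
    · have : Measurable fun q : Euc d × Euc d => ‖heatKernel d 1 q.2 * ρ (q.1 - r • q.2)‖ₑ := by fun_prop
      exact this.lintegral_prod_right'
    · rw [SS_lint d hm]; exact h
  filter_upwards [h1] with x hx
  exact ⟨Measurable.aestronglyMeasurable (by fun_prop), hx⟩

lemma SS_L1 (d : ℕ) {ρ : Euc d → ℝ} (hm : Measurable ρ) (r : ℝ) : eLpNorm (SS d ρ r) 1 volume ≤ ∫⁻ x, ‖ρ x‖ₑ := by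
  rw [eLpNorm_one_eq_lintegral_enorm, ← SS_lint d hm r]
  exact lintegral_mono fun x => enorm_integral_le_lintegral_enorm _

lemma SS_cont (d : ℕ) {ρ : Euc d → ℝ} (hm : Measurable ρ) (h : ∫⁻ x, ‖ρ x‖ₑ ≠ ⊤) (r₀ : ℝ) :
    Tendsto (fun r => eLpNorm (fun x => SS d ρ r x - SS d ρ r₀ x) 1 volume) (𝓝 r₀) (𝓝 0) := by
  have hH := measurable_heat' d 1
  have hL : MemLp ρ 1 volume := ⟨hm.aestronglyMeasurable, by
    rw [eLpNorm_one_eq_lintegral_enorm]; exact h.lt_top⟩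
  have hle : ∀ r, eLpNorm (fun x => SS d ρ r x - SS d ρ r₀ x) 1 volume ≤
      ∫⁻ z, ‖heatKernel d 1 z‖ₑ * ∫⁻ x, ‖ρ (x - r • z) - ρ (x - r₀ • z)‖ₑ := by
    intro r
    rw [eLpNorm_one_eq_lintegral_enorm]
    calc _ ≤ ∫⁻ x, ∫⁻ z, ‖heatKernel d 1 z‖ₑ * ‖ρ (x - r • z) - ρ (x - r₀ • z)‖ₑ := by
          refine lintegral_mono_ae ?_
          filter_upwards [SS_integrable d hm h r, SS_integrable d hm h r₀] with x h1 h2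
          unfold SS
          rw [← integral_sub h1 h2]
          refine (enorm_integral_le_lintegral_enorm _).trans (le_of_eq ?_)
          refine lintegral_congr fun z => ?_
          rw [← mul_sub, enorm_mul]
      _ = _ := by
          rw [lintegral_lintegral_swap (Measurable.aemeasurable (by fun_prop))]
          refine lintegral_congr fun z => ?_
          rw [lintegral_const_mul _ (by fun_prop)]
  refine tendsto_of_tendsto_of_tendsto_of_le_of_le tendsto_const_nhds ?_ (fun _ => zero_le) hle
  have key := tendsto_lintegral_filter_of_dominated_convergence (μ := (volume : Measure (Euc d))) (l := 𝓝 r₀)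
    (F := fun r z => ‖heatKernel d 1 z‖ₑ * ∫⁻ x, ‖ρ (x - r • z) - ρ (x - r₀ • z)‖ₑ) (f := fun _ => 0)
    (fun z => ‖heatKernel d 1 z‖ₑ * ((∫⁻ x, ‖ρ x‖ₑ) + ∫⁻ x, ‖ρ x‖ₑ)) ?_ ?_ ?_ ?_
  · simpa using key
  · refine Eventually.of_forall fun r => ?_
    have : Measurable fun q : Euc d × Euc d => ‖ρ (q.2 - r • q.1) - ρ (q.2 - r₀ • q.1)‖ₑ := by fun_prop
    exact hH.enorm.mul this.lintegral_prod_right'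
  · refine Eventually.of_forall fun r => Eventually.of_forall fun z => ?_
    refine mul_le_mul' le_rfl ?_
    refine (lintegral_mono fun x => enorm_sub_le).trans ?_
    rw [lintegral_add_left (by fun_prop), lint_trans (fun x => ‖ρ x‖ₑ), lint_trans (fun x => ‖ρ x‖ₑ)]
  · rw [lintegral_mul_const _ hH.enorm]
    have e : ∫⁻ z, ‖heatKernel d 1 z‖ₑ = 1 := by
      rw [← heat_one_lintegral d]
      exact lintegral_congr fun z => Real.enorm_eq_ofReal (heat_pos d one_pos z).le
    rw [e]; finiteness
  · refine Eventually.of_forall fun z => ?_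
    have := ENNReal.Tendsto.const_mul (a := ‖heatKernel d 1 z‖ₑ) (trans_L1 hL z r₀) (Or.inr (by finiteness))
    simpa using this

lemma conv_cont (d : ℕ) {ρ : Euc d → ℝ} (hm : Measurable ρ) (h : ∫⁻ x, ‖ρ x‖ₑ ≠ ⊤) {t₀ : ℝ} (ht₀ : 0 < t₀) :
    Tendsto (fun t => eLpNorm (fun x => conv (heatKernel d t) ρ x - conv (heatKernel d t₀) ρ x) 1 volume) (𝓝 t₀) (𝓝 0) := by
  have h1 := (SS_cont d hm h (√t₀)).comp (Real.continuous_sqrt.tendsto t₀)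
  refine h1.congr' ?_
  filter_upwards [Ioi_mem_nhds ht₀] with t ht
  simp only [Function.comp, conv_SS d ρ ht, conv_SS d ρ ht₀]

lemma conv_cont0 (d : ℕ) {ρ : Euc d → ℝ} (hm : Measurable ρ) (h : ∫⁻ x, ‖ρ x‖ₑ ≠ ⊤) :
    Tendsto (fun t => eLpNorm (fun x => conv (heatKernel d t) ρ x - ρ x) 1 volume) (𝓝[>] 0) (𝓝 0) := by
  have h0 := (SS_cont d hm h (√0)).comp (Real.continuous_sqrt.tendsto 0)
  have h1 := h0.mono_left (nhdsWithin_le_nhds (s := Set.Ioi 0))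
  refine h1.congr' ?_
  filter_upwards [self_mem_nhdsWithin] with t ht
  simp only [Function.comp, conv_SS d ρ ht, Real.sqrt_zero, SS_zero]

lemma conv_L1 (d : ℕ) {ρ : Euc d → ℝ} (hm : Measurable ρ) {t : ℝ} (ht : 0 < t) :
    eLpNorm (conv (heatKernel d t) ρ) 1 volume ≤ ∫⁻ x, ‖ρ x‖ₑ := by
  have : conv (heatKernel d t) ρ = SS d ρ (√t) := funext fun x => conv_SS d ρ ht x
  rw [this]; exact SS_L1 d hm _

lemma young {d : ℕ} {p : ℝ} (hp : 1 < p) {g b : Euc d → ℝ≥0∞} (hg : Measurable g) (hb : Measurable b)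
    {W : ℝ≥0∞} (hW0 : W ≠ 0) (hW : W ≠ ⊤) (h : ∫⁻ x, b x ^ p ≤ W ^ p) :
    ∫⁻ x, (∫⁻ y, g y * b (x - y)) ^ p ≤ (W * ∫⁻ y, g y) ^ p := by
  have hk : Measurable (Function.uncurry fun y x : Euc d => b (x - y)) := by
    have : Measurable fun q : Euc d × Euc d => q.2 - q.1 := by fun_prop
    exact hb.comp this
  have h1 := mink (volume.withDensity g) (volume : Measure (Euc d)) hp (fun y x => b (x - y)) hk (fun _ => W) measurable_const
    (Eventually.of_forall fun y => ⟨hW0, hW, by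
      rw [lint_trans (fun x => b x ^ p)]; exact h⟩)
  have e1 : ∀ x, ∫⁻ y, b (x - y) ∂(volume.withDensity g) = ∫⁻ y, g y * b (x - y) := fun x => by
    have hm : Measurable fun y => b (x - y) := hb.comp (by fun_prop)
    rw [lintegral_withDensity_eq_lintegral_mul _ hg hm]; rfl
  have e2 : ∫⁻ y, W ∂(volume.withDensity g) = W * ∫⁻ y, g y := by
    rw [lintegral_const, withDensity_apply _ MeasurableSet.univ, Measure.restrict_univ]
  simp only [e1, e2] at h1
  exact h1

lemma heat_t_lint (d : ℕ) {t : ℝ} (ht : 0 < t) : ∫⁻ z, ‖heatKernel d t z‖ₑ = 1 := by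
  have h1 := heat_lintegral_scale d (le_refl (1:ℝ)) ht
  have e : ∫⁻ z, ‖heatKernel d 1 z‖ₑ = 1 := by
    rw [← heat_one_lintegral d]
    exact lintegral_congr fun z => Real.enorm_eq_ofReal (heat_pos d one_pos z).le
  simp only [ENNReal.rpow_one, one_mul, sub_self, Real.rpow_zero, ENNReal.ofReal_one] at h1
  rw [h1, e]

lemma cut_lim {d : ℕ} {ρ : Euc d → ℝ} (hm : Measurable ρ) (h : ∫⁻ x, ‖ρ x‖ₑ ≠ ⊤) :
    Tendsto (fun n : ℕ => ∫⁻ x, {x | (n : ℝ≥0∞) < ‖ρ x‖ₑ}.indicator (fun x => ‖ρ x‖ₑ) x) atTop (𝓝 0) := by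
  have key := tendsto_lintegral_of_dominated_convergence (μ := (volume : Measure (Euc d)))
    (F := fun (n : ℕ) x => {x | (n : ℝ≥0∞) < ‖ρ x‖ₑ}.indicator (fun x => ‖ρ x‖ₑ) x) (f := fun _ => 0)
    (fun x => ‖ρ x‖ₑ) (fun n => hm.enorm.indicator (measurableSet_lt measurable_const hm.enorm))
    (fun n => Eventually.of_forall fun x => Set.indicator_le_self _ _ _) h ?_
  · simpa using key
  · refine Eventually.of_forall fun x => ?_
    obtain ⟨N, hN⟩ := ENNReal.exists_nat_gt (r := ‖ρ x‖ₑ) (by finiteness)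
    refine tendsto_const_nhds.congr' ?_
    filter_upwards [eventually_ge_atTop N] with n hn
    have : ¬ ((n : ℝ≥0∞) < ‖ρ x‖ₑ) := by
      push Not
      exact hN.le.trans (by exact_mod_cast hn)
    simp [Set.indicator, this]

lemma conv_small {d : ℕ} (hd : 1 ≤ d) {ρ : Euc d → ℝ} (hm : Measurable ρ) (h : ∫⁻ x, ‖ρ x‖ₑ ≠ ⊤) {ε : ℝ≥0∞} (hε : 0 < ε) :
    ∃ t₁ : ℝ, 0 < t₁ ∧ WB d t₁ (fun t => conv (heatKernel d t) ρ) ε := by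
  have hp := pR_gt hd
  have hp0 : 0 < pR d := by linarith
  have hε2 : 0 < ε / 2 := ENNReal.half_pos hε.ne'
  set Ch := (∫⁻ z, ‖heatKernel d 1 z‖ₑ ^ pR d) ^ (1 / pR d) with hCh
  have hCht : Ch ≠ ⊤ := ENNReal.rpow_ne_top_of_nonneg (by positivity) (heat_pow_finite d hp.le)
  have h1 := ENNReal.Tendsto.const_mul (a := Ch + 1) (cut_lim hm h) (Or.inr (by finiteness))
  rw [mul_zero] at h1
  obtain ⟨n, hn⟩ := (ENNReal.tendsto_nhds_zero.1 h1 _ hε2).exists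
  set a : Euc d → ℝ≥0∞ := {x | (n : ℝ≥0∞) < ‖ρ x‖ₑ}.indicator (fun x => ‖ρ x‖ₑ) with ha
  set b : Euc d → ℝ≥0∞ := {x | (n : ℝ≥0∞) < ‖ρ x‖ₑ}ᶜ.indicator (fun x => ‖ρ x‖ₑ) with hb
  have hS : MeasurableSet {x | (n : ℝ≥0∞) < ‖ρ x‖ₑ} := measurableSet_lt measurable_const hm.enorm
  have ham : Measurable a := hm.enorm.indicator hS
  have hbm : Measurable b := hm.enorm.indicator hS.compl
  have hab : ∀ x, ‖ρ x‖ₑ = a x + b x := fun x => by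
    rw [ha, hb, ← Pi.add_apply, Set.indicator_self_add_compl]
  have hbn : ∀ x, b x ≤ n := fun x => by
    rw [hb]
    by_cases hx : (n : ℝ≥0∞) < ‖ρ x‖ₑ
    · simp [Set.indicator, hx]
    · simp only [Set.indicator, Set.mem_compl_iff, Set.mem_ofPred_eq, hx, not_false_eq_true, if_true]
      exact not_lt.1 hx
  have hbp : ∫⁻ x, b x ^ pR d ≠ ⊤ := by
    have h2 : ∫⁻ x, b x ^ pR d ≤ (n:ℝ≥0∞) ^ (pR d - 1) * ∫⁻ x, ‖ρ x‖ₑ := by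
      rw [← lintegral_const_mul _ hm.enorm]
      refine lintegral_mono fun x => ?_
      calc b x ^ pR d = b x ^ ((pR d - 1) + 1) := by congr 1; ring
        _ = b x ^ (pR d - 1) * b x := by
          rw [ENNReal.rpow_add_of_nonneg _ _ (by linarith) (by norm_num), ENNReal.rpow_one]
        _ ≤ _ := mul_le_mul' (ENNReal.rpow_le_rpow (hbn x) (by linarith)) (by rw [hab x]; exact le_add_self)
    have h3 : (n:ℝ≥0∞) ^ (pR d - 1) ≠ ⊤ := ENNReal.rpow_ne_top_of_nonneg (by linarith) (ENNReal.natCast_ne_top n)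
    exact ne_top_of_le_ne_top (ENNReal.mul_ne_top h3 h) h2
  set w := (∫⁻ x, b x ^ pR d) ^ (1 / pR d) + 1 with hw
  have hwt : w ≠ ⊤ := ENNReal.add_ne_top.2 ⟨ENNReal.rpow_ne_top_of_nonneg (by positivity) hbp, by simp⟩
  have hw0 : w ≠ 0 := by simp [hw]
  have hinv : ∀ X : ℝ≥0∞, (X ^ (1 / pR d)) ^ pR d = X := fun X => by
    rw [← ENNReal.rpow_mul, one_div, inv_mul_cancel₀ hp0.ne', ENNReal.rpow_one]
  have hinv' : ∀ X : ℝ≥0∞, (X ^ pR d) ^ (1 / pR d) = X := fun X => by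
    rw [← ENNReal.rpow_mul, one_div, mul_inv_cancel₀ hp0.ne', ENNReal.rpow_one]
  have hwp : ∫⁻ x, b x ^ pR d ≤ w ^ pR d := by
    calc _ = ((∫⁻ x, b x ^ pR d) ^ (1 / pR d)) ^ pR d := (hinv _).symm
      _ ≤ _ := ENNReal.rpow_le_rpow le_self_add hp0.le
  -- main estimate
  have main : ∀ t : ℝ, 0 < t → eLpNorm (conv (heatKernel d t) ρ) (qd d) volume ≤
      ENNReal.ofReal (t ^ (-(1/4:ℝ))) * (Ch + 1) * (∫⁻ y, a y) + w := by
    intro t ht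
    have hH := (measurable_heat' d t).enorm
    rw [eLpNorm_qd hd]
    have hHs : Measurable fun q : Euc d × Euc d => ‖heatKernel d t (q.1 - q.2)‖ₑ := hH.comp (by fun_prop)
    have hA : Measurable fun x => ∫⁻ y, a y * ‖heatKernel d t (x - y)‖ₑ :=
      ((ham.comp measurable_snd).mul hHs).lintegral_prod_right'
    have hB : Measurable fun x => ∫⁻ y, ‖heatKernel d t y‖ₑ * b (x - y) := by
      have : Measurable fun q : Euc d × Euc d => b (q.1 - q.2) := hbm.comp (by fun_prop)
      exact ((hH.comp measurable_snd).mul this).lintegral_prod_right'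
    have hpt : ∀ x, ‖conv (heatKernel d t) ρ x‖ₑ ≤ (∫⁻ y, a y * ‖heatKernel d t (x - y)‖ₑ) + ∫⁻ y, ‖heatKernel d t y‖ₑ * b (x - y) := by
      intro x
      have hHx : Measurable fun y => ‖heatKernel d t (x - y)‖ₑ := hH.comp (by fun_prop)
      refine (enorm_integral_le_lintegral_enorm _).trans (le_of_eq ?_)
      have e1 : ∫⁻ y, ‖heatKernel d t y‖ₑ * b (x - y) = ∫⁻ y, b y * ‖heatKernel d t (x - y)‖ₑ := by
        rw [← lintegral_sub_left_eq_self (fun y => ‖heatKernel d t y‖ₑ * b (x - y)) x]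
        refine lintegral_congr fun y => ?_
        rw [sub_sub_cancel, mul_comm]
      have hax : Measurable fun y => a y * ‖heatKernel d t (x - y)‖ₑ := ham.mul hHx
      rw [e1, ← lintegral_add_left hax]
      refine lintegral_congr fun y => ?_
      rw [enorm_mul, hab y, ← add_mul, mul_comm]
    calc _ ≤ (∫⁻ x, ((fun x => ∫⁻ y, a y * ‖heatKernel d t (x - y)‖ₑ) + fun x => ∫⁻ y, ‖heatKernel d t y‖ₑ * b (x - y)) x ^ pR d) ^ (1 / pR d) := by
          refine ENNReal.rpow_le_rpow (lintegral_mono fun x => ENNReal.rpow_le_rpow (hpt x) hp0.le) (by positivity)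
      _ ≤ _ := ENNReal.lintegral_Lp_add_le hA.aemeasurable hB.aemeasurable hp.le
      _ ≤ _ := by
          refine add_le_add ?_ ?_
          · have h5 := young (p := pR d) hp ham hH (W := ENNReal.ofReal (t ^ (-(1/4:ℝ))) * (Ch + 1))
              (mul_ne_zero (ofReal_rpow_ne ht) (by simp)) (by finiteness) (by
                rw [heat_Lp d hd ht]
                exact ENNReal.rpow_le_rpow (mul_le_mul' le_rfl le_self_add) hp0.le)
            calc _ ≤ _ := ENNReal.rpow_le_rpow h5 (by positivity)
              _ = _ := hinv' _
          · have h5 := young (p := pR d) hp hH hbm hw0 hwt hwp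
            rw [heat_t_lint d ht, mul_one] at h5
            calc _ ≤ _ := ENNReal.rpow_le_rpow h5 (by positivity)
              _ = _ := hinv' _
  -- choose t₁
  have h6 : Tendsto (fun t : ℝ => ENNReal.ofReal (t ^ (1/4:ℝ)) * w) (𝓝[>] 0) (𝓝 0) := by
    have hc : Continuous fun t : ℝ => ENNReal.ofReal (t ^ (1/4:ℝ)) :=
      ENNReal.continuous_ofReal.comp (Real.continuous_rpow_const (by norm_num))
    have h7 := hc.tendsto 0
    rw [Real.zero_rpow (by norm_num), ENNReal.ofReal_zero] at h7
    have h8 := ENNReal.Tendsto.mul_const (b := w) (h7.mono_left (nhdsWithin_le_nhds (s := Set.Ioi 0))) (Or.inr hwt)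
    rwa [zero_mul] at h8
  obtain ⟨t₁, ht₁, ht₁0⟩ := ((ENNReal.tendsto_nhds_zero.1 h6 _ hε2).and self_mem_nhdsWithin).exists
  refine ⟨t₁, ht₁0, fun t ht => ?_⟩
  have e : ENNReal.ofReal (t ^ (1/4 : ℝ)) * ENNReal.ofReal (t ^ (-(1/4 : ℝ))) = 1 := by
    rw [← ENNReal.ofReal_mul (Real.rpow_nonneg ht.1.le _), ← Real.rpow_add ht.1]; simp
  calc _ ≤ ENNReal.ofReal (t ^ (1/4 : ℝ)) * (ENNReal.ofReal (t ^ (-(1/4:ℝ))) * (Ch + 1) * (∫⁻ y, a y) + w) :=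
        mul_le_mul' le_rfl (main t ht.1)
    _ = (ENNReal.ofReal (t ^ (1/4 : ℝ)) * ENNReal.ofReal (t ^ (-(1/4 : ℝ)))) * ((Ch + 1) * ∫⁻ y, a y) +
        ENNReal.ofReal (t ^ (1/4 : ℝ)) * w := by ring
    _ ≤ ε / 2 + ε / 2 := by
        rw [e, one_mul]
        refine add_le_add hn (le_trans (mul_le_mul' (ENNReal.ofReal_le_ofReal ?_) le_rfl) ht₁)
        exact Real.rpow_le_rpow ht.1.le ht.2 (by norm_num)
    _ = ε := ENNReal.add_halves ε

lemma u_small {d : ℕ} (hd : 1 ≤ d) {E : ℝ≥0∞} (hE : CC d E) {ρ₀ : Euc d → ℝ} (hρ : Measurable ρ₀)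
    {T : ℝ} {Θ ε : ℝ≥0∞} (hΘ : Θ ≠ ⊤) (hs : E * (2 * Θ + 2 * Θ) ≤ 1 / 2) {u : ℝ → Euc d → ℝ}
    (hu : Measurable (Function.uncurry u)) (hub : WB d T u (2 * Θ))
    (hfu : ∀ t ∈ Set.Ioc (0:ℝ) T, u t =ᵐ[volume] mildRHS d ρ₀ u t)
    (h0 : WB d T (fun t => conv (heatKernel d t) ρ₀) ε) : WB d T u (2 * ε) := by
  have hz : Measurable (Function.uncurry fun (_ : ℝ) (_ : Euc d) => (0:ℝ)) := measurable_const
  have key : ∀ N : ℕ, WB d T u (2 * ε + 2⁻¹ ^ N * (2 * Θ)) := by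
    intro N
    induction N with
    | zero => exact hub.mono (by simp)
    | succ N ih =>
      have h1 := hE.wb ρ₀ hu hz (by finiteness) (by simp) hub (WB_zero d T) (δ := 2 * ε + 2⁻¹ ^ N * (2 * Θ)) (by simpa using ih)
      simp only [mild_zero] at h1
      have hcm : ∀ s ∈ Set.Ioc (0:ℝ) T, AEStronglyMeasurable (conv (heatKernel d s) ρ₀) volume := fun s _ =>
        ((measurable_conv d hρ).comp (measurable_const.prodMk measurable_id)).aestronglyMeasurable
      have h2 := WB.add hd (w := mildRHS d ρ₀ u) hcm
        (fun s hs => (slice_meas (measurable_mild d hρ hu) s).aestronglyMeasurable.sub (hcm s hs)) h0 h1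
        (fun s _ x => by simp)
      have h3 := h2.congr (v := u) (fun s hs => (hfu s hs).symm)
      refine h3.mono ?_
      calc ε + E * ((2 * Θ + 0) * (2 * ε + 2⁻¹ ^ N * (2 * Θ)))
          ≤ ε + E * ((2 * Θ + 2 * Θ) * (2 * ε + 2⁻¹ ^ N * (2 * Θ))) := by gcongr; exact zero_le
        _ = ε + (E * (2 * Θ + 2 * Θ)) * (2 * ε + 2⁻¹ ^ N * (2 * Θ)) := by ring
        _ ≤ ε + 1 / 2 * (2 * ε + 2⁻¹ ^ N * (2 * Θ)) := by gcongr
        _ = ε + (2⁻¹ * 2) * ε + 2⁻¹ ^ (N+1) * (2 * Θ) := by rw [one_div, pow_succ]; ring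
        _ = _ := by rw [ENNReal.inv_mul_cancel (by norm_num) (by norm_num)]; ring
  intro s hs'
  have h4 : Tendsto (fun N : ℕ => 2 * ε + 2⁻¹ ^ N * (2 * Θ)) atTop (𝓝 (2 * ε + 0)) :=
    tendsto_const_nhds.add (geom_tendsto (by finiteness))
  rw [add_zero] at h4
  exact ge_of_tendsto' h4 fun N => key N s hs'

lemma WB.restr {d : ℕ} {T t : ℝ} {u : ℝ → Euc d → ℝ} {a : ℝ≥0∞} (h : WB d T u a) (ht : t ≤ T) : WB d t u a :=
  fun s hs => h s ⟨hs.1, hs.2.trans ht⟩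

lemma conv_meas (d : ℕ) {ρ₀ : Euc d → ℝ} (hρ : Measurable ρ₀) (t : ℝ) : Measurable (conv (heatKernel d t) ρ₀) :=
  (measurable_conv d hρ).comp (measurable_const.prodMk measurable_id)

lemma mild_diff {d : ℕ} {E : ℝ≥0∞} (hE : CC d E) (ρ₀ : Euc d → ℝ) {t : ℝ} (ht : 0 < t) {a : ℝ≥0∞} (ha : a ≠ ⊤)
    {u : ℝ → Euc d → ℝ} (hu : Measurable (Function.uncurry u)) (hub : WB d t u a) :
    eLpNorm (fun x => mildRHS d ρ₀ u t x - conv (heatKernel d t) ρ₀ x) 1 volume ≤ E * (a * a) := by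
  have h := (hE t ht ρ₀ u (fun _ _ => 0) hu measurable_const a 0 a ha (by simp) hub (WB_zero d t) (by simpa using hub)).1
  simpa [mild_zero] using h

lemma mild_L1 {d : ℕ} {E : ℝ≥0∞} (hE : CC d E) {ρ₀ : Euc d → ℝ} (hρ : Measurable ρ₀) {t : ℝ} (ht : 0 < t) {a : ℝ≥0∞} (ha : a ≠ ⊤)
    {u : ℝ → Euc d → ℝ} (hu : Measurable (Function.uncurry u)) (hub : WB d t u a) :
    eLpNorm (mildRHS d ρ₀ u t) 1 volume ≤ E * (a * a) + ∫⁻ x, ‖ρ₀ x‖ₑ := by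
  have e : mildRHS d ρ₀ u t = (fun x => mildRHS d ρ₀ u t x - conv (heatKernel d t) ρ₀ x) + conv (heatKernel d t) ρ₀ := by
    ext x; simp
  rw [e]
  have h1 := slice_meas (measurable_mild d hρ hu) t
  have h2 := conv_meas d hρ t
  refine (eLpNorm_add_le (h1.sub h2).aestronglyMeasurable h2.aestronglyMeasurable le_rfl).trans ?_
  exact add_le_add (mild_diff hE ρ₀ ht ha hu hub) (conv_L1 d hρ ht)

lemma mild_cont {d : ℕ} (hd : 1 ≤ d) {ρ₀ : Euc d → ℝ} (hρ : Measurable ρ₀) (hL : ∫⁻ x, ‖ρ₀ x‖ₑ ≠ ⊤) {T : ℝ} {a : ℝ≥0∞} (ha : a ≠ ⊤)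
    {u : ℝ → Euc d → ℝ} (hu : Measurable (Function.uncurry u)) (hub : WB d T u a) {t₀ : ℝ} (ht₀ : t₀ ∈ Set.Ioc (0:ℝ) T) :
    Tendsto (fun t => eLpNorm (fun x => mildRHS d ρ₀ u t x - mildRHS d ρ₀ u t₀ x) 1 volume) (𝓝[Set.Ioc (0:ℝ) T] t₀) (𝓝 0) := by
  obtain ⟨A, hA, hfl⟩ := flux_w1 d hd
  obtain ⟨c, hc, hdu⟩ := duh_bound d hd
  have hM := hfl T u hu a ha hub
  have hF := measurable_FF d hu
  have hfin : ∀ t ∈ Set.Ioc (0:ℝ) T, ∀ᵐ x, JJ (KK d t) (FF d u) x < ⊤ := fun t ht => by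
    apply ae_lt_top (measurable_JJ (measurable_KK' d t) hF)
    exact ne_top_of_le_ne_top (by finiteness) (hdu t ht.1 _ hF _ fun s hs => hM s ⟨hs.1, hs.2.trans ht.2⟩).1
  have h1 := (conv_cont d hρ hL ht₀.1).mono_left (nhdsWithin_le_nhds (s := Set.Ioc (0:ℝ) T))
  have h2 := duh_cont d hF (M := A * (a * a)) (by finiteness) hM ht₀
  have h3 := h1.add h2
  rw [add_zero] at h3
  refine tendsto_of_tendsto_of_tendsto_of_le_of_le' tendsto_const_nhds h3 (Eventually.of_forall fun _ => zero_le) ?_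
  filter_upwards [self_mem_nhdsWithin] with t ht
  rw [eLpNorm_one_eq_lintegral_enorm, eLpNorm_one_eq_lintegral_enorm]
  have hcm : Measurable fun x => ‖conv (heatKernel d t) ρ₀ x - conv (heatKernel d t₀) ρ₀ x‖ₑ :=
    ((conv_meas d hρ t).sub (conv_meas d hρ t₀)).enorm
  rw [← lintegral_add_left hcm]
  refine lintegral_mono_ae ?_
  filter_upwards [hfin t ht, hfin t₀ ht₀] with x hx hx₀
  rw [mildRHS_eq, mildRHS_eq]
  have e : conv (heatKernel d t) ρ₀ x - DD (KK d t) (FF d u) x - (conv (heatKernel d t₀) ρ₀ x - DD (KK d t₀) (FF d u) x) =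
    (conv (heatKernel d t) ρ₀ x - conv (heatKernel d t₀) ρ₀ x) - (DD (KK d t) (FF d u) x - DD (KK d t₀) (FF d u) x) := by ring
  rw [e, DD_sub' (measurable_KK' d t) (measurable_KK' d t₀) hF hx hx₀]
  exact enorm_sub_le.trans (add_le_add le_rfl (DD_le_JJ _ _ _))

lemma mild_cont0 {d : ℕ} (hd : 1 ≤ d) {E : ℝ≥0∞} (hEt : E ≠ ⊤) (hE : CC d E) {ρ₀ : Euc d → ℝ} (hρ : Measurable ρ₀)
    (hL : ∫⁻ x, ‖ρ₀ x‖ₑ ≠ ⊤)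
    {T : ℝ} (hT : 0 < T) {Θ : ℝ≥0∞} (hΘ : Θ ≠ ⊤) (hs : E * (2 * Θ + 2 * Θ) ≤ 1 / 2) {u : ℝ → Euc d → ℝ}
    (hu : Measurable (Function.uncurry u)) (hub : WB d T u (2 * Θ))
    (hfu : ∀ t ∈ Set.Ioc (0:ℝ) T, u t =ᵐ[volume] mildRHS d ρ₀ u t) :
    Tendsto (fun t => eLpNorm (fun x => mildRHS d ρ₀ u t x - ρ₀ x) 1 volume) (𝓝[>] 0) (𝓝 0) := by
  have hdiff : Tendsto (fun t => eLpNorm (fun x => mildRHS d ρ₀ u t x - conv (heatKernel d t) ρ₀ x) 1 volume) (𝓝[>] 0) (𝓝 0) := by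
    rw [ENNReal.tendsto_nhds_zero]
    intro ε hε
    have hc : Tendsto (fun η : ℝ => E * ((2 * ENNReal.ofReal η) * (2 * ENNReal.ofReal η))) (𝓝[>] 0) (𝓝 0) := by
      have h1 : Tendsto (fun η : ℝ => ENNReal.ofReal η) (𝓝[>] 0) (𝓝 0) := by
        have := (ENNReal.continuous_ofReal.tendsto 0).mono_left (nhdsWithin_le_nhds (s := Set.Ioi 0))
        rwa [ENNReal.ofReal_zero] at this
      have h2 := ENNReal.Tendsto.const_mul (a := 2) h1 (Or.inr (by simp))
      rw [mul_zero] at h2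
      have h3 := ENNReal.Tendsto.mul h2 (Or.inr (by simp)) h2 (Or.inr (by simp))
      have h4 := ENNReal.Tendsto.const_mul (a := E) h3 (Or.inr hEt)
      simpa only [mul_zero] using h4
    obtain ⟨η, hη, hη0⟩ := ((ENNReal.tendsto_nhds_zero.1 hc _ hε).and self_mem_nhdsWithin).exists
    obtain ⟨t₁, ht₁, hw⟩ := conv_small hd hρ hL (ε := ENNReal.ofReal η) (ENNReal.ofReal_pos.2 hη0)
    have hsm := u_small hd hE hρ hΘ hs hu (hub.restr (min_le_right t₁ T))
      (fun t ht => hfu t ⟨ht.1, ht.2.trans (min_le_right _ _)⟩) (hw.restr (min_le_left t₁ T))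
    filter_upwards [Ioc_mem_nhdsGT (lt_min ht₁ hT)] with t ht
    exact (mild_diff hE ρ₀ ht.1 (by finiteness) hu (hsm.restr ht.2)).trans hη
  have h3 := hdiff.add (conv_cont0 d hρ hL)
  rw [add_zero] at h3
  refine tendsto_of_tendsto_of_tendsto_of_le_of_le tendsto_const_nhds h3 (fun _ => zero_le) fun t => ?_
  have e : (fun x => mildRHS d ρ₀ u t x - ρ₀ x) = (fun x => mildRHS d ρ₀ u t x - conv (heatKernel d t) ρ₀ x) +
      fun x => conv (heatKernel d t) ρ₀ x - ρ₀ x := by ext x; simp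
  have h1 := slice_meas (measurable_mild d hρ hu) t
  have h2 := conv_meas d hρ t
  simp only
  rw [e]
  exact eLpNorm_add_le (h1.sub h2).aestronglyMeasurable (h2.sub hρ).aestronglyMeasurable le_rfl

/-- local existence and uniqueness of mild solutions of the mPKS equations
in `X_T^θ`, together with continuity in `L¹` down to `t = 0` and `ρ(0) = ρ₀`. -/
theorem mPKS_local_wellposedness (d : ℕ) (hd : 1 ≤ d) :
    ∃ θ : ℝ, 0 < θ ∧
      ∀ (ρ₀ : Euc d → ℝ), MemLp ρ₀ 1 volume → (∀ x, 0 ≤ ρ₀ x) →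
        ∀ T : ℝ, 0 < T →
          (∀ t ∈ Set.Ioc (0:ℝ) T,
            ENNReal.ofReal (t ^ (1/4 : ℝ)) *
              eLpNorm (conv (heatKernel d t) ρ₀) (qd d) volume ≤ ENNReal.ofReal θ) →
          ∃ ρ : ℝ → Euc d → ℝ,
            (IsMildSolution d ρ₀ T ρ ∧ MemXT d T ρ ∧
              (∀ t ∈ Set.Ioc (0:ℝ) T,
                ENNReal.ofReal (t ^ (1/4 : ℝ)) * eLpNorm (ρ t) (qd d) volume ≤
                  ENNReal.ofReal (2 * θ))) ∧
            (∀ ρ' : ℝ → Euc d → ℝ,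
              IsMildSolution d ρ₀ T ρ' → MemXT d T ρ' →
              (∀ t ∈ Set.Ioc (0:ℝ) T,
                ENNReal.ofReal (t ^ (1/4 : ℝ)) * eLpNorm (ρ' t) (qd d) volume ≤
                  ENNReal.ofReal (2 * θ)) →
              ∀ t ∈ Set.Ioc (0:ℝ) T, ρ' t =ᵐ[volume] ρ t) ∧
            (∀ x, ρ 0 x = ρ₀ x) ∧
            Filter.Tendsto (fun s => eLpNorm (fun x => ρ s x - ρ₀ x) 1 volume)
              (nhdsWithin 0 (Set.Ioc (0:ℝ) T)) (nhds 0) := by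
  obtain ⟨E, hEt, hE⟩ := contr d hd
  have hE : CC d E := hE
  have he : 0 ≤ E.toReal := ENNReal.toReal_nonneg
  refine ⟨1 / (8 * (E.toReal + 1)), by positivity, ?_⟩
  intro ρ₀ hL0 _ T hT hsm
  set θ : ℝ := 1 / (8 * (E.toReal + 1)) with hθ
  have hθ0 : 0 < θ := by positivity
  set Θ := ENNReal.ofReal θ with hΘd
  have hΘ : Θ ≠ ⊤ := ENNReal.ofReal_ne_top
  have hΘ0 : Θ ≠ 0 := (ENNReal.ofReal_pos.2 hθ0).ne'
  have h2Θ : ENNReal.ofReal (2 * θ) = 2 * Θ := by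
    rw [ENNReal.ofReal_mul (by norm_num)]; simp [hΘd]
  have hs : E * (2 * Θ + 2 * Θ) ≤ 1 / 2 := by
    have e1 : E * (2 * Θ + 2 * Θ) = ENNReal.ofReal (E.toReal * (2 * θ + 2 * θ)) := by
      rw [ENNReal.ofReal_mul he, ENNReal.ofReal_add (by positivity) (by positivity), h2Θ, ENNReal.ofReal_toReal hEt]
    have e2 : (1 / 2 : ℝ≥0∞) = ENNReal.ofReal (1 / 2) := by
      rw [ENNReal.ofReal_div_of_pos (by norm_num)]; simp
    rw [e1, e2]
    apply ENNReal.ofReal_le_ofReal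
    have h8 : E.toReal * (2 * θ + 2 * θ) = E.toReal / (E.toReal + 1) * (1 / 2) := by
      rw [hθ]; field_simp; ring
    rw [h8]
    have h9 : E.toReal / (E.toReal + 1) ≤ 1 := by
      rw [div_le_one (by positivity)]; linarith
    linarith
  -- measurable representative of the datum
  set ρ₁ := hL0.1.mk ρ₀ with hρ₁
  have hm : Measurable ρ₁ := hL0.1.stronglyMeasurable_mk.measurable
  have hae : ρ₀ =ᵐ[volume] ρ₁ := hL0.1.ae_eq_mk
  have hL : ∫⁻ x, ‖ρ₁ x‖ₑ ≠ ⊤ := by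
    rw [← eLpNorm_one_eq_lintegral_enorm, ← eLpNorm_congr_ae hae]
    exact hL0.2.ne
  have hcv : ∀ t, conv (heatKernel d t) ρ₁ = conv (heatKernel d t) ρ₀ := fun t => by
    ext x
    rw [← mild_zero, ← mild_zero, mild_congr0 d hae]
  have hsm1 : WB d T (fun t => conv (heatKernel d t) ρ₁) Θ := by
    intro t ht
    simp only [hcv]
    exact hsm t ht
  obtain ⟨u, hu, hub, hfu⟩ := fixed_point hd hE hm hΘ hΘ0 hs hsm1
  set ρ : ℝ → Euc d → ℝ := fun t x => if t ≤ 0 then ρ₀ x else mildRHS d ρ₁ u t x with hρ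
  have hρt : ∀ t, 0 < t → ρ t = mildRHS d ρ₁ u t := fun t ht => by
    ext x; simp [hρ, not_le.2 ht]
  have huρ : ∀ t ∈ Set.Ioc (0:ℝ) T, u t =ᵐ[volume] ρ t := fun t ht => by
    rw [hρt t ht.1]; exact hfu t ht
  have hΘ2 : 2 * Θ ≠ ⊤ := by finiteness
  have hρb : ∀ t ∈ Set.Ioc (0:ℝ) T, ENNReal.ofReal (t ^ (1/4 : ℝ)) * eLpNorm (ρ t) (qd d) volume ≤ 2 * Θ := by
    intro t ht
    rw [← eLpNorm_congr_ae (huρ t ht)]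
    exact hub t ht
  have hL1 : ∀ t ∈ Set.Ioc (0:ℝ) T, eLpNorm (ρ t) 1 volume ≤ E * ((2 * Θ) * (2 * Θ)) + ∫⁻ x, ‖ρ₁ x‖ₑ := by
    intro t ht
    rw [hρt t ht.1]
    exact mild_L1 hE hm ht.1 hΘ2 hu (hub.restr ht.2)
  have hCt : E * ((2 * Θ) * (2 * Θ)) + ∫⁻ x, ‖ρ₁ x‖ₑ ≠ ⊤ := by finiteness
  have hcont : ∀ t ∈ Set.Ioc (0:ℝ) T, Filter.Tendsto (fun s => eLpNorm (fun x => ρ s x - ρ t x) 1 volume)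
      (nhdsWithin t (Set.Ioc (0:ℝ) T)) (nhds 0) := by
    intro t ht
    refine (mild_cont hd hm hL hΘ2 hu hub ht).congr' ?_
    filter_upwards [self_mem_nhdsWithin] with s hs'
    rw [hρt s hs'.1, hρt t ht.1]
  refine ⟨ρ, ⟨?_, ⟨?_, hcont, ⟨_, hCt, hL1⟩, ⟨_, hΘ2, hρb⟩⟩, ?_⟩, ?_, ?_, ?_⟩
  · intro t ht x
    rw [hρt t ht.1, mild_congr0 d hae, mild_congr d ρ₁ (fun s hs' => huρ s ⟨hs'.1, hs'.2.trans ht.2⟩)]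
  · intro t ht
    refine ⟨?_, (hL1 t ht).trans_lt hCt.lt_top⟩
    rw [hρt t ht.1]
    exact (slice_meas (measurable_mild d hm hu) t).aestronglyMeasurable
  · intro t ht
    rw [h2Θ]; exact hρb t ht
  · intro ρ' hmild hX hb t ht
    obtain ⟨v, hv, hρv⟩ := meas_rep hX.1 hX.2.1
    have hvb : WB d T v (2 * Θ) := by
      have : WB d T ρ' (2 * Θ) := fun s hs' => by
        rw [← h2Θ]; exact hb s hs'
      exact this.congr hρv
    have hfv : ∀ s ∈ Set.Ioc (0:ℝ) T, v s =ᵐ[volume] mildRHS d ρ₁ v s := by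
      intro s hs'
      refine (hρv s hs').symm.trans (Eventually.of_forall fun x => ?_)
      rw [hmild s hs' x, mild_congr0 d hae, mild_congr d ρ₁ (fun r hr => hρv r ⟨hr.1, hr.2.trans hs'.2⟩)]
    have := unique_fp hd hE hΘ hs hu hv hub hvb hfu hfv t ht
    exact (hρv t ht).trans (this.symm.trans (huρ t ht))
  · intro x; simp [hρ]
  · have h0 := mild_cont0 hd hEt hE hm hL hT hΘ hs hu hub hfu
    have h1 := h0.mono_left (nhdsWithin_mono (0:ℝ) (Set.Ioc_subset_Ioi_self : Set.Ioc (0:ℝ) T ⊆ Set.Ioi 0))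
    refine h1.congr' ?_
    filter_upwards [self_mem_nhdsWithin] with s hs'
    rw [hρt s hs'.1]
    refine eLpNorm_congr_ae ?_
    filter_upwards [hae] with x hx
    rw [hx]

end
end

section
/- Let d ∈ ℕ, d ≥ 1, and let δ, ε ∈ ℝ with δ < −1/2 or ε < −1/2. Then there exists λ > 0, depending only on d, δ and ε, such that for every multi-index κ ∈ ℕ^d, Σ_{β+γ=κ} (κ!/(β! γ!)) |β|^{|β|+δ} |γ|^{|γ|+ε} ≤ λ |κ|^{|κ| + max{δ,ε}}, where the sum runs over all pairs of multi-indices β, γ ∈ ℕ^d with β + γ = κ. -/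
open MeasureTheory Real Filter
open scoped ENNReal BigOperators Topology

noncomputable section

/-- Real power with the convention `0^p = 1` for every real `p`. -/
noncomputable def cpow0 (a p : ℝ) : ℝ := if a = 0 then 1 else a ^ p

/-- Multi-index factorial `β! = β₁!⋯β_d!`. -/
def mfact {d : ℕ} (β : Fin d → ℕ) : ℕ := ∏ i, Nat.factorial (β i)

theorem kah_vander {d : ℕ} (κ : Fin d → ℕ) (g : ℕ → ℝ) :
    ∑ β ∈ Finset.Iic κ, ((mfact κ : ℝ) / ((mfact β : ℝ) * (mfact (κ - β) : ℝ))) * g (msize β) =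
      ∑ j ∈ Finset.range (msize κ + 1), ((msize κ).choose j : ℝ) * g j := by
  classical
  let L : Polynomial ℝ →ₗ[ℝ] ℝ := Polynomial.lsum (fun n => g n • LinearMap.id)
  have hL : ∀ (a : ℝ) (j : ℕ), L (Polynomial.C a * Polynomial.X ^ j) = a * g j := by
    intro a j
    rw [Polynomial.C_mul_X_pow_eq_monomial]
    simp [L, Polynomial.lsum_apply, Polynomial.sum_monomial_index, mul_comm]
  have h1 : ∀ n : ℕ, ((1 + Polynomial.X : Polynomial ℝ)) ^ n =
      ∑ j ∈ Finset.Iic n, Polynomial.C ((n.choose j : ℕ) : ℝ) * Polynomial.X ^ j := by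
    intro n
    rw [add_comm, add_pow]
    have : Finset.Iic n = Finset.range (n + 1) := by ext; simp [Nat.lt_succ_iff]
    rw [this]
    refine Finset.sum_congr rfl fun j _ => ?_
    simp [mul_comm]
  have h2 : ((1 + Polynomial.X : Polynomial ℝ)) ^ (msize κ) =
      ∑ β ∈ Finset.Iic κ, Polynomial.C ((mfact κ : ℝ) / ((mfact β : ℝ) * (mfact (κ - β) : ℝ)))
        * Polynomial.X ^ (msize β) := by
    have hI : Finset.Iic κ = Fintype.piFinset (fun i => Finset.Iic (κ i)) := by
      ext β; simp [Pi.le_def]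
    rw [msize, ← Finset.prod_pow_eq_pow_sum, hI]
    simp_rw [h1]
    rw [Finset.prod_univ_sum]
    refine Finset.sum_congr rfl fun β hβ => ?_
    rw [Finset.prod_mul_distrib, Finset.prod_pow_eq_pow_sum, ← map_prod]
    congr 2
    simp only [mfact, Nat.cast_prod]
    rw [← Finset.prod_mul_distrib, ← Finset.prod_div_distrib]
    refine Finset.prod_congr rfl fun i _ => ?_
    rw [Nat.cast_choose ℝ (by simpa using Fintype.mem_piFinset.1 hβ i)]
    rfl
  have h3 := congrArg L h2
  rw [h1] at h3
  simp only [map_sum, hL] at h3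
  rw [← h3]
  refine Finset.sum_congr ?_ fun _ _ => rfl
  ext; simp [Nat.lt_succ_iff]

theorem kah_binom : ∃ C : ℝ, 1 ≤ C ∧ ∀ j k : ℕ, j ≠ 0 → k ≠ 0 →
    ((j + k).choose j : ℝ) * (j : ℝ) ^ j * (k : ℝ) ^ k ≤
      C * ((j + k : ℕ) : ℝ) ^ (j + k) *
        (√((j + k : ℕ) : ℝ) / (√(j : ℝ) * √(k : ℝ))) := by
  have hf : ∀ n : ℕ, n ≠ 0 → (n.factorial : ℝ) =
      Stirling.stirlingSeq n * (√2 * √(n : ℝ) * ((n : ℝ) ^ n / Real.exp 1 ^ n)) := by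
    intro n hn
    have : (0 : ℝ) < n := by positivity
    rw [Stirling.stirlingSeq, Real.sqrt_mul (by norm_num), div_pow]
    field_simp
  have hlow : ∀ n : ℕ, n ≠ 0 → 1 ≤ Stirling.stirlingSeq n := by
    intro n hn
    refine le_trans ?_ (Stirling.sqrt_pi_le_stirlingSeq hn)
    rw [Real.one_le_sqrt]
    linarith [Real.pi_gt_three]
  have hup : ∀ n : ℕ, n ≠ 0 → Stirling.stirlingSeq n ≤ Stirling.stirlingSeq 1 := by
    intro n hn
    obtain ⟨m, rfl⟩ := Nat.exists_eq_succ_of_ne_zero hn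
    exact Stirling.stirlingSeq'_antitone (Nat.zero_le m)
  refine ⟨Stirling.stirlingSeq 1, hlow 1 one_ne_zero, ?_⟩
  intro j k hj hk
  have hjk : j + k ≠ 0 := by omega
  have hj' : (0 : ℝ) < j := by positivity
  have hk' : (0 : ℝ) < k := by positivity
  have hn' : (0 : ℝ) < ((j + k : ℕ) : ℝ) := by positivity
  have lj := hlow j hj
  have lk := hlow k hk
  have ljk := hup _ hjk
  have l1 := hlow 1 one_ne_zero
  have ln := hlow _ hjk
  have e : ((j + k).choose j : ℝ) * (j : ℝ) ^ j * (k : ℝ) ^ k =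
      (Stirling.stirlingSeq (j+k) / (Stirling.stirlingSeq j * Stirling.stirlingSeq k * √2)) *
      ((j + k : ℕ) : ℝ) ^ (j + k) * (√((j + k : ℕ) : ℝ) / (√(j : ℝ) * √(k : ℝ))) := by
    rw [Nat.cast_add_choose, hf _ hjk, hf _ hj, hf _ hk, pow_add (Real.exp 1)]
    generalize ((j + k : ℕ) : ℝ) = N at *
    have h2 : √(2:ℝ) ≠ 0 := by positivity
    have := (Real.sqrt_pos.2 hj').ne'
    have := (Real.sqrt_pos.2 hk').ne'
    have : Stirling.stirlingSeq j ≠ 0 := by positivity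
    have : Stirling.stirlingSeq k ≠ 0 := by positivity
    field_simp
  rw [e]
  have h2 : 1 ≤ √(2:ℝ) := by rw [Real.one_le_sqrt]; norm_num
  have : Stirling.stirlingSeq (j+k) / (Stirling.stirlingSeq j * Stirling.stirlingSeq k * √2)
      ≤ Stirling.stirlingSeq 1 := by
    refine (div_le_self (by linarith) ?_).trans ljk
    exact one_le_mul_of_one_le_of_one_le (one_le_mul_of_one_le_of_one_le lj lk) h2
  gcongr

theorem kah_half (p k n : ℝ) (hn : 0 < n) (h1 : n / 2 ≤ k) (h2 : k ≤ n) :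
    k ^ p ≤ 2 ^ |p| * n ^ p := by
  have hk : 0 < k := by linarith
  rcases le_total 0 p with hp | hp
  · have : k ^ p ≤ n ^ p := Real.rpow_le_rpow hk.le h2 hp
    have h1 : (1:ℝ) ≤ 2 ^ |p| := Real.one_le_rpow (by norm_num) (abs_nonneg _)
    have : 0 ≤ n ^ p := by positivity
    nlinarith
  · have : k ^ p ≤ (n / 2) ^ p := Real.rpow_le_rpow_of_nonpos (by positivity) h1 hp
    rw [Real.div_rpow hn.le (by norm_num)] at this
    rw [abs_of_nonpos hp, Real.rpow_neg (by norm_num)]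
    rw [div_eq_inv_mul] at this
    exact this

/-- middle terms -/
theorem kah_mid (δ ε : ℝ) (hδ : δ < -(1/2)) (j k : ℝ) (hj : 1 ≤ j) (hk : 1 ≤ k) :
    (j + k) ^ (1/2 : ℝ) * j ^ (δ - 1/2) * k ^ (ε - 1/2) ≤
      (2 ^ |δ - 1/2| + 2 ^ |ε - 1/2|) * (j + k) ^ (max δ ε) *
        (j ^ (δ - 1/2) + k ^ (δ - 1/2)) := by
  have hn : 0 < j + k := by linarith
  have hj0 : 0 < j := by linarith
  have hk0 : 0 < k := by linarith
  set m := max δ ε with hm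
  set n := j + k with hnn
  have hA : (0:ℝ) < 2 ^ |δ - 1/2| := by positivity
  have hB : (0:ℝ) < 2 ^ |ε - 1/2| := by positivity
  have hJ : 0 < j ^ (δ - 1/2) := by positivity
  have hK : 0 < k ^ (δ - 1/2) := by positivity
  have hN : 0 < n ^ m := by positivity
  have hdm : δ ≤ m := le_max_left _ _
  have hem : ε ≤ m := le_max_right _ _
  rcases le_total j k with hjk | hjk
  · have h1 := kah_half (ε - 1/2) k n hn (by linarith) (by linarith)
    have h2 : n ^ (1/2 : ℝ) * n ^ (ε - 1/2) ≤ n ^ m := by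
      rw [← Real.rpow_add hn]
      exact Real.rpow_le_rpow_of_exponent_le (by linarith) (by linarith)
    calc n ^ (1/2 : ℝ) * j ^ (δ - 1/2) * k ^ (ε - 1/2)
        ≤ n ^ (1/2 : ℝ) * j ^ (δ - 1/2) * (2 ^ |ε - 1/2| * n ^ (ε - 1/2)) := by gcongr
      _ = 2 ^ |ε - 1/2| * (n ^ (1/2 : ℝ) * n ^ (ε - 1/2)) * j ^ (δ - 1/2) := by ring
      _ ≤ 2 ^ |ε - 1/2| * n ^ m * j ^ (δ - 1/2) := by gcongr
      _ ≤ _ := by gcongr <;> linarith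
  · have h1 := kah_half (δ - 1/2) j n hn (by linarith) (by linarith)
    have h2 : n ^ (1/2 : ℝ) * n ^ (δ - 1/2) * k ^ (ε - 1/2) ≤ n ^ m * k ^ (δ - 1/2) := by
      rw [← Real.rpow_add hn]
      have e1 : (1/2 : ℝ) + (δ - 1/2) = m + (δ - m) := by ring
      rw [e1, Real.rpow_add hn, mul_assoc]
      have h3 : n ^ (δ - m) ≤ k ^ (δ - m) :=
        Real.rpow_le_rpow_of_nonpos hk0 (by linarith) (by linarith)
      have h4 : k ^ (δ - m) * k ^ (ε - 1/2) ≤ k ^ (δ - 1/2) := by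
        rw [← Real.rpow_add hk0]
        exact Real.rpow_le_rpow_of_exponent_le hk (by linarith)
      calc n ^ m * (n ^ (δ - m) * k ^ (ε - 1/2))
          ≤ n ^ m * (k ^ (δ - m) * k ^ (ε - 1/2)) := by gcongr
        _ ≤ _ := by gcongr
    calc n ^ (1/2 : ℝ) * j ^ (δ - 1/2) * k ^ (ε - 1/2)
        ≤ n ^ (1/2 : ℝ) * (2 ^ |δ - 1/2| * n ^ (δ - 1/2)) * k ^ (ε - 1/2) := by gcongr
      _ = 2 ^ |δ - 1/2| * (n ^ (1/2 : ℝ) * n ^ (δ - 1/2) * k ^ (ε - 1/2)) := by ring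
      _ ≤ 2 ^ |δ - 1/2| * (n ^ m * k ^ (δ - 1/2)) := by gcongr
      _ = 2 ^ |δ - 1/2| * n ^ m * k ^ (δ - 1/2) := by ring
      _ ≤ _ := by gcongr <;> linarith

theorem kah_term (δ ε : ℝ) (hδ : δ < -(1/2)) : ∃ C : ℝ, 0 < C ∧ ∀ j k : ℕ,
    ((j + k).choose j : ℝ) * (cpow0 j (j + δ) * cpow0 k (k + ε)) ≤
      C * cpow0 ((j + k : ℕ) : ℝ) (((j + k : ℕ) : ℝ) + max δ ε) *
        (cpow0 j (δ - 1/2) + cpow0 k (δ - 1/2)) := by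
  obtain ⟨C, hC, hb⟩ := kah_binom
  set D : ℝ := 2 ^ |δ - 1/2| + 2 ^ |ε - 1/2| with hD
  have hD1 : 1 ≤ D := by
    have h1 : (1:ℝ) ≤ 2 ^ |δ - 1/2| := Real.one_le_rpow (by norm_num) (abs_nonneg _)
    have : (0:ℝ) < 2 ^ |ε - 1/2| := by positivity
    linarith
  have hCD : 1 ≤ C * D := one_le_mul_of_one_le_of_one_le hC hD1
  have cnn : ∀ (n : ℕ) (p : ℝ), 0 ≤ cpow0 n p := by
    intro n p; unfold cpow0; split_ifs <;> positivity
  have cmono : ∀ (n : ℕ) (p q : ℝ), p ≤ q → cpow0 n p ≤ cpow0 n q := by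
    intro n p q hpq; unfold cpow0; split_ifs with h
    · exact le_rfl
    · have : n ≠ 0 := by rintro rfl; simp at h
      exact Real.rpow_le_rpow_of_exponent_le (by exact_mod_cast Nat.one_le_iff_ne_zero.2 this) hpq
  refine ⟨C * D, by linarith, fun j k => ?_⟩
  have key : ∀ A B w : ℝ, 0 ≤ A → A ≤ B → 0 ≤ w → A ≤ C * D * B * (1 + w) := by
    intro A B w hA hAB hw
    have : 1 * A ≤ C * D * B := by gcongr
    nlinarith [mul_nonneg (hA.trans (by linarith : A ≤ C * D * B)) hw]
  have c0 : ∀ p, cpow0 ((0:ℕ):ℝ) p = 1 := by intro p; simp [cpow0]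
  rcases eq_or_ne j 0 with rfl | hj
  · rw [c0, c0, zero_add, Nat.choose_zero_right, Nat.cast_one, one_mul, one_mul]
    exact key _ _ _ (cnn _ _) (cmono _ _ _ (by linarith [le_max_right δ ε])) (cnn _ _)
  rcases eq_or_ne k 0 with rfl | hk
  · rw [c0, c0, add_zero, Nat.choose_self, Nat.cast_one, one_mul, mul_one, add_comm _ (1:ℝ)]
    exact key _ _ _ (cnn _ _) (cmono _ _ _ (by linarith [le_max_left δ ε])) (cnn _ _)
  have hj' : (0 : ℝ) < j := by positivity
  have hk' : (0 : ℝ) < k := by positivity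
  have hn' : (0 : ℝ) < ((j + k : ℕ) : ℝ) := by positivity
  have hj1 : (1 : ℝ) ≤ j := by exact_mod_cast Nat.one_le_iff_ne_zero.2 hj
  have hk1 : (1 : ℝ) ≤ k := by exact_mod_cast Nat.one_le_iff_ne_zero.2 hk
  have hmid := kah_mid δ ε hδ j k hj1 hk1
  rw [← hD, ← Nat.cast_add] at hmid
  have hb' := hb j k hj hk
  have ce : ∀ (n : ℝ) p, 0 < n → cpow0 n p = n ^ p := by
    intro n p hn; simp [cpow0, hn.ne']
  rw [ce _ _ hj', ce _ _ hk', ce _ _ hn', ce _ _ hj', ce _ _ hk']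
  rw [Real.rpow_add hj', Real.rpow_add hk', Real.rpow_add hn', Real.rpow_natCast,
    Real.rpow_natCast, Real.rpow_natCast]
  have sj : (j:ℝ) ^ (δ - 1/2) = (j:ℝ) ^ δ / √(j:ℝ) := by
    rw [Real.rpow_sub hj', Real.sqrt_eq_rpow]
  have sk : (k:ℝ) ^ (ε - 1/2) = (k:ℝ) ^ ε / √(k:ℝ) := by
    rw [Real.rpow_sub hk', Real.sqrt_eq_rpow]
  calc ((j + k).choose j : ℝ) * ((j:ℝ) ^ j * (j:ℝ) ^ δ * ((k:ℝ) ^ k * (k:ℝ) ^ ε))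
      = (((j + k).choose j : ℝ) * (j : ℝ) ^ j * (k : ℝ) ^ k) * ((j:ℝ) ^ δ * (k:ℝ) ^ ε) := by ring
    _ ≤ (C * ((j + k : ℕ) : ℝ) ^ (j + k) *
        (√((j + k : ℕ) : ℝ) / (√(j : ℝ) * √(k : ℝ)))) * ((j:ℝ) ^ δ * (k:ℝ) ^ ε) := by gcongr
    _ = C * ((j + k : ℕ) : ℝ) ^ (j + k) *
        (((j + k : ℕ) : ℝ) ^ (1/2 : ℝ) * (j:ℝ) ^ (δ - 1/2) * (k:ℝ) ^ (ε - 1/2)) := by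
        rw [sj, sk, ← Real.sqrt_eq_rpow]
        have := (Real.sqrt_pos.2 hj').ne'
        have := (Real.sqrt_pos.2 hk').ne'
        field_simp
    _ ≤ C * ((j + k : ℕ) : ℝ) ^ (j + k) * (D * ((j + k : ℕ) : ℝ) ^ max δ ε *
        ((j:ℝ) ^ (δ - 1/2) + (k:ℝ) ^ (δ - 1/2))) := by gcongr
    _ = _ := by ring

theorem kah_one (δ ε : ℝ) (hδ : δ < -(1/2)) : ∃ lam : ℝ, 0 < lam ∧ ∀ n : ℕ,
    ∑ j ∈ Finset.range (n + 1), (n.choose j : ℝ) *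
      (cpow0 j (j + δ) * cpow0 ((n - j : ℕ) : ℝ) (((n - j : ℕ) : ℝ) + ε)) ≤
      lam * cpow0 n (n + max δ ε) := by
  obtain ⟨C, hC, hb⟩ := kah_term δ ε hδ
  have cnn : ∀ (n : ℕ) (p : ℝ), 0 ≤ cpow0 n p := by
    intro n p; unfold cpow0; split_ifs <;> positivity
  have hs : Summable (fun n : ℕ => cpow0 n (δ - 1/2)) := by
    rw [← summable_nat_add_iff 1]
    have := (summable_nat_add_iff 1).2 (Real.summable_nat_rpow.2 (show δ - 1/2 < -1 by linarith))
    refine this.congr fun n => ?_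
    unfold cpow0
    rw [if_neg (by positivity)]
  set S := ∑' n : ℕ, cpow0 n (δ - 1/2) with hS
  have hS0 : 0 ≤ S := tsum_nonneg fun n => cnn _ _
  refine ⟨C * (2 * S + 1), by positivity, fun n => ?_⟩
  have hle : ∑ j ∈ Finset.range (n + 1), cpow0 (j : ℝ) (δ - 1/2) ≤ S :=
    hs.sum_le_tsum _ fun _ _ => cnn _ _
  have hr : ∑ j ∈ Finset.range (n + 1), cpow0 ((n - j : ℕ) : ℝ) (δ - 1/2) =
      ∑ j ∈ Finset.range (n + 1), cpow0 (j : ℝ) (δ - 1/2) := by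
    have := Finset.sum_range_reflect (fun j : ℕ => cpow0 (j : ℝ) (δ - 1/2)) (n + 1)
    simpa using this
  have hn := cnn n (n + max δ ε)
  calc _ ≤ ∑ j ∈ Finset.range (n + 1), C * cpow0 n (n + max δ ε) *
        (cpow0 j (δ - 1/2) + cpow0 ((n - j : ℕ) : ℝ) (δ - 1/2)) := by
        refine Finset.sum_le_sum fun j hj => ?_
        have hjn : j + (n - j) = n := by
          have := Finset.mem_range.1 hj
          omega
        have := hb j (n - j)
        rwa [hjn] at this
    _ = C * cpow0 n (n + max δ ε) * (2 * ∑ j ∈ Finset.range (n + 1), cpow0 (j : ℝ) (δ - 1/2)) := by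
        rw [← Finset.mul_sum, Finset.sum_add_distrib, hr]; ring
    _ ≤ C * cpow0 n (n + max δ ε) * (2 * S + 1) := by gcongr; linarith
    _ = _ := by ring

theorem kah_two (δ ε : ℝ) (h : δ < -(1/2) ∨ ε < -(1/2)) : ∃ lam : ℝ, 0 < lam ∧ ∀ n : ℕ,
    ∑ j ∈ Finset.range (n + 1), (n.choose j : ℝ) *
      (cpow0 j (j + δ) * cpow0 ((n - j : ℕ) : ℝ) (((n - j : ℕ) : ℝ) + ε)) ≤
      lam * cpow0 n (n + max δ ε) := by
  rcases h with h | h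
  · exact kah_one δ ε h
  · obtain ⟨lam, hl, hb⟩ := kah_one ε δ h
    refine ⟨lam, hl, fun n => ?_⟩
    rw [max_comm]
    refine le_trans (le_of_eq ?_) (hb n)
    rw [← Finset.sum_range_reflect]
    refine Finset.sum_congr rfl fun j hj => ?_
    have hj' : j ≤ n := by have := Finset.mem_range.1 hj; omega
    have e1 : n + 1 - 1 - j = n - j := by omega
    have e2 : n - (n - j) = j := by omega
    rw [e1, e2, Nat.choose_symm hj']
    ring

/-- Kahane's combinatorial lemma on multi-index sequences. -/
theorem kahane_multiindex_sum_bound (d : ℕ) (hd : 1 ≤ d) (δ ε : ℝ)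
    (h : δ < -(1/2) ∨ ε < -(1/2)) :
    ∃ lam : ℝ, 0 < lam ∧
      ∀ κ : Fin d → ℕ,
        ∑ β ∈ Finset.Iic κ,
            ((mfact κ : ℝ) / ((mfact β : ℝ) * (mfact (κ - β) : ℝ))) *
              cpow0 (msize β : ℝ) ((msize β : ℝ) + δ) *
              cpow0 (msize (κ - β) : ℝ) ((msize (κ - β) : ℝ) + ε) ≤
          lam * cpow0 (msize κ : ℝ) ((msize κ : ℝ) + max δ ε) := by
  obtain ⟨lam, hl, hb⟩ := kah_two δ ε h
  refine ⟨lam, hl, fun κ => ?_⟩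
  refine le_trans (le_of_eq ?_) (hb (msize κ))
  rw [← kah_vander κ (fun j => cpow0 j (j + δ) *
    cpow0 ((msize κ - j : ℕ) : ℝ) (((msize κ - j : ℕ) : ℝ) + ε))]
  refine Finset.sum_congr rfl fun β hβ => ?_
  have hβ' : β ≤ κ := Finset.mem_Iic.1 hβ
  have : msize (κ - β) = msize κ - msize β := by
    have h1 : msize (κ - β) + msize β = msize κ := by
      unfold msize
      rw [← Finset.sum_add_distrib]
      exact Finset.sum_congr rfl fun i _ => Nat.sub_add_cancel (hβ' i)
    omega
  rw [this, mul_assoc]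

end
end
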